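/- Let B be a von Neumann algebra, I a set, and for every ι ∈ I let A_ι and D_ι be von Neumann algebras containing copies of B as unital von Neumann subalgebras, with normal conditional expectations φ_ι : A_ι → B and ψ_ι : D_ι → B whose GNS representations are faithful. Suppose that for each ι ∈ I there is a normal unital completely positive map θ_ι : A_ι → D_ι that is also a B–B-bimodule map and satisfies ψ_ι∘θ_ι = φ_ι. Let (A,φ) = (*̄_B)_{ι∈I}(A_ι,φ_ι) and (D,ψ) = (*̄_B)_{ι∈I}(D_ι,ψ_ι) be the amalgamated free products of von Neumann algebras. Then there is a NORMAL unital completely positive map θ : A → D such that the restriction of θ to the canonical copy of A_ι in A equals θ_ι followed by the canonical embedding D_ι ↪ D for every ι ∈ I, and θ(a₁a₂⋯aₙ) = θ(a₁)θ(a₂)⋯θ(aₙ) whenever a_j ∈ A_{ι_j} ∩ ker φ_{ι_j} with ι₁ ≠ ι₂, ι₂ ≠ ι₃, …, ι_{n−1} ≠ ιₙ. -/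

import Mathlib

noncomputable section

/-- A conditional expectation from a unital C⋆-algebra `A` onto a unital C⋆-subalgebra
(the range of the unital embedding `j : B →⋆ₐ[ℂ] A`): a positive, `B`–`B`-bimodule,
idempotent (i.e. restricting to the identity on `B`) contraction. -/
structure IsCondExp {B A : Type*} [CStarAlgebra B] [CStarAlgebra A]
    (j : B →⋆ₐ[ℂ] A) (E : A →ₗ[ℂ] B) : Prop where
  injective : Function.Injective j
  left_inverse : ∀ b : B, E (j b) = b
  bimodule : ∀ (b₁ b₂ : B) (a : A), E (j b₁ * a * j b₂) = b₁ * E a * b₂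
  positive : ∀ a : A, ∃ b : B, E (star a * a) = star b * b
  contractive : ∀ a : A, ‖E a‖ ≤ ‖a‖

/-- The GNS representation of a conditional expectation `E : A → B` (i.e. the left action
of `A` on the Hilbert `B`-module `L²(A,E)` obtained from `A` by separation and completion
with respect to the `B`-valued inner product `⟨a₁, a₂⟩ = E (a₁⋆ * a₂)`) is faithful:
`a` acts as zero on the image of `A` in `L²(A,E)` only if `a = 0`. -/
def FaithfulGNS {B A : Type*} [CStarAlgebra B] [CStarAlgebra A] (E : A →ₗ[ℂ] B) : Prop :=
  ∀ a : A, (∀ x : A, E (star (a * x) * (a * x)) = 0) → a = 0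

/-- `(C, jC, emb, E)` is the reduced amalgamated free product of the unital C⋆-algebras
`A i` over `B` with respect to the conditional expectations `φ i : A i → B` (each having
faithful GNS representation): the `A i` embed into `C` compatibly with the copies of `B`,
`E` is a conditional expectation onto `B` with faithful GNS representation restricting to
`φ i` on each `A i`, the family of copies of the `A i` is free with respect to `E`, and
the copies of the `A i` together generate `C` as a C⋆-algebra.  These properties
characterize the reduced amalgamated free product `(A,φ) = (*_B)_{i ∈ I} (A i, φ i)`
up to canonical isomorphism. -/
structure IsReducedAmalgProd (B : Type*) [CStarAlgebra B] {I : Type*} {A : I → Type*}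
    [∀ i, CStarAlgebra (A i)] (jB : ∀ i, B →⋆ₐ[ℂ] A i) (φ : ∀ i, A i →ₗ[ℂ] B)
    {C : Type*} [CStarAlgebra C] (jC : B →⋆ₐ[ℂ] C) (emb : ∀ i, A i →⋆ₐ[ℂ] C)
    (E : C →ₗ[ℂ] B) : Prop where
  emb_injective : ∀ i, Function.Injective (emb i)
  compat : ∀ i, (emb i).comp (jB i) = jC
  condExp : IsCondExp jC E
  restrict : ∀ i (a : A i), E (emb i a) = φ i a
  faithful : FaithfulGNS E
  free : ∀ (n : ℕ) (ι : Fin (n + 1) → I), (∀ k : Fin n, ι k.castSucc ≠ ι k.succ) →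
    ∀ a : (j : Fin (n + 1)) → A (ι j), (∀ j, φ (ι j) (a j) = 0) →
      E ((List.ofFn fun j => emb (ι j) (a j)).prod) = 0
  generating :
    Dense ((StarAlgebra.adjoin ℂ (⋃ i, Set.range (emb i)) : StarSubalgebra ℂ C) : Set C)

/-- A completely positive map between unital C⋆-algebras. -/
def IsCompletelyPositive {A D : Type*} [CStarAlgebra A] [CStarAlgebra D]
    (θ : A →ₗ[ℂ] D) : Prop :=
  ∀ (n : ℕ) (a : Fin n → A) (c : Fin n → D),
    ∃ d : D, ∑ i, ∑ j, star (c i) * θ (star (a i) * a j) * c j = star d * d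

open scoped ComplexOrder

/-- A positive linear functional `f` on a von Neumann algebra `M` is *normal* if it is
completely additive, i.e. it preserves the suprema of nonempty bounded directed families
of elements of `M` (equivalently, `f` is σ-weakly continuous). -/
def IsNormalPosFunctional {M : Type*} [CStarAlgebra M] [PartialOrder M]
    (f : M →ₗ[ℂ] ℂ) : Prop :=
  (∀ a : M, ∃ c : ℂ, f (star a * a) = star c * c) ∧
  ∀ (s : Set M) (x : M), s.Nonempty → DirectedOn (· ≤ ·) s → IsLUB s x →
    Filter.Tendsto (fun p : s => f p) Filter.atTop (nhds (f x))

/-- The σ-weak topology on a von Neumann algebra `M`: the weak topology `σ(M, M_⋆)`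
induced by the predual `M_⋆`, i.e. by the normal (positive) linear functionals on `M`. -/
def sigmaWeak (M : Type*) [CStarAlgebra M] [PartialOrder M] : TopologicalSpace M :=
  TopologicalSpace.induced
    (fun m => fun f : { f : M →ₗ[ℂ] ℂ // IsNormalPosFunctional f } => f.1 m) inferInstance

/-- A map between von Neumann algebras is *normal* if it is σ-weakly continuous. -/
def IsNormalMap {M N : Type*} [CStarAlgebra M] [PartialOrder M] [CStarAlgebra N]
    [PartialOrder N] (θ : M → N) : Prop :=
  @Continuous M N (sigmaWeak M) (sigmaWeak N) θ

/-- A normal state on a von Neumann algebra: a unital normal positive linear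
functional. -/
def IsNormalState {M : Type*} [CStarAlgebra M] [PartialOrder M] (ψ : M →ₗ[ℂ] ℂ) : Prop :=
  ψ 1 = 1 ∧ IsNormalPosFunctional ψ

/-- `(M, jC, emb, E)` is the amalgamated free product
`(A, φ) = (⋆̄_B)_{i ∈ I}(A i, φ i)` of the von Neumann algebras `A i` over `B` with
respect to the normal conditional expectations `φ i : A i → B` (each having faithful GNS
representation).  It is obtained from the C⋆-algebra reduced amalgamated free product
`(𝒜, φ₀)` by taking the weak closure in the GNS representation of the state `ψ ∘ φ₀`,
for any normal state `ψ` on `B` with faithful GNS representation, and is characterized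
by the following properties: the `A i` embed normally into `M` compatibly with the
copies of `B`, `E` is a normal conditional expectation onto `B` with faithful GNS
representation restricting to `φ i` on each `A i`, the family of copies of the `A i` is
free with respect to `E`, and the copies of the `A i` generate `M` as a von Neumann
algebra (i.e. they generate a σ-weakly dense ⋆-subalgebra). -/
structure IsVNAmalgProd (B : Type*) [CStarAlgebra B] [PartialOrder B] [StarOrderedRing B]
    [WStarAlgebra B] {I : Type*} {A : I → Type*} [∀ i, CStarAlgebra (A i)]
    [∀ i, PartialOrder (A i)] [∀ i, StarOrderedRing (A i)] [∀ i, WStarAlgebra (A i)]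
    (jB : ∀ i, B →⋆ₐ[ℂ] A i) (φ : ∀ i, A i →ₗ[ℂ] B)
    {M : Type*} [CStarAlgebra M] [PartialOrder M] [StarOrderedRing M] [WStarAlgebra M]
    (jC : B →⋆ₐ[ℂ] M) (emb : ∀ i, A i →⋆ₐ[ℂ] M) (E : M →ₗ[ℂ] B) : Prop where
  emb_injective : ∀ i, Function.Injective (emb i)
  emb_normal : ∀ i, IsNormalMap (emb i)
  compat : ∀ i, (emb i).comp (jB i) = jC
  condExp : IsCondExp jC E
  normal : IsNormalMap E
  restrict : ∀ i (a : A i), E (emb i a) = φ i a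
  faithful : FaithfulGNS E
  free : ∀ (n : ℕ) (ι : Fin (n + 1) → I), (∀ k : Fin n, ι k.castSucc ≠ ι k.succ) →
    ∀ a : (j : Fin (n + 1)) → A (ι j), (∀ j, φ (ι j) (a j) = 0) →
      E ((List.ofFn fun j => emb (ι j) (a j)).prod) = 0
  generating : @Dense M (sigmaWeak M)
    ((StarAlgebra.adjoin ℂ (⋃ i, Set.range (emb i)) : StarSubalgebra ℂ M) : Set M)

open Filter Topology

open scoped InnerProductSpace

section OrderLemmas

variable {M : Type*} [CStarAlgebra M] [PartialOrder M] [StarOrderedRing M]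

lemma IsSelfAdjoint.le_smul_one {a : M} (ha : IsSelfAdjoint a) {r : ℝ} (h : ‖a‖ ≤ r) :
    a ≤ r • (1 : M) := by
  refine (ha.le_algebraMap_norm_self).trans ?_
  rw [← Algebra.algebraMap_eq_smul_one]
  exact algebraMap_mono M h

lemma IsSelfAdjoint.neg_smul_one_le {a : M} (ha : IsSelfAdjoint a) {r : ℝ} (h : ‖a‖ ≤ r) :
    -(r • (1 : M)) ≤ a := by
  have := ha.neg.le_smul_one (r := r) (by simpa using h)
  exact neg_le.mp this

lemma norm_le_of_neg_le_of_le {a : M} {r : ℝ} (hr : 0 ≤ r) (h₁ : -(r • (1 : M)) ≤ a)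
    (h₂ : a ≤ r • (1 : M)) : ‖a‖ ≤ r := by
  rcases subsingleton_or_nontrivial M with hM | hM
  · rw [Subsingleton.elim a 0, norm_zero]; exact hr
  have ha : IsSelfAdjoint a := by
    have h : IsSelfAdjoint (a + r • (1 : M)) :=
      IsSelfAdjoint.of_nonneg (by simpa using add_le_add_left h₁ (r • (1 : M)))
    simpa using h.sub ((IsSelfAdjoint.all r).smul (IsSelfAdjoint.one M))
  rw [← Algebra.algebraMap_eq_smul_one] at h₁ h₂
  rw [← map_neg] at h₁
  rw [algebraMap_le_iff_le_spectrum (ha := ha)] at h₁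
  rw [le_algebraMap_iff_spectrum_le (ha := ha)] at h₂
  rcases CStarAlgebra.norm_or_neg_norm_mem_spectrum ha with h | h
  · exact h₂ _ h
  · linarith [h₁ _ h]

lemma le_zero_of_forall_le_smul {a b : M} (h : ∀ s : ℝ, 0 < s → s ≤ 1 → a ≤ s • b) : a ≤ 0 := by
  have ht : Tendsto (fun s : ℝ => s • b) (𝓝[>] 0) (𝓝 ((0 : ℝ) • b)) :=
    ((continuous_id.smul continuous_const).tendsto 0).mono_left nhdsWithin_le_nhds
  rw [zero_smul] at ht
  refine ge_of_tendsto ht ?_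
  filter_upwards [Ioc_mem_nhdsGT (zero_lt_one' ℝ)] with s hs
  exact h s hs.1 hs.2

lemma eq_zero_of_forall_smul_le {a b : M} (h : ∀ t : ℝ, t • a ≤ b) : a = 0 := by
  have key : ∀ c : M, (∀ t : ℝ, 0 < t → t • c ≤ b) → c ≤ 0 := by
    intro c hc
    refine le_zero_of_forall_le_smul (b := b) fun s hs _ => ?_
    have := smul_le_smul_of_nonneg_left (hc s⁻¹ (by positivity)) hs.le
    rwa [smul_smul, mul_inv_cancel₀ hs.ne', one_smul] at this
  refine le_antisymm (key a fun t _ => h t) ?_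
  have := key (-a) fun t _ => by simpa using h (-t)
  simpa using this

lemma nonneg_of_norm_sub_le {x : M} (hx : IsSelfAdjoint x) {r : ℝ} (h : ‖r • (1 : M) - x‖ ≤ r) :
    0 ≤ x := by
  have := (((IsSelfAdjoint.all r).smul (IsSelfAdjoint.one M)).sub hx).le_smul_one h
  simpa using this

lemma IsSelfAdjoint.of_norm_smul_le {p q : M} (hp : IsSelfAdjoint p) (hq : IsSelfAdjoint q) {r : ℝ}
    (h : ∀ t : ℝ, ‖p + Complex.I • q + t • Complex.I • (1 : M)‖ ^ 2 ≤ r ^ 2 + t ^ 2) : q = 0 := by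
  refine eq_zero_of_forall_smul_le (b := (r ^ 2 / 2) • (1 : M)) fun t => ?_
  have h1 : ‖q + t • (1 : M)‖ ≤ ‖p + Complex.I • q + t • Complex.I • (1 : M)‖ := by
    set z := p + Complex.I • q + t • Complex.I • (1 : M) with hz
    have h2 : (2 * Complex.I) • (q + t • (1 : M)) = z - star z := by
      simp only [hz, star_add, star_smul, hp.star_eq, hq.star_eq, star_one, Complex.star_def,
        Complex.conj_I, star_trivial]
      module
    have h3 := congrArg norm h2
    rw [norm_smul] at h3
    have h4 : ‖z - star z‖ ≤ ‖z‖ + ‖z‖ := by simpa using norm_sub_le z (star z)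
    simp at h3
    linarith
  have hsa : IsSelfAdjoint (q + t • (1 : M)) :=
    hq.add ((IsSelfAdjoint.all t).smul (IsSelfAdjoint.one M))
  have h2 : ‖(q + t • (1 : M)) * (q + t • (1 : M))‖ ≤ r ^ 2 + t ^ 2 := by
    refine (norm_mul_le _ _).trans ?_
    rw [← sq]
    exact (pow_le_pow_left₀ (norm_nonneg _) h1 2).trans (h t)
  have h3 := (show IsSelfAdjoint ((q + t • (1 : M)) * (q + t • (1 : M))) by
    simpa [hsa.star_eq] using IsSelfAdjoint.star_mul_self (q + t • (1 : M))).le_smul_one h2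
  have h4 : 0 ≤ q * q := by simpa [hq.star_eq] using star_mul_self_nonneg q
  have h5 : (q + t • (1 : M)) * (q + t • (1 : M)) = q * q + (2 : ℝ) • t • q + t ^ 2 • (1 : M) := by
    simp only [add_mul, mul_add, smul_mul_assoc, mul_smul_comm, one_mul, mul_one, smul_smul]
    module
  rw [h5, add_smul, add_le_add_iff_right] at h3
  have h6 : (2 : ℝ) • t • q ≤ r ^ 2 • (1 : M) := (le_add_of_nonneg_left h4).trans h3
  have := smul_le_smul_of_nonneg_left h6 (show (0 : ℝ) ≤ 1 / 2 by norm_num)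
  convert this using 1 <;> module

end OrderLemmas

section Predual

variable {M : Type*} [CStarAlgebra M]
  {X : Type*} [NormedAddCommGroup X] [NormedSpace ℂ X] (e : StrongDual ℂ X ≃ₗᵢ⋆[ℂ] M)

/-- The functional on `M` given by an element of a predual. -/
def predualPairing (k : X) : M →ₗ[ℂ] ℂ where
  toFun m := star (e.symm m k)
  map_add' a b := by simp
  map_smul' c a := by simp [map_smulₛₗ]

lemma norm_predualPairing (k : X) (m : M) : ‖predualPairing e k m‖ = ‖e.symm m k‖ := by
  simp [predualPairing]

lemma norm_predualPairing_le (k : X) (m : M) : ‖predualPairing e k m‖ ≤ ‖k‖ * ‖m‖ := by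
  rw [norm_predualPairing, mul_comm, ← e.symm.norm_map m]
  exact (e.symm m).le_opNorm k

lemma norm_le_of_predualPairing {m : M} {r : ℝ} (hr : 0 ≤ r)
    (h : ∀ k, ‖predualPairing e k m‖ ≤ r * ‖k‖) : ‖m‖ ≤ r := by
  rw [← e.symm.norm_map m]
  exact (e.symm m).opNorm_le_bound hr fun k => by simpa [norm_predualPairing] using h k

lemma eq_of_predualPairing {m n : M} (h : ∀ k, predualPairing e k m = predualPairing e k n) :
    m = n := by
  have : ‖m - n‖ ≤ 0 := norm_le_of_predualPairing e le_rfl fun k => by simp [h k]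
  exact sub_eq_zero.mp (norm_le_zero_iff.mp this)

/-- Weak-star convergence with respect to a predual. -/
def WeakStarLim {α : Type*} (l : Filter α) (u : α → M) (x : M) : Prop :=
  ∀ k, Tendsto (fun a => predualPairing e k (u a)) l (𝓝 (predualPairing e k x))

variable {e} {α : Type*} {l : Filter α} {u v : α → M} {x y : M}

lemma WeakStarLim.unique [NeBot l] (h : WeakStarLim e l u x) (h' : WeakStarLim e l u y) : x = y :=
  eq_of_predualPairing e fun k => tendsto_nhds_unique (h k) (h' k)

lemma WeakStarLim.add (h : WeakStarLim e l u x) (h' : WeakStarLim e l v y) :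
    WeakStarLim e l (fun a => u a + v a) (x + y) := fun k => by
  simpa using (h k).add (h' k)

lemma WeakStarLim.sub (h : WeakStarLim e l u x) (h' : WeakStarLim e l v y) :
    WeakStarLim e l (fun a => u a - v a) (x - y) := fun k => by
  simpa using (h k).sub (h' k)

lemma WeakStarLim.smul (c : ℂ) (h : WeakStarLim e l u x) :
    WeakStarLim e l (fun a => c • u a) (c • x) := fun k => by
  simpa using (h k).const_mul c

lemma WeakStarLim.real_smul (c : ℝ) (h : WeakStarLim e l u x) :
    WeakStarLim e l (fun a => c • u a) (c • x) := by
  simpa [Complex.coe_smul] using h.smul (c : ℂ)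

lemma WeakStarLim.const (x : M) : WeakStarLim e l (fun _ => x) x := fun _ => tendsto_const_nhds

lemma WeakStarLim.congr' (h : WeakStarLim e l u x) (h' : ∀ᶠ a in l, u a = v a) :
    WeakStarLim e l v x := fun k =>
  (h k).congr' (h'.mono fun a ha => by rw [ha])

lemma WeakStarLim.norm_le [NeBot l] (h : WeakStarLim e l u x) {r : ℝ} (hr : 0 ≤ r)
    (hu : ∀ᶠ a in l, ‖u a‖ ≤ r) : ‖x‖ ≤ r :=
  norm_le_of_predualPairing e hr fun k =>
    le_of_tendsto (h k).norm (hu.mono fun a ha =>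
      (norm_predualPairing_le e k _).trans (by rw [mul_comm]; gcongr))

lemma exists_weakStarLim (e : StrongDual ℂ X ≃ₗᵢ⋆[ℂ] M) (U : Ultrafilter α) (u : α → M) {r : ℝ}
    (hu : ∀ᶠ a in U, ‖u a‖ ≤ r) : ∃ x, ‖x‖ ≤ r ∧ WeakStarLim e U u x := by
  have hc := WeakDual.isCompact_closedBall (𝕜 := ℂ) (E := X) 0 r
  let w : α → WeakDual ℂ X := fun a => StrongDual.toWeakDual (e.symm (u a))
  have hw : ((U.map w : Ultrafilter (WeakDual ℂ X)) : Filter (WeakDual ℂ X)) ≤ 𝓟 (WeakDual.toStrongDual ⁻¹' Metric.closedBall 0 r) := by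
    rw [le_principal_iff, Ultrafilter.coe_map, mem_map]
    filter_upwards [hu] with a ha
    simpa [w] using ha
  obtain ⟨y, hy, hy'⟩ := hc.ultrafilter_le_nhds _ hw
  refine ⟨e (WeakDual.toStrongDual y), by simpa using hy, fun k => ?_⟩
  have h1 : Tendsto w U (𝓝 y) := hy'
  have h2 := ((WeakDual.eval_continuous k).tendsto y).comp h1
  have h3 := (continuous_star.tendsto _).comp h2
  simpa [predualPairing, Function.comp_def, w] using h3

end Predual

section SelfAdjointLimits

variable {M : Type*} [CStarAlgebra M] [PartialOrder M] [StarOrderedRing M]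
  {X : Type*} [NormedAddCommGroup X] [NormedSpace ℂ X] {e : StrongDual ℂ X ≃ₗᵢ⋆[ℂ] M}
  {α : Type*} {l : Filter α} {u v : α → M} {x y : M}

lemma WeakStarLim.isSelfAdjoint [NeBot l] (h : WeakStarLim e l u x) {r : ℝ}
    (hu : ∀ᶠ a in l, ‖u a‖ ≤ r) (hsa : ∀ᶠ a in l, IsSelfAdjoint (u a)) : IsSelfAdjoint x := by
  have hr : 0 ≤ r := by
    obtain ⟨a, ha⟩ := hu.exists
    exact (norm_nonneg _).trans ha
  have key : ((imaginaryPart x : selfAdjoint M) : M) = 0 := by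
    refine IsSelfAdjoint.of_norm_smul_le (realPart x).2 (imaginaryPart x).2 (r := r) fun t => ?_
    rw [realPart_add_I_smul_imaginaryPart]
    have h1 := h.add (WeakStarLim.const (t • Complex.I • (1 : M)))
    have h2 := h1.norm_le (Real.sqrt_nonneg (r ^ 2 + t ^ 2)) ?_
    · calc _ ≤ Real.sqrt (r ^ 2 + t ^ 2) ^ 2 := pow_le_pow_left₀ (norm_nonneg _) h2 2
        _ = _ := Real.sq_sqrt (by positivity)
    · filter_upwards [hu, hsa] with a ha hs
      refine Real.le_sqrt_of_sq_le ?_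
      rw [sq, ← CStarRing.norm_star_mul_self]
      have : star (u a + t • Complex.I • (1 : M)) * (u a + t • Complex.I • (1 : M))
          = u a * u a + t ^ 2 • (1 : M) := by
        have h1 : star (t • Complex.I • (1 : M)) = -(t • Complex.I • (1 : M)) := by simp
        have h2 : u a * (t • Complex.I • (1 : M)) = (t • Complex.I • (1 : M)) * u a := by simp
        have h3 : (t • Complex.I • (1 : M)) * (t • Complex.I • (1 : M)) = -(t ^ 2 • (1 : M)) := by
          simp only [smul_mul_assoc, mul_smul_comm, one_mul, smul_smul, ← Complex.coe_smul,
            ← neg_smul]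
          congr 1
          push_cast
          linear_combination (t : ℂ) ^ 2 * Complex.I_mul_I
        rw [star_add, hs.star_eq, h1, add_mul, mul_add, mul_add, neg_mul, neg_mul, h2, h3]
        abel
      rw [this]
      refine (norm_add_le _ _).trans (add_le_add ((norm_mul_le _ _).trans ?_) ?_)
      · rw [← sq]; gcongr
      · rcases subsingleton_or_nontrivial M with hM | hM
        · rw [Subsingleton.elim (1 : M) 0]; simp; positivity
        · rw [norm_smul]; simp
  rw [← realPart_add_I_smul_imaginaryPart x, key, smul_zero, add_zero]
  exact (realPart x).2

lemma WeakStarLim.nonneg [NeBot l] (h : WeakStarLim e l u x) {r : ℝ}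
    (hu : ∀ᶠ a in l, ‖u a‖ ≤ r) (hsa : ∀ᶠ a in l, 0 ≤ u a) : 0 ≤ x := by
  have hr : 0 ≤ r := by
    obtain ⟨a, ha⟩ := hu.exists
    exact (norm_nonneg _).trans ha
  refine nonneg_of_norm_sub_le (h.isSelfAdjoint hu (hsa.mono fun a ha => .of_nonneg ha)) (r := r)
    (((WeakStarLim.const _).sub h).norm_le hr ?_)
  filter_upwards [hu, hsa] with a ha hs
  refine norm_le_of_neg_le_of_le hr ?_ (by simpa using hs)
  have := (IsSelfAdjoint.of_nonneg hs).le_smul_one ha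
  calc -(r • (1 : M)) ≤ 0 := by simpa using smul_nonneg hr (zero_le_one' M)
    _ ≤ _ := by simpa using this

lemma WeakStarLim.map_star {U : Ultrafilter α} (h : WeakStarLim e U u x) {r : ℝ}
    (hu : ∀ᶠ a in U, ‖u a‖ ≤ r) : WeakStarLim e U (fun a => star (u a)) (star x) := by
  have h1 : ∀ᶠ a in U, ‖((realPart (u a) : selfAdjoint M) : M)‖ ≤ r :=
    hu.mono fun a ha => (realPart.norm_le _).trans ha
  have h2 : ∀ᶠ a in U, ‖((imaginaryPart (u a) : selfAdjoint M) : M)‖ ≤ r :=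
    hu.mono fun a ha => (imaginaryPart.norm_le _).trans ha
  obtain ⟨p, -, hp⟩ := exists_weakStarLim e U _ h1
  obtain ⟨q, -, hq⟩ := exists_weakStarLim e U _ h2
  have hps := hp.isSelfAdjoint h1 (.of_forall fun a => (realPart (u a)).2)
  have hqs := hq.isSelfAdjoint h2 (.of_forall fun a => (imaginaryPart (u a)).2)
  have h3 := hp.add (hq.smul Complex.I)
  simp only [realPart_add_I_smul_imaginaryPart] at h3
  rw [h.unique h3]
  have h4 := hp.sub (hq.smul Complex.I)
  convert h4 using 2 with a
  · nth_rw 1 [← realPart_add_I_smul_imaginaryPart (u a)]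
    simp [(realPart (u a)).2.star_eq, (imaginaryPart (u a)).2.star_eq, sub_eq_add_neg]
  · simp [hps.star_eq, hqs.star_eq, sub_eq_add_neg]

end SelfAdjointLimits

section Jordan

variable {M : Type*} [CStarAlgebra M] [PartialOrder M] [StarOrderedRing M]
  {X : Type*} [NormedAddCommGroup X] [NormedSpace ℂ X] {e : StrongDual ℂ X ≃ₗᵢ⋆[ℂ] M}
  {α : Type*} {U : Ultrafilter α} {u v : α → M} {x y k : M}

lemma norm_one_add_sub_sq_le {y : M} (hy : IsSelfAdjoint y) {R : ℝ} (hR : ‖y‖ ≤ R) (s : ℝ) :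
    ‖(1 : M) + (s : ℂ) • Complex.I • y - (s ^ 2 / 2) • (y * y)‖ ^ 2 ≤ 1 + s ^ 4 * R ^ 4 / 4 := by
  have h1 : star ((1 : M) + (s : ℂ) • Complex.I • y - (s ^ 2 / 2) • (y * y)) *
      ((1 : M) + (s : ℂ) • Complex.I • y - (s ^ 2 / 2) • (y * y)) =
      1 + (s ^ 4 / 4) • (y * y * (y * y)) := by
    simp only [star_add, star_sub, star_one, star_smul, star_mul, hy.star_eq, Complex.star_def,
      Complex.conj_I, star_trivial, Complex.conj_ofReal, add_mul, mul_add, sub_mul, mul_sub,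
      smul_mul_assoc, mul_smul_comm, one_mul, mul_one, mul_assoc, ← Complex.coe_smul]
    match_scalars <;> push_cast <;> ring_nf <;> simp [Complex.I_sq]
  rw [sq, ← CStarRing.norm_star_mul_self, h1]
  refine (norm_add_le _ _).trans (add_le_add ?_ ?_)
  · rcases subsingleton_or_nontrivial M with hM | hM
    · rw [Subsingleton.elim (1 : M) 0]; simp
    · simp
  · rw [norm_smul, Real.norm_of_nonneg (by positivity)]
    have : ‖y * y * (y * y)‖ ≤ R ^ 4 := by
      calc _ ≤ (‖y‖ * ‖y‖) * (‖y‖ * ‖y‖) := (norm_mul_le _ _).trans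
            (mul_le_mul (norm_mul_le _ _) (norm_mul_le _ _) (norm_nonneg _) (by positivity))
        _ = ‖y‖ ^ 4 := by ring
        _ ≤ _ := by gcongr
    nlinarith [show 0 ≤ s ^ 4 / 4 by positivity]

lemma WeakStarLim.mul_self_le (h : WeakStarLim e U u y) {R : ℝ} (hu : ∀ᶠ a in U, ‖u a‖ ≤ R)
    (hsa : ∀ᶠ a in U, IsSelfAdjoint (u a)) (hk : WeakStarLim e U (fun a => u a * u a) k) :
    y * y ≤ k := by
  have hR : 0 ≤ R := by
    obtain ⟨a, ha⟩ := hu.exists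
    exact (norm_nonneg _).trans ha
  have hy := h.isSelfAdjoint hu hsa
  have hu2 : ∀ᶠ a in U, ‖u a * u a‖ ≤ R * R :=
    hu.mono fun a ha => (norm_mul_le _ _).trans (by gcongr)
  have hks : IsSelfAdjoint k := hk.isSelfAdjoint hu2 <| hsa.mono fun a ha => by
    simpa [ha.star_eq] using IsSelfAdjoint.star_mul_self (u a)
  set w : M := (Complex.I / 2) • (y * k - k * y) with hw
  have hws : IsSelfAdjoint w := by
    simp only [hw, IsSelfAdjoint, star_smul, star_sub, star_mul, hy.star_eq, hks.star_eq]
    simp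
    module
  have key : ∀ s : ℝ, 0 < s → s ≤ 1 → y * y - k ≤ s • (R ^ 4 / 4 + ‖w‖) • (1 : M) := by
    intro s hs hs1
    have h1 : WeakStarLim e U (fun a => (1 : M) + (s : ℂ) • Complex.I • u a -
        (s ^ 2 / 2) • (u a * u a)) (1 + (s : ℂ) • Complex.I • y - (s ^ 2 / 2) • k) :=
      ((WeakStarLim.const _).add ((h.smul _).smul _)).sub (hk.real_smul _)
    have h2 := h1.norm_le (Real.sqrt_nonneg (1 + s ^ 4 * R ^ 4 / 4)) <| by
      filter_upwards [hu, hsa] with a ha hs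
      exact Real.le_sqrt_of_sq_le (norm_one_add_sub_sq_le hs ha s)
    set z := 1 + (s : ℂ) • Complex.I • y - (s ^ 2 / 2) • k with hz
    have h3 : ‖star z * z‖ ≤ 1 + s ^ 4 * R ^ 4 / 4 := by
      rw [CStarRing.norm_star_mul_self, ← Real.mul_self_sqrt (show 0 ≤ 1 + s ^ 4 * R ^ 4 / 4 by
        positivity)]
      gcongr
    have h4 := (IsSelfAdjoint.star_mul_self z).le_smul_one h3
    have h5 : star z * z = 1 + s ^ 2 • (y * y - k) + s ^ 3 • w + (s ^ 4 / 4) • (k * k) := by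
      simp only [hz, hw, star_add, star_sub, star_one, star_smul, star_mul, hy.star_eq,
        hks.star_eq, Complex.star_def,
        Complex.conj_I, star_trivial, Complex.conj_ofReal, add_mul, mul_add, sub_mul, mul_sub,
        smul_mul_assoc, mul_smul_comm, one_mul, mul_one, mul_assoc, ← Complex.coe_smul]
      match_scalars <;> push_cast <;> ring_nf <;> simp [Complex.I_sq]
    have h6 : 0 ≤ (s ^ 4 / 4) • (k * k) :=
      smul_nonneg (by positivity) (by simpa [hks.star_eq] using star_mul_self_nonneg k)
    have h7 : -(s ^ 3 • ‖w‖ • (1 : M)) ≤ s ^ 3 • w := by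
      rw [← smul_neg]
      exact smul_le_smul_of_nonneg_left (hws.neg_smul_one_le le_rfl) (by positivity)
    have h8 : s ^ 2 • (y * y - k) ≤ s ^ 2 • (s • (R ^ 4 / 4 + ‖w‖) • (1 : M)) := by
      have h9 : s ^ 4 • (R ^ 4 / 4) • (1 : M) ≤ s ^ 3 • (R ^ 4 / 4) • (1 : M) := by
        refine smul_le_smul_of_nonneg_right ?_ (smul_nonneg (by positivity) (zero_le_one' M))
        exact pow_le_pow_of_le_one hs.le hs1 (by norm_num)
      calc s ^ 2 • (y * y - k) = star z * z - 1 - s ^ 3 • w - (s ^ 4 / 4) • (k * k) := by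
            rw [h5]; abel
        _ ≤ (1 + s ^ 4 * R ^ 4 / 4) • (1 : M) - 1 - (-(s ^ 3 • ‖w‖ • (1 : M))) - 0 := by
            gcongr
        _ = s ^ 4 • (R ^ 4 / 4) • (1 : M) + s ^ 3 • ‖w‖ • (1 : M) := by module
        _ ≤ s ^ 3 • (R ^ 4 / 4) • (1 : M) + s ^ 3 • ‖w‖ • (1 : M) := by gcongr
        _ = _ := by module
    have := smul_le_smul_of_nonneg_left h8 (show 0 ≤ (s ^ 2)⁻¹ by positivity)
    rwa [inv_smul_smul₀ (by positivity), inv_smul_smul₀ (by positivity)] at this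
  exact sub_nonpos.mp (le_zero_of_forall_le_smul key)

lemma WeakStarLim.jordan_selfAdjoint {a : M} (ha : IsSelfAdjoint a) (h : WeakStarLim e U u x)
    {R : ℝ} (hu : ∀ᶠ i in U, ‖u i‖ ≤ R) (hsa : ∀ᶠ i in U, IsSelfAdjoint (u i)) :
    WeakStarLim e U (fun i => a * u i + u i * a) (a * x + x * a) := by
  have hu2 : ∀ᶠ i in U, ‖u i * u i‖ ≤ R * R := hu.mono fun i hi =>
    (norm_mul_le _ _).trans (mul_le_mul hi hi (norm_nonneg _) ((norm_nonneg _).trans hi))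
  have hu3 : ∀ᶠ i in U, ‖a * u i + u i * a‖ ≤ ‖a‖ * R + R * ‖a‖ := hu.mono fun i hi =>
    (norm_add_le _ _).trans (add_le_add ((norm_mul_le _ _).trans (by gcongr))
      ((norm_mul_le _ _).trans (by gcongr)))
  obtain ⟨k, -, hk⟩ := exists_weakStarLim e U _ hu2
  obtain ⟨m, -, hm⟩ := exists_weakStarLim e U _ hu3
  have key : ∀ t : ℝ, t • (a * x + x * a - m) ≤ k - x * x := by
    intro t
    have h1 : WeakStarLim e U (fun i => u i + t • a) (x + t • a) := h.add (.const _)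
    have h2 : WeakStarLim e U (fun i => (u i + t • a) * (u i + t • a))
        (k + t • m + t ^ 2 • (a * a)) := by
      refine ((hk.add (hm.real_smul t)).add (.const (t ^ 2 • (a * a)))).congr' (.of_forall ?_)
      intro i
      simp only [add_mul, mul_add, smul_mul_assoc, mul_smul_comm]
      module
    have h3 := h1.mul_self_le (R := R + ‖t • a‖)
      (hu.mono fun i hi => (norm_add_le _ _).trans (by gcongr))
      (hsa.mono fun i hi => hi.add ((IsSelfAdjoint.all t).smul ha)) h2
    rw [← sub_nonneg] at h3 ⊢
    convert h3 using 1
    simp only [add_mul, mul_add, smul_mul_assoc, mul_smul_comm]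
    module
  rw [sub_eq_zero.mp (eq_zero_of_forall_smul_le key)]
  exact hm

lemma WeakStarLim.jordan {a : M} (ha : IsSelfAdjoint a) (h : WeakStarLim e U u x)
    {R : ℝ} (hu : ∀ᶠ i in U, ‖u i‖ ≤ R) :
    WeakStarLim e U (fun i => a * u i + u i * a) (a * x + x * a) := by
  have h1 : ∀ᶠ i in U, ‖((realPart (u i) : selfAdjoint M) : M)‖ ≤ R :=
    hu.mono fun a ha => (realPart.norm_le _).trans ha
  have h2 : ∀ᶠ i in U, ‖((imaginaryPart (u i) : selfAdjoint M) : M)‖ ≤ R :=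
    hu.mono fun a ha => (imaginaryPart.norm_le _).trans ha
  obtain ⟨p, -, hp⟩ := exists_weakStarLim e U _ h1
  obtain ⟨q, -, hq⟩ := exists_weakStarLim e U _ h2
  have h3 := hp.add (hq.smul Complex.I)
  simp only [realPart_add_I_smul_imaginaryPart] at h3
  have h4 := (hp.jordan_selfAdjoint ha h1 (.of_forall fun a => (realPart (u a)).2)).add
    ((hq.jordan_selfAdjoint ha h2 (.of_forall fun a => (imaginaryPart (u a)).2)).smul Complex.I)
  rw [h.unique h3]
  have h5 : (fun i => a * u i + u i * a) = fun i => a * ((realPart (u i) : selfAdjoint M) : M) +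
      ((realPart (u i) : selfAdjoint M) : M) * a + Complex.I •
        (a * ((imaginaryPart (u i) : selfAdjoint M) : M) +
          ((imaginaryPart (u i) : selfAdjoint M) : M) * a) := by
    funext i
    nth_rw 1 2 [← realPart_add_I_smul_imaginaryPart (u i)]
    simp only [add_mul, mul_add, smul_mul_assoc, mul_smul_comm, smul_add]
    abel
  rw [h5]
  convert h4 using 1
  · simp only [add_mul, mul_add, smul_mul_assoc, mul_smul_comm, smul_add]
    abel

end Jordan

section BoundedWeakStar

variable {M : Type*} [CStarAlgebra M] [PartialOrder M] [StarOrderedRing M]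
  {X : Type*} [NormedAddCommGroup X] [NormedSpace ℂ X] (e : StrongDual ℂ X ≃ₗᵢ⋆[ℂ] M)

lemma exists_weakStarLim_of_directedOn {s : Set M} {b : M} (hne : s.Nonempty)
    (hd : DirectedOn (· ≤ ·) s) (hb : b ∈ upperBounds s) (U : Ultrafilter s)
    (hU : (U : Filter s) ≤ atTop) :
    ∃ x r, IsLUB s x ∧ (∀ᶠ p : s in U, ‖(p : M)‖ ≤ r) ∧
      WeakStarLim e U (fun p : s => (p : M)) x := by
  obtain ⟨a, ha⟩ := hne
  have : Nonempty s := ⟨⟨a, ha⟩⟩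
  have : IsDirectedOrder s := directedOn_iff_isDirectedOrder.mp hd
  have hge : ∀ c : s, ∀ᶠ p : s in U, c ≤ p := fun c => hU (Ici_mem_atTop c)
  have hbd : ∀ᶠ p : s in U, ‖(p : M)‖ ≤ ‖a‖ + ‖b - a‖ := by
    filter_upwards [hge ⟨a, ha⟩] with p hp
    have h1 : a ≤ p := hp
    have h2 : ‖(p : M) - a‖ ≤ ‖b - a‖ :=
      CStarAlgebra.norm_le_norm_of_nonneg_of_le (sub_nonneg.mpr h1) (sub_le_sub_right (hb p.2) a)
    calc ‖(p : M)‖ = ‖a + (p - a)‖ := by simp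
      _ ≤ _ := (norm_add_le _ _).trans (by gcongr)
  obtain ⟨x, -, hx⟩ := exists_weakStarLim e U _ hbd
  have hcl : ∀ (c : M), (∀ᶠ p : s in U, c ≤ (p : M)) → c ≤ x := fun c hc => by
    refine sub_nonneg.mp ((hx.sub (.const c)).nonneg (r := (‖a‖ + ‖b - a‖) + ‖c‖) ?_ ?_)
    · exact hbd.mono fun p hp => (norm_sub_le _ _).trans (by gcongr)
    · exact hc.mono fun p hp => sub_nonneg.mpr hp
  refine ⟨x, _, ⟨fun c hc => hcl c (hge ⟨c, hc⟩), fun c hc => ?_⟩, hbd, hx⟩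
  refine sub_nonneg.mp (((WeakStarLim.const c).sub hx).nonneg
    (r := ‖c‖ + (‖a‖ + ‖b - a‖)) ?_ ?_)
  · exact hbd.mono fun p hp => (norm_sub_le _ _).trans (by gcongr)
  · exact .of_forall fun p => sub_nonneg.mpr (hc p.2)

/-- A linear functional is boundedly weak-star continuous if it is weak-star continuous on
norm balls. -/
def BoundedlyWeakStar (f : M →ₗ[ℂ] ℂ) : Prop :=
  ∀ (U : Ultrafilter M) (r : ℝ) (x : M), (∀ᶠ m : M in U, ‖m‖ ≤ r) → WeakStarLim e U id x →
    Tendsto f U (𝓝 (f x))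

variable {e} {f g h : M →ₗ[ℂ] ℂ}

lemma BoundedlyWeakStar.tendsto (hf : BoundedlyWeakStar e f) {α : Type*} {U : Ultrafilter α}
    {u : α → M} {x : M} {r : ℝ} (hu : ∀ᶠ a in U, ‖u a‖ ≤ r) (hx : WeakStarLim e U u x) :
    Tendsto (fun a => f (u a)) U (𝓝 (f x)) :=
  hf (U.map u) r x hu fun k => hx k

lemma BoundedlyWeakStar.add (hf : BoundedlyWeakStar e f) (hg : BoundedlyWeakStar e g) :
    BoundedlyWeakStar e (f + g) := fun U r x hr hx => (hf U r x hr hx).add (hg U r x hr hx)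

lemma BoundedlyWeakStar.smul (c : ℂ) (hf : BoundedlyWeakStar e f) :
    BoundedlyWeakStar e (c • f) := fun U r x hr hx => (hf U r x hr hx).const_mul c

lemma BoundedlyWeakStar.sub (hf : BoundedlyWeakStar e f) (hg : BoundedlyWeakStar e g) :
    BoundedlyWeakStar e (f - g) := fun U r x hr hx => (hf U r x hr hx).sub (hg U r x hr hx)

lemma boundedlyWeakStar_predualPairing (k : X) : BoundedlyWeakStar e (predualPairing e k) :=
  fun _ _ _ _ hx => hx k

lemma BoundedlyWeakStar.of_approx
    (hf : ∀ ε : ℝ, 0 < ε → ∃ g, BoundedlyWeakStar e g ∧ ∀ x, ‖f x - g x‖ ≤ ε * ‖x‖) :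
    BoundedlyWeakStar e f := by
  intro U r x hr hx
  have hr0 : 0 ≤ r := by
    obtain ⟨a, ha⟩ := hr.exists
    exact (norm_nonneg _).trans ha
  have hxr : ‖x‖ ≤ r := hx.norm_le hr0 hr
  rw [Metric.tendsto_nhds]
  intro ε hε
  obtain ⟨g, hg, hfg⟩ := hf (ε / (3 * (r + 1))) (by positivity)
  have h1 := Metric.tendsto_nhds.mp (hg U r x hr hx) (ε / 3) (by positivity)
  have hb : ∀ y : M, ‖y‖ ≤ r → ‖f y - g y‖ < ε / 3 := fun y hy => by
    calc _ ≤ ε / (3 * (r + 1)) * ‖y‖ := hfg y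
      _ < ε / (3 * (r + 1)) * (r + 1) := by
        have : 0 < ε / (3 * (r + 1)) := by positivity
        nlinarith
      _ = ε / 3 := by field_simp
  filter_upwards [h1, hr] with m hm hmr
  rw [dist_eq_norm] at hm ⊢
  have h2 := hb m hmr
  have h3 := hb x hxr
  calc ‖f m - f x‖ = ‖(f m - g m) + (g m - g x) - (f x - g x)‖ := by congr 1; ring
    _ ≤ ‖f m - g m‖ + ‖g m - g x‖ + ‖f x - g x‖ :=
        (norm_sub_le _ _).trans (add_le_add_left (norm_add_le _ _) _)
    _ < ε := by linarith

/-- The functional `x ↦ f (a * x + x * a)`. -/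
def jordanMul (a : M) (f : M →ₗ[ℂ] ℂ) : M →ₗ[ℂ] ℂ :=
  f ∘ₗ (LinearMap.mulLeft ℂ a + LinearMap.mulRight ℂ a)

@[simp] lemma jordanMul_apply (a : M) (f : M →ₗ[ℂ] ℂ) (x : M) :
    jordanMul a f x = f (a * x + x * a) := rfl

lemma BoundedlyWeakStar.jordan_of_isSelfAdjoint (hf : BoundedlyWeakStar e f) {a : M} (ha : IsSelfAdjoint a) :
    BoundedlyWeakStar e (jordanMul a f) := fun U r x hr hx => by
  refine hf.tendsto (r := ‖a‖ * r + r * ‖a‖) ?_ (hx.jordan ha hr)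
  exact hr.mono fun i hi => (norm_add_le _ _).trans (add_le_add ((norm_mul_le _ _).trans (by gcongr))
      ((norm_mul_le _ _).trans (by gcongr)))

lemma BoundedlyWeakStar.jordan (hf : BoundedlyWeakStar e f) (a : M) :
    BoundedlyWeakStar e (jordanMul a f) := by
  have h1 := (hf.jordan_of_isSelfAdjoint (realPart a).2).add
    ((hf.jordan_of_isSelfAdjoint (imaginaryPart a).2).smul Complex.I)
  convert h1 using 1
  ext x
  nth_rw 1 [← realPart_add_I_smul_imaginaryPart a]
  simp [add_mul, mul_add]
  ring

/-- The functional `x ↦ f (star a * x * a)`. -/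
def conjMul (a : M) (f : M →ₗ[ℂ] ℂ) : M →ₗ[ℂ] ℂ :=
  f ∘ₗ (LinearMap.mulRight ℂ a ∘ₗ LinearMap.mulLeft ℂ (star a))

@[simp] lemma conjMul_apply (a : M) (f : M →ₗ[ℂ] ℂ) (x : M) :
    conjMul a f x = f (star a * x * a) := rfl

lemma BoundedlyWeakStar.conj_of_isSelfAdjoint (hf : BoundedlyWeakStar e f) {a : M} (ha : IsSelfAdjoint a) :
    BoundedlyWeakStar e (conjMul a f) := by
  have h1 := (((hf.jordan_of_isSelfAdjoint ha).jordan_of_isSelfAdjoint ha).sub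
    (hf.jordan_of_isSelfAdjoint (a := a * a) (by simpa [ha.star_eq] using IsSelfAdjoint.star_mul_self a))).smul
      (1 / 2)
  convert h1 using 1
  ext x
  simp only [conjMul_apply, ha.star_eq, LinearMap.smul_apply, LinearMap.sub_apply,
    jordanMul_apply, ← map_sub, ← map_smul]
  congr 1
  simp only [mul_add, add_mul, mul_assoc]
  module

/-- Positivity of a linear functional. -/
def IsPosFunctional (f : M →ₗ[ℂ] ℂ) : Prop := ∀ x, 0 ≤ x → 0 ≤ f x

lemma IsPosFunctional.mono (hf : IsPosFunctional f) {x y : M} (h : x ≤ y) : f x ≤ f y := by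
  have := hf _ (sub_nonneg.mpr h)
  rwa [map_sub, sub_nonneg] at this

lemma IsPosFunctional.monotone (hf : IsPosFunctional f) : Monotone f := fun _ _ h => hf.mono h

lemma isNormalPosFunctional_iff : IsNormalPosFunctional f ↔ IsPosFunctional f ∧
    ∀ (s : Set M) (x : M), s.Nonempty → DirectedOn (· ≤ ·) s → IsLUB s x →
    Tendsto (fun p : s => f p) atTop (𝓝 (f x)) := by
  refine and_congr_left fun _ => ⟨fun h x hx => ?_, fun h a => ?_⟩
  · obtain ⟨a, rfl⟩ := CStarAlgebra.nonneg_iff_eq_star_mul_self.mp hx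
    obtain ⟨c, hc⟩ := h a
    rw [hc]; exact star_mul_self_nonneg c
  · exact CStarAlgebra.nonneg_iff_eq_star_mul_self.mp (h _ (star_mul_self_nonneg a))

lemma IsNormalPosFunctional.isPosFunctional (hf : IsNormalPosFunctional f) : IsPosFunctional f :=
  (isNormalPosFunctional_iff.mp hf).1

lemma BoundedlyWeakStar.isNormalPosFunctional (hf : BoundedlyWeakStar e f)
    (hp : IsPosFunctional f) : IsNormalPosFunctional f := by
  refine isNormalPosFunctional_iff.mpr ⟨hp, fun s x hne hd hx => ?_⟩
  rw [tendsto_iff_ultrafilter]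
  intro U hU
  obtain ⟨y, r, hy, hr, hlim⟩ := exists_weakStarLim_of_directedOn e hne hd hx.1 U hU
  rw [hx.unique hy]
  exact hf.tendsto hr hlim

end BoundedWeakStar

section Decomposition

variable {M : Type*} [CStarAlgebra M] [PartialOrder M] [StarOrderedRing M]
  {X : Type*} [NormedAddCommGroup X] [NormedSpace ℂ X] {e : StrongDual ℂ X ≃ₗᵢ⋆[ℂ] M}
  {f g h : M →ₗ[ℂ] ℂ}

/-- The adjoint functional `x ↦ conj (f (star x))`. -/
def starFunctional (f : M →ₗ[ℂ] ℂ) : M →ₗ[ℂ] ℂ where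
  toFun x := star (f (star x))
  map_add' x y := by simp
  map_smul' c x := by simp

@[simp] lemma starFunctional_apply (f : M →ₗ[ℂ] ℂ) (x : M) :
    starFunctional f x = star (f (star x)) := rfl

lemma BoundedlyWeakStar.star_functional (hf : BoundedlyWeakStar e f) :
    BoundedlyWeakStar e (starFunctional f) := fun U r x hr hx =>
  (hf.tendsto (r := r) (hr.mono fun a ha => by simpa using ha) (hx.map_star hr)).star

lemma BoundedlyWeakStar.exists_max (hf : BoundedlyWeakStar e f) :
    ∃ u : M, IsSelfAdjoint u ∧ ‖u‖ ≤ 1 ∧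
      ∀ x : M, IsSelfAdjoint x → (f x).re ≤ ‖x‖ * (f u).re := by
  let T : Set M := {x | IsSelfAdjoint x ∧ ‖x‖ ≤ 1}
  have hc : IsCompact ((fun x => (f x).re) '' T) := by
    rw [isCompact_iff_ultrafilter_le_nhds]
    intro V hV
    rw [le_principal_iff] at hV
    let W := Ultrafilter.ofComapInfPrincipal hV
    have hW : T ∈ W := Ultrafilter.ofComapInfPrincipal_mem hV
    have hmap : W.map (fun x => (f x).re) = V := Ultrafilter.ofComapInfPrincipal_eq_of_map hV
    have h1 : ∀ᶠ m : M in W, ‖m‖ ≤ 1 := by filter_upwards [hW] with m hm using hm.2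
    have h2 : ∀ᶠ m : M in W, IsSelfAdjoint m := by filter_upwards [hW] with m hm using hm.1
    obtain ⟨x, hx1, hx⟩ := exists_weakStarLim e W id h1
    refine ⟨_, ⟨x, ⟨hx.isSelfAdjoint h1 h2, hx1⟩, rfl⟩, ?_⟩
    rw [← hmap]
    exact (Complex.continuous_re.tendsto _).comp (hf W 1 x h1 hx)
  obtain ⟨-, ⟨u, hu, rfl⟩, hmax⟩ := hc.exists_isGreatest ⟨_, 0, ⟨.zero M, by simp⟩, rfl⟩
  refine ⟨u, hu.1, hu.2, fun x hx => ?_⟩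
  rcases eq_or_ne x 0 with rfl | hx0
  · simp
  have hpos : 0 < ‖x‖ := norm_pos_iff.mpr hx0
  have h3 := hmax ⟨(‖x‖⁻¹ : ℝ) • x, ⟨(IsSelfAdjoint.all _).smul hx, by
    rw [norm_smul]; simp [hx0]⟩, rfl⟩
  simp only [LinearMap.map_smul_of_tower, Complex.smul_re, smul_eq_mul] at h3
  calc (f x).re = ‖x‖ * (‖x‖⁻¹ * (f x).re) := by field_simp
    _ ≤ _ := by gcongr

lemma norm_conj_add_smul_le {u x : M} (hu : IsSelfAdjoint u) (hu1 : ‖u‖ ≤ 1) (hx : 0 ≤ x)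
    {s : ℝ} (hs : 0 ≤ s) {ε : ℝ} (hε : |ε| ≤ 1) :
    ‖(1 - (s / 2) • x) * u * (1 - (s / 2) • x) + (ε * s) • x‖ ≤ 1 + s ^ 2 / 4 * ‖x‖ ^ 2 := by
  have hxs : IsSelfAdjoint x := .of_nonneg hx
  have hcs : IsSelfAdjoint (1 - (s / 2) • x) :=
    (IsSelfAdjoint.one M).sub ((IsSelfAdjoint.all _).smul hxs)
  have h1 := hcs.conjugate_le_conjugate (hu.le_smul_one hu1)
  have h2 := hcs.conjugate_le_conjugate (hu.neg_smul_one_le hu1)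
  have hε' := abs_le.mp hε
  have h3 : (ε * s) • x ≤ s • x := smul_le_smul_of_nonneg_right (by nlinarith) hx
  have h4 : -(s • x) ≤ (ε * s) • x := by
    rw [← neg_smul]; exact smul_le_smul_of_nonneg_right (by nlinarith) hx
  have h5 : (1 - (s / 2) • x) * ((1 : ℝ) • (1 : M)) * (1 - (s / 2) • x) + s • x =
      1 + (s ^ 2 / 4) • (x * x) := by
    simp only [sub_mul, mul_sub, smul_mul_assoc, mul_smul_comm, one_mul, mul_one]
    module
  have h6 : (s ^ 2 / 4) • (x * x) ≤ (s ^ 2 / 4 * ‖x‖ ^ 2) • (1 : M) := by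
    rw [mul_smul]
    refine smul_le_smul_of_nonneg_left ?_ (by positivity)
    have : IsSelfAdjoint (x * x) := by simpa [hxs.star_eq] using IsSelfAdjoint.star_mul_self x
    exact this.le_smul_one ((norm_mul_le _ _).trans (sq _).ge)
  have h7 : (1 - (s / 2) • x) * ((1 : ℝ) • (1 : M)) * (1 - (s / 2) • x) + s • x ≤
      (1 + s ^ 2 / 4 * ‖x‖ ^ 2) • (1 : M) := by
    rw [h5, add_smul, one_smul]
    gcongr
  refine norm_le_of_neg_le_of_le (by positivity) ?_ ((add_le_add h1 h3).trans h7)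
  refine (neg_le_neg h7).trans (le_of_eq_of_le ?_ (add_le_add h2 h4))
  simp only [mul_neg, neg_mul, neg_add]

/-- Every hermitian boundedly weak-star continuous functional is dominated by a positive one. -/
lemma BoundedlyWeakStar.exists_dominating (hf : BoundedlyWeakStar e f)
    (hsa : starFunctional f = f) :
    ∃ g, BoundedlyWeakStar e g ∧ IsPosFunctional (g + f) ∧ IsPosFunctional (g - f) := by
  obtain ⟨u, hu, hu1, hmax⟩ := hf.exists_max
  have hreal : ∀ x, IsSelfAdjoint x → (f x).im = 0 := fun x hx => by
    have := congrArg (fun k => k x) hsa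
    simp only [starFunctional_apply, hx.star_eq] at this
    exact Complex.conj_eq_iff_im.mp this
  have key : ∀ x, 0 ≤ x → ∀ ε : ℝ, |ε| ≤ 1 → 0 ≤ ((1 / 2 : ℂ) * f (u * x + x * u)).re -
      ε * (f x).re := by
    intro x hx ε hε
    have hxs : IsSelfAdjoint x := .of_nonneg hx
    set N := (f u).re
    have h1 : ∀ s : ℝ, 0 < s → ε * (f x).re - ((1 / 2 : ℂ) * f (u * x + x * u)).re ≤
        s * (1 / 4 * ‖x‖ ^ 2 * N - 1 / 4 * (f (x * u * x)).re) := by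
      intro s hs
      have hcs : IsSelfAdjoint (1 - (s / 2) • x) :=
        (IsSelfAdjoint.one M).sub ((IsSelfAdjoint.all _).smul hxs)
      have h2 := hmax ((1 - (s / 2) • x) * u * (1 - (s / 2) • x) + (ε * s) • x)
        (IsSelfAdjoint.add (by simpa [hcs.star_eq] using hu.conjugate (1 - (s / 2) • x))
          ((IsSelfAdjoint.all _).smul hxs))
      have hN : 0 ≤ N := by
        have := hmax u hu
        have h0 := hmax (-u) hu.neg
        simp at h0
        nlinarith [norm_nonneg u]
      have h3 := h2.trans (mul_le_mul_of_nonneg_right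
        (norm_conj_add_smul_le hu hu1 hx hs.le hε) hN)
      have h4 : (1 - (s / 2) • x) * u * (1 - (s / 2) • x) + (ε * s) • x =
          u + (-(s / 2)) • (u * x + x * u) + (s ^ 2 / 4) • (x * u * x) + (ε * s) • x := by
        simp only [sub_mul, mul_sub, smul_mul_assoc, mul_smul_comm, one_mul, mul_one]
        module
      rw [h4] at h3
      simp only [map_add, LinearMap.map_smul_of_tower, Complex.add_re, Complex.smul_re, smul_eq_mul] at h3
      have h5 : ((1 / 2 : ℂ) * f (u * x + x * u)).re = 1 / 2 * ((f (u * x)).re + (f (x * u)).re) := by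
        rw [map_add]; simp
      rw [h5]
      refine le_of_mul_le_mul_left ?_ hs
      change _ ≤ (1 + s ^ 2 / 4 * ‖x‖ ^ 2) * N at h3
      change N + _ + _ + _ ≤ _ at h3
      linarith
    by_contra! hlt
    set C := 1 / 4 * ‖x‖ ^ 2 * N - 1 / 4 * (f (x * u * x)).re
    set d := ε * (f x).re - ((1 / 2 : ℂ) * f (u * x + x * u)).re
    have hd : 0 < d := by simp only [d]; linarith
    have := h1 (d / (2 * (|C| + 1))) (by positivity)
    have h6 : d / (2 * (|C| + 1)) * C ≤ d / (2 * (|C| + 1)) * (|C| + 1) := by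
      gcongr
      linarith [le_abs_self C]
    have h7 : d / (2 * (|C| + 1)) * (|C| + 1) = d / 2 := by field_simp
    linarith
  have him : ∀ x, 0 ≤ x → (f (u * x + x * u)).im = 0 := fun x hx => hreal _ <| by
    have hxs : IsSelfAdjoint x := .of_nonneg hx
    simp [IsSelfAdjoint, hxs.star_eq, hu.star_eq, add_comm]
  refine ⟨(1 / 2 : ℂ) • jordanMul u f, (hf.jordan_of_isSelfAdjoint hu).smul _, fun x hx => ?_,
    fun x hx => ?_⟩
  · have := key x hx (-1) (by simp)
    rw [Complex.nonneg_iff]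
    refine ⟨?_, ?_⟩
    · simpa using this
    · simpa [hreal x (.of_nonneg hx)] using him x hx
  · have := key x hx 1 (by simp)
    rw [Complex.nonneg_iff]
    refine ⟨?_, ?_⟩
    · simpa using this
    · simpa [hreal x (.of_nonneg hx)] using him x hx

/-- Every boundedly weak-star continuous functional is a combination of positive ones. -/
lemma BoundedlyWeakStar.mem_span (hf : BoundedlyWeakStar e f) :
    f ∈ Submodule.span ℂ {g : M →ₗ[ℂ] ℂ | BoundedlyWeakStar e g ∧ IsPosFunctional g} := by
  have key : ∀ f : M →ₗ[ℂ] ℂ, BoundedlyWeakStar e f → starFunctional f = f →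
      f ∈ Submodule.span ℂ {g : M →ₗ[ℂ] ℂ | BoundedlyWeakStar e g ∧ IsPosFunctional g} := by
    intro f hf hsa
    obtain ⟨g, hg, h1, h2⟩ := hf.exists_dominating hsa
    have : f = (1 / 2 : ℂ) • ((g + f) - (g - f)) := by module
    rw [this]
    exact Submodule.smul_mem _ _ (Submodule.sub_mem _ (Submodule.subset_span ⟨hg.add hf, h1⟩)
      (Submodule.subset_span ⟨hg.sub hf, h2⟩))
  have h1 := key ((1 / 2 : ℂ) • (f + starFunctional f)) ((hf.add hf.star_functional).smul _) (by
    ext x; simp; ring)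
  have h2 := key ((Complex.I / 2 : ℂ) • (starFunctional f - f))
    ((hf.star_functional.sub hf).smul _) (by ext x; simp; ring)
  have h3 : f = (1 / 2 : ℂ) • (f + starFunctional f) +
      (Complex.I) • ((Complex.I / 2 : ℂ) • (starFunctional f - f)) := by
    ext x; simp; linear_combination (1 / 2) * (f x - (starRingEnd ℂ) (f (star x))) * Complex.I_sq
  rw [h3]
  exact Submodule.add_mem _ h1 (Submodule.smul_mem _ _ h2)

lemma exists_pos_boundedlyWeakStar (e : StrongDual ℂ X ≃ₗᵢ⋆[ℂ] M) {d : M} (hd : d ≠ 0) :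
    ∃ g : M →ₗ[ℂ] ℂ, BoundedlyWeakStar e g ∧ IsPosFunctional g ∧ g d ≠ 0 := by
  by_contra! hcon
  refine hd (eq_of_predualPairing e fun k => ?_)
  rw [map_zero]
  have : predualPairing e k ∈ Submodule.span ℂ
    {g : M →ₗ[ℂ] ℂ | BoundedlyWeakStar e g ∧ IsPosFunctional g} :=
    (boundedlyWeakStar_predualPairing k).mem_span
  generalize predualPairing e k = p at this
  induction this using Submodule.span_induction with
  | mem g hg => exact hcon g hg.1 hg.2
  | zero => rfl
  | add g h _ _ h1 h2 => simp [h1, h2]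
  | smul c g _ h1 => simp [h1]

end Decomposition

section NormalFunctionals

variable {M : Type*} [CStarAlgebra M] [PartialOrder M] [StarOrderedRing M]
  {X : Type*} [NormedAddCommGroup X] [NormedSpace ℂ X] {e : StrongDual ℂ X ≃ₗᵢ⋆[ℂ] M}
  {f g h : M →ₗ[ℂ] ℂ}

/-- The bundled positive linear map associated with a positive functional. -/
def IsPosFunctional.toPositiveLinearMap (hf : IsPosFunctional f) : M →ₚ[ℂ] ℂ :=
  PositiveLinearMap.mk₀ f hf

@[simp] lemma IsPosFunctional.toPositiveLinearMap_apply (hf : IsPosFunctional f) (x : M) :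
    hf.toPositiveLinearMap x = f x := rfl

lemma IsPosFunctional.apply_star (hf : IsPosFunctional f) (x : M) : f (star x) = star (f x) :=
  map_star hf.toPositiveLinearMap x

lemma IsPosFunctional.cauchy_schwarz (hf : IsPosFunctional f) (a b : M) :
    ‖f (star a * b)‖ ^ 2 ≤ (f (star a * a)).re * (f (star b * b)).re := by
  have h1 := norm_inner_le_norm (𝕜 := ℂ) (hf.toPositiveLinearMap.toPreGNS a)
    (hf.toPositiveLinearMap.toPreGNS b)
  have h2 : ∀ a : M, ‖hf.toPositiveLinearMap.toPreGNS a‖ ^ 2 = (f (star a * a)).re := fun a => by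
    have := congrArg Complex.re (hf.toPositiveLinearMap.preGNS_norm_sq
      (hf.toPositiveLinearMap.toPreGNS a))
    rw [← Complex.ofReal_pow, Complex.ofReal_re] at this
    exact this
  rw [PositiveLinearMap.preGNS_inner_def] at h1
  have h3 := pow_le_pow_left₀ (norm_nonneg _) h1 2
  rw [mul_pow, h2, h2] at h3
  exact h3

lemma IsPosFunctional.norm_apply_le (hf : IsPosFunctional f) (a : M) :
    ‖f a‖ ^ 2 ≤ (f 1).re * (f (star a * a)).re := by
  simpa using hf.cauchy_schwarz 1 a

lemma IsPosFunctional.norm_apply_le' (hf : IsPosFunctional f) (a : M) :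
    ‖f a‖ ^ 2 ≤ (f 1).re * (f (a * star a)).re := by
  have := hf.norm_apply_le (star a)
  rwa [hf.apply_star, norm_star, star_star] at this

lemma IsPosFunctional.re_nonneg (hf : IsPosFunctional f) {x : M} (hx : 0 ≤ x) : 0 ≤ (f x).re :=
  (Complex.nonneg_iff.mp (hf x hx)).1

lemma IsPosFunctional.re_mono (hf : IsPosFunctional f) {x y : M} (h : x ≤ y) :
    (f x).re ≤ (f y).re := (Complex.le_def.mp (hf.mono h)).1

lemma IsPosFunctional.re_apply_le (hf : IsPosFunctional f) {x : M} (hx : IsSelfAdjoint x) :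
    (f x).re ≤ (f 1).re * ‖x‖ := by
  have := hf.re_mono (hx.le_smul_one le_rfl)
  rw [LinearMap.map_smul_of_tower, Complex.smul_re, smul_eq_mul] at this
  linarith

/-- A positive functional which is bounded by the (symmetrised) Hilbert seminorm of a positive
boundedly weak-star continuous functional is boundedly weak-star continuous. -/
lemma BoundedlyWeakStar.of_sq_le (hh : BoundedlyWeakStar e h) (hp : IsPosFunctional h) {C : ℝ}
    (hC : 0 ≤ C) (hf : ∀ x, (f x).re ^ 2 ≤ C * (h (star x * x + x * star x)).re) :
    BoundedlyWeakStar e f := by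
  let q : M → ℝ := fun a => (h (star a * a + a * star a)).re - 2 * (f a).re
  let Q : M → ℝ := fun a => (h (star a * a + a * star a)).re
  have hQ0 : ∀ a, 0 ≤ Q a := fun a =>
    hp.re_nonneg (add_nonneg (star_mul_self_nonneg a) (mul_star_self_nonneg a))
  have hbdd : BddBelow (Set.range q) := by
    refine ⟨-C, ?_⟩
    rintro _ ⟨a, rfl⟩
    have h1 := hf a
    have h2 : 0 ≤ Q a := hQ0 a
    change -C ≤ Q a - 2 * (f a).re
    change _ ≤ C * Q a at h1
    nlinarith [sq_nonneg (C - Q a), sq_nonneg ((f a).re), sq_nonneg (C + Q a - 2 * (f a).re)]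
  refine BoundedlyWeakStar.of_approx fun ε hε => ?_
  obtain ⟨K, hK0, hK⟩ : ∃ K : ℝ, 0 < K ∧ ∀ x, Q x ≤ K ^ 2 * ‖x‖ ^ 2 := by
    refine ⟨Real.sqrt (2 * (h 1).re + 1), Real.sqrt_pos.mpr ?_, fun x => ?_⟩
    · have := hp.re_nonneg (zero_le_one' M); positivity
    · have := hp.re_nonneg (zero_le_one' M)
      rw [Real.sq_sqrt (by positivity)]
      have h1 := hp.re_apply_le (IsSelfAdjoint.star_mul_self x)
      have h2 := hp.re_apply_le (IsSelfAdjoint.mul_star_self x)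
      rw [CStarRing.norm_star_mul_self] at h1
      rw [CStarRing.norm_self_mul_star] at h2
      change (h _).re ≤ _
      rw [map_add, Complex.add_re]
      nlinarith [norm_nonneg x]
  set δ := ε / (2 * K) with hδ
  have hδ0 : 0 < δ := by positivity
  obtain ⟨-, ⟨a, rfl⟩, ha⟩ := exists_lt_of_csInf_lt (Set.range_nonempty q)
    (lt_add_of_pos_right (sInf (Set.range q)) (show 0 < δ ^ 2 by positivity))
  have hmin : ∀ b, q a - δ ^ 2 ≤ q b := fun b => by
    have := csInf_le hbdd ⟨b, rfl⟩
    linarith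
  refine ⟨jordanMul (star a) h, hh.jordan _, ?_⟩
  have hre : ∀ x, |(f x - jordanMul (star a) h x).re| ≤ ε / 2 * ‖x‖ := by
    intro x
    set L := (f x - jordanMul (star a) h x).re with hL
    have hexp : ∀ t : ℝ, q (a + t • x) = q a + t ^ 2 * Q x - 2 * t * L := by
      intro t
      have h1 : star (a + t • x) * (a + t • x) + (a + t • x) * star (a + t • x) =
          (star a * a + a * star a) + t • ((star a * x + x * star a) + star (star a * x + x * star a))
            + t ^ 2 • (star x * x + x * star x) := by
        simp only [star_add, star_smul, star_mul, star_star, star_trivial, add_mul, mul_add,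
          smul_mul_assoc, mul_smul_comm]
        module
      have h2 : (h (star (star a * x + x * star a))).re = (h (star a * x + x * star a)).re := by
        rw [hp.apply_star]; simp
      simp only [q, Q, h1, hL, jordanMul_apply]
      simp only [map_add, LinearMap.map_smul_of_tower, Complex.add_re, Complex.smul_re,
        smul_eq_mul, Complex.sub_re] at h2 ⊢
      linear_combination t * h2
    have h3 : ∀ t : ℝ, 2 * t * L ≤ t ^ 2 * (K ^ 2 * ‖x‖ ^ 2) + δ ^ 2 := fun t => by
      have h4 := hmin (a + t • x)
      rw [hexp] at h4
      nlinarith [hK x, sq_nonneg t]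
    rcases eq_or_ne x 0 with rfl | hx
    · simp [hL]
    have hx0 : 0 < ‖x‖ := norm_pos_iff.mpr hx
    have h6 := h3 (δ / (K * ‖x‖))
    have h7 := h3 (-(δ / (K * ‖x‖)))
    have h8 : (δ / (K * ‖x‖)) ^ 2 * (K ^ 2 * ‖x‖ ^ 2) = δ ^ 2 := by field_simp
    rw [neg_sq, h8] at h7
    rw [h8] at h6
    have h9 : δ ^ 2 = (δ / (K * ‖x‖)) * (ε / 2 * ‖x‖) := by rw [hδ]; field_simp
    have h10 : 0 < δ / (K * ‖x‖) := by positivity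
    rw [abs_le]
    constructor
    · refine le_of_mul_le_mul_left ?_ h10; linarith
    · refine le_of_mul_le_mul_left ?_ h10; linarith
  intro x
  have h1 := hre x
  have h2 := hre (Complex.I • x)
  have h3 : (f (Complex.I • x) - jordanMul (star a) h (Complex.I • x)).re =
      -(f x - jordanMul (star a) h x).im := by
    rw [map_smul, map_smul]; simp; ring
  rw [h3, abs_neg, norm_smul, Complex.norm_I, one_mul] at h2
  calc _ ≤ _ := Complex.norm_le_abs_re_add_abs_im _
    _ ≤ ε / 2 * ‖x‖ + ε / 2 * ‖x‖ := add_le_add h1 h2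
    _ = _ := by ring

end NormalFunctionals

section OrderNormal

variable {M : Type*} [CStarAlgebra M] [PartialOrder M] [StarOrderedRing M]
  {X : Type*} [NormedAddCommGroup X] [NormedSpace ℂ X] {e : StrongDual ℂ X ≃ₗᵢ⋆[ℂ] M}
  {f g h : M →ₗ[ℂ] ℂ}

lemma mul_self_le_of_le_one {d : M} (h0 : 0 ≤ d) (h1 : d ≤ 1) : d * d ≤ d := by
  simpa [pow_two] using CStarAlgebra.pow_antitone h0 h1 one_le_two

lemma BoundedlyWeakStar.zero : BoundedlyWeakStar e (0 : M →ₗ[ℂ] ℂ) := fun _ _ _ _ _ =>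
  tendsto_const_nhds

lemma IsPosFunctional.norm_jordanMul_le (hf : IsPosFunctional f) {d : M} (h0 : 0 ≤ d) (h1 : d ≤ 1)
    (y : M) : ‖jordanMul d f y‖ ≤ 2 * (Real.sqrt ((f d).re * (f 1).re) * ‖y‖) := by
  have hd : star d = d := IsSelfAdjoint.of_nonneg h0
  have hdd := hf.re_mono (mul_self_le_of_le_one h0 h1)
  have hd0 := hf.re_nonneg h0
  have h10 := hf.re_nonneg (zero_le_one' M)
  have key : ∀ {a b : ℝ}, 0 ≤ a → a ≤ (f (d * d)).re * b → 0 ≤ b → b ≤ (f 1).re * ‖y‖ ^ 2 →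
      Real.sqrt a ≤ Real.sqrt ((f d).re * (f 1).re) * ‖y‖ := by
    intro a b ha hab hb0 hb
    rw [Real.sqrt_le_left (by positivity), mul_pow, Real.sq_sqrt (by positivity)]
    calc a ≤ _ := hab
      _ ≤ (f d).re * b := by gcongr
      _ ≤ (f d).re * ((f 1).re * ‖y‖ ^ 2) := by gcongr
      _ = _ := by ring
  have hA : ‖f (d * y)‖ ≤ Real.sqrt ((f d).re * (f 1).re) * ‖y‖ := by
    have := hf.cauchy_schwarz d y
    rw [hd] at this
    rw [← Real.sqrt_sq (norm_nonneg (f (d * y)))]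
    refine key (sq_nonneg _) this (hf.re_nonneg (star_mul_self_nonneg y)) ?_
    have := hf.re_apply_le (IsSelfAdjoint.star_mul_self y)
    rwa [CStarRing.norm_star_mul_self, ← pow_two] at this
  have hB : ‖f (y * d)‖ ≤ Real.sqrt ((f d).re * (f 1).re) * ‖y‖ := by
    have := hf.cauchy_schwarz (star y) d
    rw [hd, star_star, mul_comm (Complex.re _)] at this
    rw [← Real.sqrt_sq (norm_nonneg (f (y * d)))]
    refine key (sq_nonneg _) this (hf.re_nonneg (mul_star_self_nonneg y)) ?_
    have := hf.re_apply_le (IsSelfAdjoint.mul_star_self y)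
    rwa [CStarRing.norm_self_mul_star, ← pow_two] at this
  rw [jordanMul_apply, map_add]
  linarith [norm_add_le (f (d * y)) (f (y * d))]

lemma jordanMul_add (a b : M) (f : M →ₗ[ℂ] ℂ) :
    jordanMul (a + b) f = jordanMul a f + jordanMul b f := by
  ext x; simp [add_mul, mul_add]; ring

lemma IsNormalPosFunctional.exists_maximal_jordan (e : StrongDual ℂ X ≃ₗᵢ⋆[ℂ] M)
    (hf : IsNormalPosFunctional f) :
    ∃ a, Maximal (· ∈ {a : M | 0 ≤ a ∧ a ≤ 1 ∧ BoundedlyWeakStar e (jordanMul a f)}) a := by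
  have hfp := hf.isPosFunctional
  have hfn := (isNormalPosFunctional_iff.mp hf).2
  suffices H : _ from (zorn_le_nonempty₀
    {a : M | 0 ≤ a ∧ a ≤ 1 ∧ BoundedlyWeakStar e (jordanMul a f)} H 0
    ⟨le_rfl, zero_le_one, by
      convert BoundedlyWeakStar.zero (e := e) using 1
      ext x; simp⟩).imp fun _ => And.right
  intro c hc hchain y hy
  have hne : c.Nonempty := ⟨y, hy⟩
  have : Nonempty c := ⟨⟨y, hy⟩⟩
  have hd : DirectedOn (· ≤ ·) c := hchain.directedOn
  have : IsDirectedOrder c := directedOn_univ_iff.mp fun a _ b _ => by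
    obtain ⟨z, hz, h1, h2⟩ := hd a a.2 b b.2
    exact ⟨⟨z, hz⟩, trivial, h1, h2⟩
  have h1 : (1 : M) ∈ upperBounds c := fun z hz => (hc hz).2.1
  obtain ⟨x, -, hx, -, -⟩ := exists_weakStarLim_of_directedOn e hne hd h1
    (Ultrafilter.of (atTop : Filter c)) (Ultrafilter.of_le _)
  refine ⟨x, ⟨(hc hy).1.trans (hx.1 hy), hx.2 h1, ?_⟩, hx.1⟩
  refine BoundedlyWeakStar.of_approx fun ε hε => ?_
  have hlim := hfn c x hne hd hx
  have hlim2 : Tendsto (fun p : c => 2 * Real.sqrt ((f (x - p)).re * (f 1).re)) atTop (𝓝 0) := by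
    have : Tendsto (fun p : c => f (x - p)) atTop (𝓝 0) := by
      simpa using (tendsto_const_nhds (x := f x)).sub hlim
    have h2 := (Complex.continuous_re.tendsto _).comp this
    have h3 := ((h2.mul_const (f 1).re).sqrt).const_mul 2
    simpa using h3
  obtain ⟨p, hp⟩ := (hlim2.eventually_lt_const hε).exists
  refine ⟨jordanMul p f, (hc p.2).2.2, fun y => ?_⟩
  have h3 : jordanMul x f y - jordanMul (p : M) f y = jordanMul (x - p) f y := by
    simp [sub_mul, mul_sub]; ring
  rw [h3]
  refine (hfp.norm_jordanMul_le (sub_nonneg.mpr (hx.1 p.2)) ?_ y).trans ?_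
  · exact (sub_le_self _ (hc p.2).1).trans (hx.2 h1)
  · rw [← mul_assoc]; gcongr

lemma IsNormalPosFunctional.exists_maximal_le (e : StrongDual ℂ X ≃ₗᵢ⋆[ℂ] M)
    (hf : IsNormalPosFunctional f) (hh : IsNormalPosFunctional h) {b : M} (hb : 0 ≤ b) :
    ∃ t, Maximal (· ∈ {t : M | 0 ≤ t ∧ t ≤ b ∧ (h t).re ≤ (f t).re}) t := by
  have hfn := (isNormalPosFunctional_iff.mp hf).2
  have hhn := (isNormalPosFunctional_iff.mp hh).2
  suffices H : _ from (zorn_le_nonempty₀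
    {t : M | 0 ≤ t ∧ t ≤ b ∧ (h t).re ≤ (f t).re} H 0 ⟨le_rfl, hb, by simp⟩).imp
      fun _ => And.right
  intro c hc hchain y hy
  have hne : c.Nonempty := ⟨y, hy⟩
  have : Nonempty c := ⟨⟨y, hy⟩⟩
  have hd : DirectedOn (· ≤ ·) c := hchain.directedOn
  have : IsDirectedOrder c := directedOn_univ_iff.mp fun a _ b _ => by
    obtain ⟨z, hz, h1, h2⟩ := hd a a.2 b b.2
    exact ⟨⟨z, hz⟩, trivial, h1, h2⟩
  have h1 : b ∈ upperBounds c := fun z hz => (hc hz).2.1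
  obtain ⟨x, -, hx, -, -⟩ := exists_weakStarLim_of_directedOn e hne hd h1
    (Ultrafilter.of (atTop : Filter c)) (Ultrafilter.of_le _)
  refine ⟨x, ⟨(hc hy).1.trans (hx.1 hy), hx.2 h1, ?_⟩, hx.1⟩
  exact le_of_tendsto_of_tendsto' ((Complex.continuous_re.tendsto _).comp (hhn c x hne hd hx))
    ((Complex.continuous_re.tendsto _).comp (hfn c x hne hd hx)) fun p => (hc p.2).2.2

/-- Order-normal positive functionals are weak-star continuous on bounded sets. -/
theorem IsNormalPosFunctional.boundedlyWeakStar (e : StrongDual ℂ X ≃ₗᵢ⋆[ℂ] M)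
    (hf : IsNormalPosFunctional f) : BoundedlyWeakStar e f := by
  have hfp := hf.isPosFunctional
  obtain ⟨a, ⟨ha0, ha1, haW⟩, hamax⟩ := hf.exists_maximal_jordan e
  by_cases hb : 1 - a = 0
  · rw [← sub_eq_zero.mp hb] at haW
    convert haW.smul (1 / 2) using 1
    ext x; simp; ring
  exfalso
  set b := 1 - a with hbdef
  have hb0 : 0 ≤ b := sub_nonneg.mpr ha1
  obtain ⟨g, hgW, hgp, hgb⟩ := exists_pos_boundedlyWeakStar e hb
  have hgb' : 0 < (g b).re := by
    have h1 := Complex.nonneg_iff.mp (hgp b hb0)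
    refine lt_of_le_of_ne h1.1 fun h0 => hgb (Complex.ext h0.symm h1.2.symm)
  set c : ℝ := ((f b).re + 1) / (g b).re with hc
  have hc0 : 0 ≤ c := div_nonneg (by linarith [hfp.re_nonneg hb0]) hgb'.le
  set h : M →ₗ[ℂ] ℂ := (c : ℂ) • g with hh
  have hhW : BoundedlyWeakStar e h := hgW.smul _
  have hhp : IsPosFunctional h := fun x hx => by
    rw [hh, LinearMap.smul_apply, smul_eq_mul]
    exact mul_nonneg (by exact_mod_cast hc0) (hgp x hx)
  have hlt : (f b).re < (h b).re := by
    rw [hh, LinearMap.smul_apply, smul_eq_mul, Complex.re_ofReal_mul, hc, div_mul_cancel₀ _ hgb'.ne']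
    linarith
  obtain ⟨t, ⟨ht0, htb, ht⟩, htmax⟩ :=
    hf.exists_maximal_le e (hhW.isNormalPosFunctional hhp) hb0
  set d := b - t with hd
  have hd0 : 0 ≤ d := sub_nonneg.mpr htb
  have hdne : d ≠ 0 := fun h0 => by
    rw [sub_eq_zero] at h0
    rw [← h0] at ht
    linarith
  have hd1 : d ≤ 1 := by
    calc d ≤ b := sub_le_self _ ht0
      _ ≤ 1 := sub_le_self _ ha0
  have hds : star d = d := IsSelfAdjoint.of_nonneg hd0
  have hle : ∀ y, 0 ≤ y → y ≤ d → (f y).re ≤ (h y).re := by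
    intro y hy0 hyd
    by_contra! hcon
    have h1 : t + y ≤ t := htmax ⟨add_nonneg ht0 hy0, by
      calc t + y ≤ t + d := by gcongr
        _ = b := by simp [hd], by
      rw [map_add, map_add, Complex.add_re, Complex.add_re]; linarith⟩ (le_add_of_nonneg_right hy0)
    have h2 : y = 0 := le_antisymm (by simpa using h1) hy0
    simp [h2] at hcon
  have hle2 : ∀ y, 0 ≤ y → (f (d * y * d)).re ≤ (h (d * y * d)).re := by
    intro y hy
    rcases eq_or_ne y 0 with rfl | hyne
    · simp
    have hn : 0 < ‖y‖ := norm_pos_iff.mpr hyne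
    have h1 := hle (‖y‖⁻¹ • (d * y * d)) (smul_nonneg (by positivity)
      ((IsSelfAdjoint.of_nonneg hd0).conjugate_nonneg hy)) (by
      have h2 := (IsSelfAdjoint.of_nonneg hd0).conjugate_le_conjugate
        ((IsSelfAdjoint.of_nonneg hy).le_smul_one le_rfl)
      calc ‖y‖⁻¹ • (d * y * d) ≤ ‖y‖⁻¹ • (d * ‖y‖ • 1 * d) := by gcongr
        _ = d * d := by
          rw [mul_smul_comm, smul_mul_assoc, smul_smul, inv_mul_cancel₀ hn.ne']; simp
        _ ≤ d := mul_self_le_of_le_one hd0 hd1)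
    rw [LinearMap.map_smul_of_tower, LinearMap.map_smul_of_tower, Complex.smul_re, Complex.smul_re,
      smul_eq_mul, smul_eq_mul] at h1
    exact le_of_mul_le_mul_left h1 (by positivity)
  have hdW : BoundedlyWeakStar e (jordanMul d f) := by
    have h10 := hfp.re_nonneg (zero_le_one' M)
    refine (hhW.conj_of_isSelfAdjoint (a := d) hds).of_sq_le ?_
      (C := 2 * (f 1).re) (by positivity) fun x => ?_
    · intro x hx
      rw [conjMul_apply]
      exact hhp _ (star_left_conjugate_nonneg hx d)
    have h1 := hfp.norm_apply_le (x * d)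
    have h2 := hfp.norm_apply_le' (d * x)
    have e1 : star (x * d) * (x * d) = d * (star x * x) * d := by
      rw [star_mul, hds]; simp only [mul_assoc]
    have e2 : d * x * star (d * x) = d * (x * star x) * d := by
      rw [star_mul, hds]; simp only [mul_assoc]
    rw [e1] at h1
    rw [e2] at h2
    have h3 := mul_le_mul_of_nonneg_left (hle2 _ (star_mul_self_nonneg x)) h10
    have h4 := mul_le_mul_of_nonneg_left (hle2 _ (mul_star_self_nonneg x)) h10
    have h5 : (f (x * d)).re ^ 2 ≤ ‖f (x * d)‖ ^ 2 := sq_le_sq' (by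
      linarith [(abs_le.mp (Complex.abs_re_le_norm (f (x * d)))).1]) (Complex.re_le_norm _)
    have h6 : (f (d * x)).re ^ 2 ≤ ‖f (d * x)‖ ^ 2 := sq_le_sq' (by
      linarith [(abs_le.mp (Complex.abs_re_le_norm (f (d * x)))).1]) (Complex.re_le_norm _)
    rw [jordanMul_apply, conjMul_apply, hds, mul_add, add_mul, map_add, map_add, Complex.add_re,
      Complex.add_re]
    nlinarith [sq_nonneg ((f (d * x)).re - (f (x * d)).re)]
  have h1 : a + d ≤ a := hamax ⟨add_nonneg ha0 hd0, by
    calc a + d ≤ a + b := by gcongr; exact sub_le_self _ ht0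
      _ = 1 := by simp [hbdef], by
    rw [jordanMul_add]; exact haW.add hdW⟩ (le_add_of_nonneg_right hd0)
  exact hdne (le_antisymm (by simpa using h1) hd0)

end OrderNormal

section KreinSmulian

variable {M : Type*} [CStarAlgebra M] [PartialOrder M] [StarOrderedRing M]
  {X : Type*} [NormedAddCommGroup X] [NormedSpace ℂ X] {e : StrongDual ℂ X ≃ₗᵢ⋆[ℂ] M}

lemma predualPairing_real_smul (t : ℝ) (k : X) (m : M) :
    predualPairing e ((t : ℂ) • k) m = t * predualPairing e k m := by
  simp [predualPairing]

lemma norm_le_of_predualPairing_le_one {m : M} {δ : ℝ} (hδ : 0 < δ)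
    (h : ∀ k : X, ‖k‖ ≤ 1 / δ → ‖predualPairing e k m‖ ≤ 1) : ‖m‖ ≤ δ := by
  refine norm_le_of_predualPairing e hδ.le fun k => ?_
  rcases eq_or_ne k 0 with rfl | hk
  · simp [predualPairing]
  have hk0 : 0 < ‖k‖ := norm_pos_iff.mpr hk
  have h1 := h (((1 / (δ * ‖k‖) : ℝ) : ℂ) • k) (by
    rw [norm_smul, Complex.norm_real, Real.norm_of_nonneg (by positivity)]
    exact le_of_eq (by field_simp))
  rw [predualPairing_real_smul, norm_mul, Complex.norm_real, Real.norm_of_nonneg (by positivity)]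
    at h1
  rw [div_mul_eq_mul_div, one_mul, div_le_one (by positivity)] at h1
  exact h1

/-- One step of the Krein–Šmulian construction. -/
lemma exists_finset_predualPairing (e : StrongDual ℂ X ≃ₗᵢ⋆[ℂ] M) {S : Set M}
    (hS : ∀ (U : Ultrafilter (Finset X)) (u : Finset X → M) (r : ℝ) (x : M),
      (∀ᶠ F in U, u F ∈ S ∧ ‖u F‖ ≤ r) → WeakStarLim e U u x → x ∈ S) {δ δ' : ℝ} (hδ : 0 < δ)
    {G : Finset X} (hG : ∀ m ∈ S, ‖m‖ ≤ δ → ∃ k ∈ G, 1 < ‖predualPairing e k m‖) :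
    ∃ F : Finset X, (∀ k ∈ F, ‖k‖ ≤ 1 / δ) ∧
      ∀ m ∈ S, ‖m‖ ≤ δ' → (∃ k ∈ G, 1 < ‖predualPairing e k m‖) ∨
        ∃ k ∈ F, 1 < ‖predualPairing e k m‖ := by
  classical
  by_contra! hcon
  have hcon' : ∀ F : Finset X, ∃ m ∈ S, ‖m‖ ≤ δ' ∧ (∀ k ∈ G, ‖predualPairing e k m‖ ≤ 1) ∧
      ∀ k ∈ F, ‖k‖ ≤ 1 / δ → ‖predualPairing e k m‖ ≤ 1 := by
    intro F
    obtain ⟨m, hm, h1, h2, h3⟩ := hcon (F.filter fun k => ‖k‖ ≤ 1 / δ)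
      (fun k hk => (Finset.mem_filter.mp hk).2)
    exact ⟨m, hm, h1, h2, fun k hk hk' => h3 k (Finset.mem_filter.mpr ⟨hk, hk'⟩)⟩
  choose u huS hub huG huF using hcon'
  set U : Ultrafilter (Finset X) := Ultrafilter.of atTop
  have hU : (U : Filter (Finset X)) ≤ atTop := Ultrafilter.of_le _
  obtain ⟨x, -, hx⟩ := exists_weakStarLim e U u (Eventually.of_forall hub)
  have hxS := hS U u δ' x (Eventually.of_forall fun F => ⟨huS F, hub F⟩) hx
  have hxδ : ‖x‖ ≤ δ := norm_le_of_predualPairing_le_one (e := e) hδ fun k hk =>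
    le_of_tendsto (hx k).norm (hU ((eventually_ge_atTop {k}).mono fun F hF =>
      huF F k (hF (Finset.mem_singleton_self k)) hk))
  obtain ⟨k, hk, h1⟩ := hG x hxS hxδ
  exact absurd (le_of_tendsto (hx k).norm (Eventually.of_forall fun F => huG F k hk)) (not_le.mpr h1)

/-- A set of functionals in the predual, norm-convergent to zero, whose polar misses `S`. -/
lemma exists_nullSet_predualPairing (e : StrongDual ℂ X ≃ₗᵢ⋆[ℂ] M) {S : Set M}
    (hS : ∀ (U : Ultrafilter (Finset X)) (u : Finset X → M) (r : ℝ) (x : M),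
      (∀ᶠ F in U, u F ∈ S ∧ ‖u F‖ ≤ r) → WeakStarLim e U u x → x ∈ S) {δ : ℝ} (hδ : 0 < δ)
    (hδS : ∀ m ∈ S, δ < ‖m‖) :
    ∃ (K : Set X) (r : ℝ), (∀ k ∈ K, ‖k‖ ≤ r) ∧
      (∀ ε : ℝ, 0 < ε → ∃ G : Finset X, ∀ k ∈ K, k ∈ G ∨ ‖k‖ ≤ ε) ∧
      ∀ m ∈ S, ∃ k ∈ K, 1 < ‖predualPairing e k m‖ := by
  classical
  let P : ℕ → Type _ := fun n => {G : Finset X // ∀ m ∈ S, ‖m‖ ≤ (n + 1) * δ →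
    ∃ k ∈ G, 1 < ‖predualPairing e k m‖}
  have step : ∀ (n : ℕ) (G : P n), ∃ G' : P (n + 1), G.1 ⊆ G'.1 ∧
      ∀ k ∈ G'.1, k ∈ G.1 ∨ ‖k‖ ≤ 1 / ((n + 1) * δ) := by
    intro n G
    obtain ⟨F, hF, h2⟩ := exists_finset_predualPairing e hS (δ' := ((n + 1 : ℕ) + 1) * δ)
      (by positivity) G.2
    refine ⟨⟨G.1 ∪ F, fun m hm hm' => ?_⟩, Finset.subset_union_left, fun k hk => ?_⟩
    · rcases h2 m hm hm' with ⟨k, hk, h⟩ | ⟨k, hk, h⟩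
      · exact ⟨k, Finset.mem_union_left _ hk, h⟩
      · exact ⟨k, Finset.mem_union_right _ hk, h⟩
    · rcases Finset.mem_union.mp hk with h | h
      · exact Or.inl h
      · exact Or.inr (hF k h)
  choose nxt hsub hnxt using step
  let G : ∀ n, P n := fun n => Nat.rec (motive := P)
    ⟨∅, fun m hm hm' => absurd hm' (by simpa using hδS m hm)⟩ (fun n G => nxt n G) n
  have hGs : ∀ n, G (n + 1) = nxt n (G n) := fun n => rfl
  have hmono : Monotone fun n => (G n).1 := monotone_nat_of_le_succ fun n => by
    rw [hGs]; exact hsub n (G n)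
  have hsmall : ∀ N n, N ≤ n → ∀ k ∈ (G n).1, k ∈ (G N).1 ∨ ‖k‖ ≤ 1 / ((N + 1) * δ) := by
    intro N n hn
    induction n, hn using Nat.le_induction with
    | base => exact fun k hk => Or.inl hk
    | succ n hn ih =>
      intro k hk
      rw [hGs] at hk
      rcases hnxt n (G n) k hk with h | h
      · exact ih k h
      · refine Or.inr (h.trans ?_)
        gcongr
  have hsmall' : ∀ N n, ∀ k ∈ (G n).1, k ∈ (G N).1 ∨ ‖k‖ ≤ 1 / ((N + 1) * δ) := fun N n k hk => by
    rcases le_total N n with h | h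
    · exact hsmall N n h k hk
    · exact Or.inl (hmono h hk)
  refine ⟨⋃ n, ((G n).1 : Set X), 1 / δ, fun k hk => ?_, fun ε hε => ?_, fun m hm => ?_⟩
  · obtain ⟨n, hn⟩ := Set.mem_iUnion.mp hk
    rcases hsmall' 0 n k hn with h | h
    · exact absurd h (Finset.notMem_empty k)
    · simpa using h
  · obtain ⟨N, hN⟩ := exists_nat_gt (1 / (ε * δ))
    refine ⟨(G N).1, fun k hk => ?_⟩
    obtain ⟨n, hn⟩ := Set.mem_iUnion.mp hk
    refine (hsmall' N n k hn).imp_right fun h => h.trans ?_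
    rw [div_lt_iff₀ (by positivity)] at hN
    rw [div_le_iff₀ (by positivity)]
    nlinarith [mul_pos hε hδ]
  · obtain ⟨N, hN⟩ := exists_nat_gt (‖m‖ / δ)
    rw [div_lt_iff₀ hδ] at hN
    obtain ⟨k, hk, h⟩ := (G N).2 m hm (by nlinarith)
    exact ⟨k, Set.mem_iUnion.mpr ⟨N, hk⟩, h⟩

/-- **Krein–Šmulian theorem** for subspaces: a subspace closed under bounded weak-star limits is
separated from outside points by functionals that are weak-star continuous on bounded sets. -/
theorem exists_boundedlyWeakStar_separating (e : StrongDual ℂ X ≃ₗᵢ⋆[ℂ] M) {𝒢 : Submodule ℂ M}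
    (h𝒢 : ∀ (U : Ultrafilter M) (r : ℝ) (x : M),
      (∀ᶠ m : M in U, m ∈ 𝒢 ∧ ‖m‖ ≤ r) → WeakStarLim e U id x → x ∈ 𝒢) {x : M} (hx : x ∉ 𝒢) :
    ∃ h : M →ₗ[ℂ] ℂ, BoundedlyWeakStar e h ∧ (∀ m ∈ 𝒢, h m = 0) ∧ h x ≠ 0 := by
  set S : Set M := {m | x + m ∈ 𝒢} with hSdef
  have hS : ∀ (U : Ultrafilter (Finset X)) (u : Finset X → M) (r : ℝ) (y : M),
      (∀ᶠ F in U, u F ∈ S ∧ ‖u F‖ ≤ r) → WeakStarLim e U u y → y ∈ S := fun U u r y hu hy =>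
    h𝒢 (U.map fun F => x + u F) (‖x‖ + r) _
      (hu.mono fun F hF => ⟨hF.1, (norm_add_le _ _).trans (by gcongr; exact hF.2)⟩)
      ((WeakStarLim.const x).add hy :)
  obtain ⟨δ, hδ, hδS⟩ : ∃ δ : ℝ, 0 < δ ∧ ∀ m ∈ S, δ < ‖m‖ := by
    by_contra! hcon
    choose! u hu using hcon
    have hmem : ∀ n : ℕ, x + u (1 / (n + 1)) ∈ 𝒢 := fun n => (hu _ (by positivity)).1
    have hnorm : ∀ n : ℕ, ‖u (1 / (n + 1))‖ ≤ 1 / (n + 1) := fun n => (hu _ (by positivity)).2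
    have hlim : Tendsto (fun n : ℕ => u (1 / (n + 1))) atTop (𝓝 0) :=
      squeeze_zero_norm hnorm tendsto_one_div_add_atTop_nhds_zero_nat
    refine hx (h𝒢 ((Ultrafilter.of (atTop : Filter ℕ)).map fun n : ℕ => x + u (1 / ((n : ℝ) + 1))) (‖x‖ + 1) x
      (eventually_map.mpr <| Eventually.of_forall fun n : ℕ => ⟨hmem n, (norm_add_le _ _).trans ?_⟩) fun k => ?_)
    · gcongr
      exact (hnorm n).trans (by rw [div_le_one (by positivity)]; linarith [n.cast_nonneg (α := ℝ)])
    · have h1 : Tendsto (fun n : ℕ => x + u (1 / (n + 1))) (Ultrafilter.of (atTop : Filter ℕ)) (𝓝 x) := by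
        simpa using (tendsto_const_nhds (x := x)).add (hlim.mono_left (Ultrafilter.of_le _))
      have hc : Continuous (predualPairing e k) :=
        AddMonoidHomClass.continuous_of_bound _ ‖k‖ (norm_predualPairing_le e k)
      exact (hc.tendsto x).comp h1
  obtain ⟨K, r, hKr, hKε, hKS⟩ := exists_nullSet_predualPairing e hS hδ hδS
  let p₀ : K → Seminorm ℂ M := fun k => (normSeminorm ℂ ℂ).comp (predualPairing e (k : X))
  have hp₀ : ∀ k m, p₀ k m = ‖predualPairing e (k : X) m‖ := fun _ _ => rfl
  have hbddm : ∀ m, BddAbove (Set.range fun k => p₀ k m) := fun m => by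
    refine ⟨r * ‖m‖, ?_⟩
    rintro _ ⟨k, rfl⟩
    exact (norm_predualPairing_le e _ m).trans (by gcongr; exact hKr k k.2)
  have hbdd : BddAbove (Set.range p₀) := by
    rw [Seminorm.bddAbove_range_iff]
    exact hbddm
  have hp : ∀ m, (⨆ k, p₀ k) m = ⨆ k, p₀ k m := fun m => Seminorm.iSup_apply hbdd
  obtain ⟨h₀, hh₀x, hh₀⟩ := Submodule.exists_dual_map_eq_bot_of_notMem hx inferInstance
  have hh₀g : ∀ m ∈ 𝒢, h₀ m = 0 := fun m hm => by
    have : h₀ m ∈ 𝒢.map h₀ := ⟨m, hm, rfl⟩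
    rwa [hh₀, Submodule.mem_bot] at this
  have hpS : ∀ m ∈ S, 1 ≤ (⨆ k, p₀ k) m := fun m hm => by
    obtain ⟨k, hk, h1⟩ := hKS m hm
    rw [hp]
    exact h1.le.trans (le_ciSup (hbddm m) ⟨k, hk⟩)
  have hdom : ∀ y : (𝒢 ⊔ Submodule.span ℂ {x} : Submodule ℂ M),
      ‖((h₀ x)⁻¹ • h₀).domRestrict (𝒢 ⊔ Submodule.span ℂ {x}) y‖ ≤ (⨆ k, p₀ k) (y : M) := by
    rintro ⟨y, hy⟩
    obtain ⟨g, hg, z, hz, rfl⟩ := Submodule.mem_sup.mp hy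
    obtain ⟨t, rfl⟩ := Submodule.mem_span_singleton.mp hz
    simp only [LinearMap.domRestrict_apply, LinearMap.smul_apply, map_add, hh₀g g hg, zero_add,
      map_smul, smul_eq_mul, mul_zero]
    rw [inv_mul_cancel₀ hh₀x, mul_one]
    rcases eq_or_ne t 0 with rfl | ht
    · simp
    have h1 : g + t • x = (-t) • (-(t⁻¹ • g) - x) := by
      rw [smul_sub, neg_smul, smul_neg, smul_smul, mul_inv_cancel₀ ht]
      simp
    rw [h1, map_smul_eq_mul, norm_neg]
    refine le_mul_of_one_le_right (norm_nonneg _) (hpS _ ?_)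
    change x + (-(t⁻¹ • g) - x) ∈ 𝒢
    rw [add_sub_cancel]
    exact neg_mem (Submodule.smul_mem _ _ hg)
  obtain ⟨h, hh, hhp⟩ := Module.Dual.exists_extension_of_le_seminorm _ _ hdom
  refine ⟨h, ?_, fun m hm => ?_, ?_⟩
  · intro U R y hR hy
    have hR0 : 0 ≤ R := by
      obtain ⟨a, ha⟩ := hR.exists
      exact (norm_nonneg _).trans ha
    rw [Metric.tendsto_nhds]
    intro ε hε
    obtain ⟨G, hG⟩ := hKε (ε / 2 / (R + ‖y‖ + 1)) (by positivity)
    have h1 : ∀ᶠ m : M in U, ∀ k ∈ G, ‖predualPairing e k (m - y)‖ ≤ ε / 2 := by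
      rw [Filter.eventually_all_finset]
      intro k _
      have h2 := ((hy k).sub_const (predualPairing e k y)).norm
      rw [sub_self, norm_zero] at h2
      refine (h2.eventually_le_const (show 0 < ε / 2 by positivity)).mono fun m hm => ?_
      rwa [map_sub]
    filter_upwards [h1, hR] with m hm hmR
    rw [dist_eq_norm, ← map_sub]
    refine (hhp _).trans_lt (lt_of_le_of_lt ?_ (half_lt_self hε))
    rw [hp]
    refine Real.iSup_le (fun k => ?_) (by positivity)
    rcases hG k k.2 with h3 | h3
    · exact hm k h3
    · rw [hp₀]
      refine (norm_predualPairing_le e _ _).trans ?_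
      have h4 : ‖m - y‖ ≤ R + ‖y‖ + 1 := (norm_sub_le _ _).trans (by linarith)
      calc _ ≤ (ε / 2 / (R + ‖y‖ + 1)) * (R + ‖y‖ + 1) := by gcongr
        _ = ε / 2 := by field_simp
  · have := hh ⟨m, Submodule.mem_sup_left hm⟩
    simp only at this
    rw [this]
    simp [hh₀g m hm]
  · have := hh ⟨x, Submodule.mem_sup_right (Submodule.mem_span_singleton_self x)⟩
    simp only at this
    rw [this]
    simp [hh₀x]

end KreinSmulian

section NormalDual

variable (M : Type*) [CStarAlgebra M] [PartialOrder M]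

/-- The predual of a von Neumann algebra, realised as the span of the normal positive
functionals. -/
def normalDual : Submodule ℂ (M →ₗ[ℂ] ℂ) := Submodule.span ℂ {f | IsNormalPosFunctional f}

variable {M}

/-- Convergence against all normal functionals. -/
def NormalLim {α : Type*} (l : Filter α) (u : α → M) (x : M) : Prop :=
  ∀ f ∈ normalDual M, Tendsto (fun a => f (u a)) l (𝓝 (f x))

lemma IsNormalPosFunctional.mem_normalDual {f : M →ₗ[ℂ] ℂ} (hf : IsNormalPosFunctional f) :
    f ∈ normalDual M := Submodule.subset_span hf

lemma continuous_sigmaWeak_of_mem_normalDual {f : M →ₗ[ℂ] ℂ} (hf : f ∈ normalDual M) :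
    Continuous[sigmaWeak M, inferInstance] f := by
  let _ := sigmaWeak M
  refine Submodule.span_induction (p := fun (f : M →ₗ[ℂ] ℂ) _ => Continuous f) (fun g hg => ?_) continuous_const
    (fun f g _ _ hf hg => hf.add hg) (fun c f _ hf => hf.const_smul c) hf
  have h1 : Continuous fun (m : M) (f : { f : M →ₗ[ℂ] ℂ // IsNormalPosFunctional f }) => f.1 m :=
    continuous_induced_dom
  exact continuous_pi_iff.mp h1 ⟨g, hg⟩

variable {α : Type*} {l : Filter α} {u v : α → M} {x y : M}

lemma NormalLim.add (h : NormalLim l u x) (h' : NormalLim l v y) :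
    NormalLim l (fun a => u a + v a) (x + y) := fun f hf => by
  simpa using (h f hf).add (h' f hf)

lemma NormalLim.smul (c : ℂ) (h : NormalLim l u x) : NormalLim l (fun a => c • u a) (c • x) :=
  fun f hf => by simpa using (h f hf).const_mul c

lemma NormalLim.tendsto_sigmaWeak (h : NormalLim l u x) :
    Tendsto u l (@nhds M (sigmaWeak M) x) := by
  rw [sigmaWeak, nhds_induced, tendsto_comap_iff, tendsto_pi_nhds]
  exact fun f => h f.1 f.2.mem_normalDual

variable [StarOrderedRing M] {X : Type*} [NormedAddCommGroup X] [NormedSpace ℂ X]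

lemma mem_normalDual_iff (e : StrongDual ℂ X ≃ₗᵢ⋆[ℂ] M) {f : M →ₗ[ℂ] ℂ} :
    f ∈ normalDual M ↔ BoundedlyWeakStar e f := by
  refine ⟨fun hf => ?_, fun hf => ?_⟩
  · exact Submodule.span_induction (p := fun f _ => BoundedlyWeakStar e f)
      (fun g hg => hg.boundedlyWeakStar e) BoundedlyWeakStar.zero
      (fun f g _ _ hf hg => hf.add hg) (fun c f _ hf => hf.smul c) hf
  · refine Submodule.span_mono ?_ hf.mem_span
    exact fun g hg => hg.1.isNormalPosFunctional hg.2

lemma normalLim_of_weakStarLim {e : StrongDual ℂ X ≃ₗᵢ⋆[ℂ] M} {U : Ultrafilter α} {r : ℝ}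
    (hu : ∀ᶠ a in U, ‖u a‖ ≤ r) (h : WeakStarLim e U u x) : NormalLim U u x := fun _ hf =>
  ((mem_normalDual_iff e).mp hf).tendsto hu h

variable [WStarAlgebra M]

lemma exists_normalLim (U : Ultrafilter α) (u : α → M) {r : ℝ} (hu : ∀ᶠ a in U, ‖u a‖ ≤ r) :
    ∃ x, ‖x‖ ≤ r ∧ NormalLim U u x := by
  obtain ⟨X, _, _, _, ⟨e⟩⟩ := WStarAlgebra.exists_predual (M := M)
  obtain ⟨x, hx, h⟩ := exists_weakStarLim e U u hu
  exact ⟨x, hx, normalLim_of_weakStarLim hu h⟩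

lemma mem_normalDual_of_tendsto {f : M →ₗ[ℂ] ℂ}
    (hf : ∀ (U : Ultrafilter M) (r : ℝ) (x : M), (∀ᶠ m : M in U, ‖m‖ ≤ r) → NormalLim U id x →
      Tendsto f U (𝓝 (f x))) : f ∈ normalDual M := by
  obtain ⟨X, _, _, _, ⟨e⟩⟩ := WStarAlgebra.exists_predual (M := M)
  exact (mem_normalDual_iff e).mpr fun U r x hr hx => hf U r x hr (normalLim_of_weakStarLim hr hx)

lemma mem_normalDual_of_continuous {f : M →ₗ[ℂ] ℂ} (hf : Continuous[sigmaWeak M, inferInstance] f) :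
    f ∈ normalDual M := by
  refine mem_normalDual_of_tendsto fun U r x _ hx => ?_
  let _ := sigmaWeak M
  exact (hf.tendsto x).comp hx.tendsto_sigmaWeak

lemma mem_normalDual_of_approx {f : M →ₗ[ℂ] ℂ}
    (hf : ∀ ε : ℝ, 0 < ε → ∃ g ∈ normalDual M, ∀ x, ‖f x - g x‖ ≤ ε * ‖x‖) : f ∈ normalDual M := by
  obtain ⟨X, _, _, _, ⟨e⟩⟩ := WStarAlgebra.exists_predual (M := M)
  refine (mem_normalDual_iff e).mpr (.of_approx fun ε hε => ?_)
  obtain ⟨g, hg, h⟩ := hf ε hε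
  exact ⟨g, (mem_normalDual_iff e).mp hg, h⟩

lemma eq_zero_of_normalDual (hx : ∀ f : M →ₗ[ℂ] ℂ, IsNormalPosFunctional f → f x = 0) : x = 0 := by
  obtain ⟨X, _, _, _, ⟨e⟩⟩ := WStarAlgebra.exists_predual (M := M)
  by_contra hne
  obtain ⟨g, hg, hp, h⟩ := exists_pos_boundedlyWeakStar e hne
  exact h (hx g (hg.isNormalPosFunctional hp))

lemma eq_of_normalDual (hx : ∀ f ∈ normalDual M, f x = f y) : x = y :=
  sub_eq_zero.mp <| eq_zero_of_normalDual fun f hf => by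
    rw [map_sub, hx f hf.mem_normalDual, sub_self]

lemma NormalLim.unique [NeBot l] (h : NormalLim l u x) (h' : NormalLim l u y) : x = y :=
  eq_of_normalDual fun f hf => tendsto_nhds_unique (h f hf) (h' f hf)

/-- Krein–Šmulian: a σ-weakly dense subspace closed under bounded σ-weak limits is everything. -/
theorem eq_top_of_dense_of_normalLim {𝒢 : Submodule ℂ M} (hd : @Dense M (sigmaWeak M) 𝒢)
    (h𝒢 : ∀ (U : Ultrafilter M) (r : ℝ) (x : M),
      (∀ᶠ m : M in U, m ∈ 𝒢 ∧ ‖m‖ ≤ r) → NormalLim U id x → x ∈ 𝒢) : 𝒢 = ⊤ := by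
  obtain ⟨X, _, _, _, ⟨e⟩⟩ := WStarAlgebra.exists_predual (M := M)
  refine eq_top_iff.mpr fun x _ => ?_
  by_contra hx
  obtain ⟨h, hh, h0, hne⟩ := exists_boundedlyWeakStar_separating e (fun U r x hU hlim =>
    h𝒢 U r x hU (normalLim_of_weakStarLim (hU.mono fun _ => And.right) hlim)) hx
  let _ := sigmaWeak M
  have hc := continuous_sigmaWeak_of_mem_normalDual ((mem_normalDual_iff e).mpr hh)
  have := congrFun (hc.ext_on hd (continuous_const (y := (0 : ℂ))) fun m hm => h0 m hm) x
  exact hne this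

lemma isNormalPosFunctional_iff_exists_lt {f : M →ₗ[ℂ] ℂ} : IsNormalPosFunctional f ↔
    IsPosFunctional f ∧ ∀ (s : Set M) (x : M), s.Nonempty → DirectedOn (· ≤ ·) s → IsLUB s x →
      ∀ ε : ℝ, 0 < ε → ∃ p ∈ s, (f x).re < (f p).re + ε := by
  rw [isNormalPosFunctional_iff]
  refine and_congr_right fun hp => forall₂_congr fun s x => forall₃_congr fun hne hd hx => ?_
  have : Nonempty s := hne.to_subtype
  have : IsDirectedOrder s := directedOn_univ_iff.mp fun a _ b _ => by
    obtain ⟨z, hz, h1, h2⟩ := hd a a.2 b b.2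
    exact ⟨⟨z, hz⟩, trivial, h1, h2⟩
  refine ⟨fun h ε hε => ?_, fun h => ?_⟩
  · have h1 := (Complex.continuous_re.tendsto _).comp h
    obtain ⟨p, hp⟩ := (h1.eventually_const_lt (sub_lt_self (f x).re hε)).exists
    exact ⟨p, p.2, by simpa [sub_lt_iff_lt_add] using hp⟩
  · rw [Metric.tendsto_nhds]
    intro ε hε
    obtain ⟨p, hps, hpx⟩ := h ε hε
    filter_upwards [eventually_ge_atTop (⟨p, hps⟩ : s)] with q hq
    have h1 := hp _ (sub_nonneg.mpr (hx.1 q.2))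
    have h2 := hp.re_mono (show p ≤ (q : M) from hq)
    rw [dist_comm, dist_eq_norm, ← map_sub, ← Complex.re_eq_norm.mpr h1, map_sub, Complex.sub_re]
    linarith

lemma IsNormalPosFunctional.conjMul_of_isUnit {f : M →ₗ[ℂ] ℂ} (hf : IsNormalPosFunctional f)
    {c : M} (hc : IsUnit c) : IsNormalPosFunctional (conjMul c f) := by
  obtain ⟨hp, hn⟩ := isNormalPosFunctional_iff_exists_lt.mp hf
  refine isNormalPosFunctional_iff_exists_lt.mpr
    ⟨fun x hx => hp _ (star_left_conjugate_nonneg hx c), fun s x hne hd hx ε hε => ?_⟩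
  obtain ⟨c, rfl⟩ := hc
  have h1 : star ((↑c⁻¹ : M)) * star (c : M) = 1 := by rw [← star_mul, Units.mul_inv, star_one]
  have h2 : star (c : M) * star ((↑c⁻¹ : M)) = 1 := by rw [← star_mul, Units.inv_mul, star_one]
  let φ : M ≃o M :=
    { toFun := fun y => star (c : M) * y * c
      invFun := fun y => star (↑c⁻¹ : M) * y * (↑c⁻¹ : M)
      left_inv := fun y => by
        calc _ = (star (↑c⁻¹ : M) * star (c : M)) * y * (c * ↑c⁻¹) := by simp only [mul_assoc]
          _ = y := by rw [h1, Units.mul_inv, one_mul, mul_one]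
      right_inv := fun y => by
        calc _ = (star (c : M) * star (↑c⁻¹ : M)) * y * (↑c⁻¹ * c) := by simp only [mul_assoc]
          _ = y := by rw [h2, Units.inv_mul, one_mul, mul_one]
      map_rel_iff' := fun {a b} => by
        refine ⟨fun h => ?_, fun h => star_left_conjugate_le_conjugate h _⟩
        have h3 := star_left_conjugate_le_conjugate h (↑c⁻¹ : M)
        have h4 : ∀ y : M, star (↑c⁻¹ : M) * (star (c : M) * y * c) * (↑c⁻¹ : M) = y := fun y => by
          calc _ = (star (↑c⁻¹ : M) * star (c : M)) * y * (c * ↑c⁻¹) := by simp only [mul_assoc]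
            _ = y := by rw [h1, Units.mul_inv, one_mul, mul_one]
        simpa only [Equiv.coe_fn_mk, h4] using h3 }
  obtain ⟨_, ⟨p, hp, rfl⟩, hlt⟩ := hn (φ '' s) (φ x) (hne.image _)
    (by
      rintro _ ⟨a, ha, rfl⟩ _ ⟨b, hb, rfl⟩
      obtain ⟨z, hz, h3, h4⟩ := hd a ha b hb
      exact ⟨_, ⟨z, hz, rfl⟩, φ.monotone h3, φ.monotone h4⟩) (φ.isLUB_image'.mpr hx) ε hε
  exact ⟨p, hp, hlt⟩

lemma isUnit_smul_one_sub {a : M} {z : ℂ} (h : ‖a‖ * ‖(1 : M)‖ < ‖z‖) : IsUnit (z • (1 : M) - a) := by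
  have := spectrum.mem_resolventSet_of_norm_lt_mul h
  rwa [spectrum.mem_resolventSet_iff, Algebra.algebraMap_eq_smul_one] at this

lemma IsNormalPosFunctional.mulRight_mem {f : M →ₗ[ℂ] ℂ} (hf : IsNormalPosFunctional f) (a : M) :
    f ∘ₗ LinearMap.mulRight ℂ a ∈ normalDual M := by
  set r : ℝ := ‖a‖ * ‖(1 : M)‖ + 1 with hr
  have hr0 : 0 < r := by positivity
  have hmem : ∀ z : ℂ, ‖z‖ = 1 → conjMul ((r * z) • (1 : M) - a) f ∈ normalDual M := fun z hz =>
    (hf.conjMul_of_isUnit (isUnit_smul_one_sub (by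
      rw [norm_mul, hz, Complex.norm_real, Real.norm_of_nonneg hr0.le]; linarith))).mem_normalDual
  have h1 := Submodule.smul_mem _ (-(1 / (4 * r) : ℂ)) (add_mem (add_mem (hmem 1 (by simp))
    (Submodule.smul_mem _ Complex.I (hmem Complex.I (by simp))))
    (add_mem (Submodule.smul_mem _ (-1) (hmem (-1) (by simp)))
    (Submodule.smul_mem _ (-Complex.I) (hmem (-Complex.I) (by simp)))))
  convert h1 using 1
  ext x
  have hr' : (r : ℂ) ≠ 0 := by exact_mod_cast hr0.ne'
  simp only [LinearMap.comp_apply, LinearMap.mulRight_apply, LinearMap.smul_apply,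
    LinearMap.add_apply, conjMul_apply, star_sub, star_smul, star_one, sub_mul, mul_sub,
    smul_mul_assoc, mul_smul_comm, one_mul, mul_one, map_sub, map_smul, smul_eq_mul]
  simp
  field_simp
  ring_nf
  simp
  ring

lemma IsNormalPosFunctional.mulLeft_mem {f : M →ₗ[ℂ] ℂ} (hf : IsNormalPosFunctional f) (a : M) :
    f ∘ₗ LinearMap.mulLeft ℂ a ∈ normalDual M := by
  set r : ℝ := ‖star a‖ * ‖(1 : M)‖ + 1 with hr
  have hr0 : 0 < r := by positivity
  have hmem : ∀ z : ℂ, ‖z‖ = 1 → conjMul ((r * z) • (1 : M) - star a) f ∈ normalDual M := fun z hz =>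
    (hf.conjMul_of_isUnit (isUnit_smul_one_sub (by
      rw [norm_mul, hz, Complex.norm_real, Real.norm_of_nonneg hr0.le]; linarith))).mem_normalDual
  have h1 := Submodule.smul_mem _ (-(1 / (4 * r) : ℂ)) (add_mem (add_mem (hmem 1 (by simp))
    (Submodule.smul_mem _ (-Complex.I) (hmem Complex.I (by simp))))
    (add_mem (Submodule.smul_mem _ (-1) (hmem (-1) (by simp)))
    (Submodule.smul_mem _ (Complex.I) (hmem (-Complex.I) (by simp)))))
  convert h1 using 1
  ext x
  have hr' : (r : ℂ) ≠ 0 := by exact_mod_cast hr0.ne'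
  simp only [LinearMap.comp_apply, LinearMap.mulLeft_apply, LinearMap.smul_apply,
    LinearMap.add_apply, conjMul_apply, star_sub, star_smul, star_one, star_star, sub_mul, mul_sub,
    smul_mul_assoc, mul_smul_comm, one_mul, mul_one, map_sub, map_smul, smul_eq_mul]
  simp
  field_simp
  ring_nf
  simp
  ring

lemma comp_mem_normalDual_of_forall {N : Type*} [CStarAlgebra N] [PartialOrder N]
    {T : M →ₗ[ℂ] N} (hT : ∀ f : N →ₗ[ℂ] ℂ, IsNormalPosFunctional f → f ∘ₗ T ∈ normalDual M)
    {f : N →ₗ[ℂ] ℂ} (hf : f ∈ normalDual N) : f ∘ₗ T ∈ normalDual M :=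
  Submodule.span_induction (p := fun f _ => f ∘ₗ T ∈ normalDual M)
    hT (by rw [LinearMap.zero_comp]; exact zero_mem _)
    (fun f g _ _ hf hg => by rw [LinearMap.add_comp]; exact add_mem hf hg)
    (fun c f _ hf => by rw [LinearMap.smul_comp]; exact Submodule.smul_mem _ _ hf) hf

lemma mulRight_mem_normalDual {f : M →ₗ[ℂ] ℂ} (hf : f ∈ normalDual M) (a : M) :
    f ∘ₗ LinearMap.mulRight ℂ a ∈ normalDual M :=
  comp_mem_normalDual_of_forall (fun _ hg => hg.mulRight_mem a) hf

lemma mulLeft_mem_normalDual {f : M →ₗ[ℂ] ℂ} (hf : f ∈ normalDual M) (a : M) :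
    f ∘ₗ LinearMap.mulLeft ℂ a ∈ normalDual M :=
  comp_mem_normalDual_of_forall (fun _ hg => hg.mulLeft_mem a) hf

lemma isNormalMap_iff {N : Type*} [CStarAlgebra N] [PartialOrder N] {T : M →ₗ[ℂ] N} :
    IsNormalMap T ↔ ∀ f ∈ normalDual N, f ∘ₗ T ∈ normalDual M := by
  refine ⟨fun hT f hf => ?_, fun hT => ?_⟩
  · refine mem_normalDual_of_continuous ?_
    exact @Continuous.comp M N ℂ (sigmaWeak M) (sigmaWeak N) _ _ _
      (continuous_sigmaWeak_of_mem_normalDual hf) hT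
  · refine continuous_induced_rng.mpr ?_
    let _ := sigmaWeak M
    exact continuous_pi fun f => continuous_sigmaWeak_of_mem_normalDual (hT f.1 f.2.mem_normalDual)

/-- A bounded map is normal as soon as it is normal against a separating family of normal
functionals. -/
lemma isNormalMap_of_separating {N : Type*} [CStarAlgebra N] [PartialOrder N] [StarOrderedRing N]
    [WStarAlgebra N] {T : M →ₗ[ℂ] N} {C : ℝ} (hC : ∀ x, ‖T x‖ ≤ C * ‖x‖)
    {F : Set (N →ₗ[ℂ] ℂ)} (hF : ∀ f ∈ F, f ∈ normalDual N)
    (hsep : ∀ y, (∀ f ∈ F, f y = 0) → y = 0) (hT : ∀ f ∈ F, f ∘ₗ T ∈ normalDual M) :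
    IsNormalMap T := by
  refine isNormalMap_iff.mpr fun g hg => mem_normalDual_of_tendsto fun U r x hr hx => ?_
  obtain ⟨y, -, hy⟩ := exists_normalLim U (fun m : M => T m) (r := |C| * r)
    (hr.mono fun m hm => (hC m).trans (by gcongr; exact le_abs_self C))
  have : y = T x := sub_eq_zero.mp <| hsep _ fun f hf => by
    rw [map_sub, sub_eq_zero]
    exact tendsto_nhds_unique (hy f (hF f hf)) (hx _ (hT f hf))
  rw [LinearMap.comp_apply, ← this]
  exact hy g hg

end NormalDual

section MatrixPositivity

attribute [local instance] CStarAlgebra.spectralOrder CStarAlgebra.spectralOrderedRing in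
lemma IsSelfAdjoint.exists_negPart {M : Type*} [CStarAlgebra M] {p : M} (hp : IsSelfAdjoint p) :
    ∃ m t : M, star m = m ∧ m * p * m = - (star t * t) ∧ (t = 0 → ∃ q, p = star q * q) := by
  have hmn : 0 ≤ p⁻ := CFC.negPart_nonneg p
  obtain ⟨r, hr⟩ := CStarAlgebra.nonneg_iff_eq_star_mul_self.mp hmn
  have hms : star p⁻ = p⁻ := (IsSelfAdjoint.of_nonneg hmn).star_eq
  refine ⟨p⁻, r * p⁻, hms, ?_, fun h => CStarAlgebra.nonneg_iff_eq_star_mul_self.mp ?_⟩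
  · have h1 := CFC.posPart_sub_negPart p
    have h2 := CFC.negPart_mul_posPart p
    generalize p⁻ = b at *
    subst hr
    rw [← h1, mul_sub, h2, zero_sub, neg_mul, star_mul, hms]
    simp only [mul_assoc]
  · have h1 : star p⁻ * p⁻ = 0 := by
      rw [hms]; conv_lhs => rw [hr]
      rw [mul_assoc, ← hr, h, mul_zero]
    rw [← CFC.negPart_eq_zero_iff p]
    exact CStarRing.star_mul_self_eq_zero_iff _ |>.mp h1

variable {A : Type*} [CStarAlgebra A] 

lemma eq_zero_of_forall_sum_eq_zero {n : ℕ} {T : Fin n → Fin n → A}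
    (hT : ∀ c : Fin n → A, ∑ i, ∑ j, star (c i) * T i j * c j = 0) (i j : Fin n) : T i j = 0 := by
  let q : (Fin n → A) → (Fin n → A) → A := fun c d => ∑ i, ∑ j, star (c i) * T i j * d j
  have hadd : ∀ (c d) (z : ℂ), q (c + z • d) (c + z • d) =
      q c c + z • q c d + (star z) • q d c + (star z * z) • q d d := fun c d z => by
    simp only [q, Finset.smul_sum, ← Finset.sum_add_distrib]
    refine Finset.sum_congr rfl fun i _ => Finset.sum_congr rfl fun j _ => ?_
    simp only [Pi.add_apply, Pi.smul_apply, star_add, star_smul, add_mul, mul_add, smul_mul_assoc,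
      mul_smul_comm, smul_add, smul_smul]
    rw [mul_comm z (star z)]
    abel
  have h0 : ∀ c d, q c d = 0 := fun c d => by
    have h1 := hadd c d (1 : ℂ)
    have h2 := hadd c d Complex.I
    have hcc : ∀ e, q e e = 0 := hT
    simp only [hcc, star_one, one_smul, smul_zero, add_zero, zero_add] at h1 h2
    have h3 : q d c = - q c d := (neg_eq_of_add_eq_zero_right h1.symm).symm
    rw [h3] at h2
    have h4 : (2 * Complex.I) • q c d = 0 := by
      rw [h2]; simp only [Complex.star_def, Complex.conj_I]; module
    exact (smul_eq_zero.mp h4).resolve_left (by simp)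
  have := h0 (Pi.single i 1) (Pi.single j 1)
  simpa [q, Pi.single_apply, apply_ite, ite_mul, Finset.sum_ite_eq] using this

lemma exists_eq_sum_star_mul {n : ℕ} {P : Fin n → Fin n → A}
    (hP : ∀ c : Fin n → A, ∃ d, ∑ i, ∑ j, star (c i) * P i j * c j = star d * d) :
    ∃ Q : Fin n → Fin n → A, ∀ i j, P i j = ∑ k, star (Q k i) * Q k j := by
  have hsa : ∀ i j, star (P j i) = P i j := fun i j => by
    refine sub_eq_zero.mp (eq_zero_of_forall_sum_eq_zero
      (T := fun i j => star (P j i) - P i j) (fun c => ?_) i j)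
    obtain ⟨d, hd⟩ := hP c
    simp only [mul_sub, sub_mul, Finset.sum_sub_distrib]
    rw [sub_eq_zero, hd, ← (IsSelfAdjoint.star_mul_self d).star_eq, ← hd, star_sum, Finset.sum_comm]
    refine Finset.sum_congr rfl fun i _ => ?_
    rw [star_sum]
    refine Finset.sum_congr rfl fun j _ => ?_
    simp [mul_assoc]
  let _ := CStarAlgebra.spectralOrder A
  have _ := CStarAlgebra.spectralOrderedRing A
  let p : CStarMatrix (Fin n) (Fin n) A := CStarMatrix.ofMatrix (Matrix.of P)
  have hp : IsSelfAdjoint p := by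
    ext i j; simpa [CStarMatrix.star_apply, p] using hsa i j
  obtain ⟨m, t, hm, hmt, ht⟩ := IsSelfAdjoint.exists_negPart (M := CStarMatrix (Fin n) (Fin n) A) hp
  suffices h : t = 0 by
    obtain ⟨q, hq⟩ := ht h
    refine ⟨fun k i => q k i, fun i j => ?_⟩
    have := congrFun (congrFun hq i) j
    rw [CStarMatrix.mul_apply] at this
    simpa [CStarMatrix.star_apply, p] using this
  have key : ∀ j, ∑ k, star (t k j) * t k j = 0 := fun j => by
    refine le_antisymm ?_ (Finset.sum_nonneg fun k _ => star_mul_self_nonneg _)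
    obtain ⟨d, hd⟩ := hP fun i => m i j
    have h1 := congrFun (congrFun hmt j) j
    rw [CStarMatrix.neg_apply, CStarMatrix.mul_apply, CStarMatrix.mul_apply] at h1
    simp only [CStarMatrix.star_apply] at h1
    rw [← neg_nonneg, ← h1]
    have h2 : ∑ i, (m * p) j i * m i j = star d * d := by
      rw [← hd, Finset.sum_comm]
      refine Finset.sum_congr rfl fun i _ => ?_
      rw [CStarMatrix.mul_apply, Finset.sum_mul]
      refine Finset.sum_congr rfl fun l _ => ?_
      have h3 : m j l = star (m l j) := by
        conv_lhs => rw [← hm]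
        rfl
      rw [h3]
      rfl
    rw [h2]
    exact star_mul_self_nonneg d
  ext k j
  have := (Finset.sum_eq_zero_iff_of_nonneg fun k _ => star_mul_self_nonneg (t k j)).mp (key j) k
    (Finset.mem_univ _)
  exact CStarRing.star_mul_self_eq_zero_iff _ |>.mp this

end MatrixPositivity

section Representations

variable {M : Type*} [CStarAlgebra M]
variable {H : Type*} [NormedAddCommGroup H] [InnerProductSpace ℂ H]
variable {K : Type*} [NormedAddCommGroup K] [InnerProductSpace ℂ K] [CompleteSpace K]

lemma exists_norm_sq_sub_eq (a : M) : ∃ c : M, ((‖a‖ ^ 2 : ℝ) : ℂ) • (1 : M) - star a * a = star c * c := by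
  let _ := CStarAlgebra.spectralOrder M
  have _ := CStarAlgebra.spectralOrderedRing M
  refine CStarAlgebra.nonneg_iff_eq_star_mul_self.mp (sub_nonneg.mpr ?_)
  have := (IsSelfAdjoint.star_mul_self a).le_smul_one (r := ‖a‖ ^ 2)
    (by rw [CStarRing.norm_star_mul_self, sq])
  simpa [← Complex.ofReal_pow, Complex.coe_smul] using this

/-- A set of vectors is total if only zero is orthogonal to it. -/
lemma dense_span_of_forall_inner {X : Type*} {w : X → K}
    (hw : ∀ k : K, (∀ x, ⟪w x, k⟫_ℂ = 0) → k = 0) :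
    Dense (Submodule.span ℂ (Set.range w) : Set K) := by
  rw [Submodule.dense_iff_topologicalClosure_eq_top, Submodule.topologicalClosure_eq_top_iff,
    Submodule.eq_bot_iff]
  exact fun k hk => hw k fun x => hk _ (Submodule.subset_span ⟨x, rfl⟩)

/-- A family of vectors permuted by `M` in a way compatible with the inner product carries a
representation of `M`. -/
theorem exists_representation {X : Type*} (w : X → K)
    (hw : Dense (Submodule.span ℂ (Set.range w) : Set K)) (σ : M → X → X)
    (hone : ∀ x, w (σ 1 x) = w x) (hmul : ∀ a b x, w (σ (a * b) x) = w (σ a (σ b x)))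
    (hadd : ∀ a b x, w (σ (a + b) x) = w (σ a x) + w (σ b x))
    (hsmul : ∀ (c : ℂ) a x, w (σ (c • a) x) = c • w (σ a x))
    (hinner : ∀ a x y, ⟪w (σ a x), w y⟫_ℂ = ⟪w x, w (σ (star a) y)⟫_ℂ) :
    ∃ ρ : M →⋆ₐ[ℂ] (K →L[ℂ] K), ∀ a x, ρ a (w x) = w (σ a x) := by
  let e : (X →₀ ℂ) →ₗ[ℂ] K := Finsupp.linearCombination ℂ w
  let f : M → (X →₀ ℂ) →ₗ[ℂ] K := fun a => Finsupp.linearCombination ℂ fun x => w (σ a x)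
  have he : DenseRange e := by
    rw [DenseRange, ← LinearMap.coe_range, Finsupp.range_linearCombination]
    exact hw
  have hfi : ∀ a b ξ η, ⟪f a ξ, f b η⟫_ℂ = ⟪e ξ, f (star a * b) η⟫_ℂ := fun a b ξ η => by
    simp only [e, f, Finsupp.linearCombination_apply, Finsupp.sum_inner, Finsupp.inner_sum]
    simp only [Finsupp.sum]
    refine Finset.sum_congr rfl fun x _ => ?_
    refine Finset.sum_congr rfl fun y _ => ?_
    simp only [inner_smul_left, inner_smul_right, hinner, hmul]
  have hfadd : ∀ a b ξ, f (a + b) ξ = f a ξ + f b ξ := fun a b ξ => by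
    simp only [f, Finsupp.linearCombination_apply, hadd, smul_add, Finsupp.sum_add]
  have hfsmul : ∀ (c : ℂ) a ξ, f (c • a) ξ = c • f a ξ := fun c a ξ => by
    simp only [f, Finsupp.linearCombination_apply, hsmul, Finsupp.smul_sum, smul_comm c]
  have hf1 : ∀ ξ, f 1 ξ = e ξ := fun ξ => by simp only [f, e, hone]
  have hbd : ∀ a ξ, ‖f a ξ‖ ≤ ‖a‖ * ‖e ξ‖ := fun a ξ => by
    obtain ⟨c, hc⟩ := exists_norm_sq_sub_eq a
    refine le_of_sq_le_sq ?_ (by positivity)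
    have h1 : ((‖a‖ ^ 2 : ℝ) : ℂ) • (1 : M) = star a * a + star c * c := by rw [← hc]; abel
    have h2 : ((‖a‖ ^ 2 : ℝ) : ℂ) * ⟪e ξ, e ξ⟫_ℂ = ⟪f a ξ, f a ξ⟫_ℂ + ⟪f c ξ, f c ξ⟫_ℂ := by
      rw [hfi, hfi, ← inner_add_right, ← hfadd, ← h1, hfsmul, inner_smul_right, hf1]
    simp only [inner_self_eq_norm_sq_to_K, Complex.coe_algebraMap] at h2
    have h3 : ‖a‖ ^ 2 * ‖e ξ‖ ^ 2 = ‖f a ξ‖ ^ 2 + ‖f c ξ‖ ^ 2 := by exact_mod_cast h2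
    rw [mul_pow, h3]
    have := sq_nonneg ‖f c ξ‖
    linarith
  let R : M → K →L[ℂ] K := fun a => (f a).extendOfNorm e
  have hR : ∀ a x, R a (w x) = w (σ a x) := fun a x => by
    have := LinearMap.extendOfNorm_eq he (f := f a) ⟨‖a‖, hbd a⟩ (Finsupp.single x 1)
    simpa [e, f] using this
  have hext : ∀ {T T' : K →L[ℂ] K}, (∀ x, T (w x) = T' (w x)) → T = T' := fun h =>
    ContinuousLinearMap.ext_on hw (by rintro _ ⟨x, rfl⟩; exact h x)
  refine ⟨
    { toFun := R
      map_one' := ?_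
      map_mul' := ?_
      map_zero' := ?_
      map_add' := ?_
      commutes' := ?_
      map_star' := ?_ }, hR⟩
  · exact hext fun x => by simp [hR, hone]
  · exact fun a b => hext fun x => by simp [hR, hmul]
  · refine hext fun x => ?_
    rw [hR, ← zero_smul ℂ (0 : M), hsmul]
    simp
  · exact fun a b => hext fun x => by simp [hR, hadd]
  · exact fun c => hext fun x => by
      simp [Algebra.algebraMap_eq_smul_one, hR, hsmul, hone]
  · refine fun a => hext fun x => hw.eq_of_inner_right ℂ fun v hv => ?_
    rw [ContinuousLinearMap.star_eq_adjoint, ContinuousLinearMap.adjoint_inner_right]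
    induction hv using Submodule.span_induction with
    | mem v hv =>
      obtain ⟨y, rfl⟩ := hv
      rw [hR, hR, hinner]
    | zero => simp
    | add v v' _ _ h h' => simp only [map_add, inner_add_left, h, h']
    | smul c v _ h => simp only [map_smul, inner_smul_left, h]

variable [CompleteSpace H]

/-- Complete positivity for maps into operators on a Hilbert space. -/
def IsCPOp (Φ : M →ₗ[ℂ] (H →L[ℂ] H)) : Prop :=
  ∀ (n : ℕ) (a : Fin n → M) (h : Fin n → H),
    0 ≤ ∑ i, ∑ j, ⟪h i, Φ (star (a i) * a j) (h j)⟫_ℂ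

lemma IsCPOp.sum_nonneg {Φ : M →ₗ[ℂ] (H →L[ℂ] H)} (hΦ : IsCPOp Φ) {ι : Type*} (s : Finset ι)
    (a : ι → M) (h : ι → H) : 0 ≤ ∑ i ∈ s, ∑ j ∈ s, ⟪h i, Φ (star (a i) * a j) (h j)⟫_ℂ := by
  have key : ∀ g : ι → ℂ, ∑ i : Fin s.card, g (s.equivFin.symm i) = ∑ i ∈ s, g i := fun g =>
    (s.equivFin.symm.sum_comp fun i : s => g i).trans (Finset.sum_coe_sort s g)
  refine (hΦ s.card (fun i => a (s.equivFin.symm i)) fun i => h (s.equivFin.symm i)).trans_eq ?_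
  rw [← key]
  exact Finset.sum_congr rfl fun i _ => key fun j => ⟪h _, Φ (star (a _) * a j) (h j)⟫_ℂ

lemma IsCPOp.conj_symm {Φ : M →ₗ[ℂ] (H →L[ℂ] H)} (hΦ : IsCPOp Φ) (a b : M) (h k : H) :
    star ⟪h, Φ (star a * b) k⟫_ℂ = ⟪k, Φ (star b * a) h⟫_ℂ := by
  have h1 : ∀ (z : ℂ), (z * ⟪h, Φ (star a * b) k⟫_ℂ + star z * ⟪k, Φ (star b * a) h⟫_ℂ).im = 0 :=
    fun z => by
    have h2 := hΦ 2 ![a, b] ![h, z • k]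
    have h3 := hΦ 1 ![a] ![h]
    have h4 := hΦ 1 ![b] ![z • k]
    simp only [Fin.sum_univ_two, Fin.sum_univ_one, Matrix.cons_val_zero, Matrix.cons_val_one] at h2 h3 h4
    replace h2 := (Complex.le_def.mp h2).2
    replace h3 := (Complex.le_def.mp h3).2
    replace h4 := (Complex.le_def.mp h4).2
    simp only [Complex.zero_im, Complex.add_im, inner_smul_left, inner_smul_right, map_smul,
      Matrix.cons_val_fin_one] at h2 h3 h4 ⊢
    simp only [starRingEnd_apply] at h2 h4
    linarith
  have h2 := h1 1
  have h3 := h1 Complex.I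
  simp only [Complex.add_im, Complex.mul_im, Complex.I_re, Complex.I_im, Complex.star_def,
    Complex.conj_I, Complex.neg_re, Complex.neg_im, one_mul, zero_mul, zero_add, map_one] at h2 h3
  apply Complex.ext
  · simp only [Complex.star_def, Complex.conj_re]; linarith
  · simp only [Complex.star_def, Complex.conj_im]; linarith

end Representations

section Stinespring

universe u v

variable {M : Type u} [CStarAlgebra M]
variable {H : Type v} [NormedAddCommGroup H] [InnerProductSpace ℂ H] [CompleteSpace H]

/-- Stinespring's dilation theorem. -/
theorem IsCPOp.exists_stinespring {Φ : M →ₗ[ℂ] (H →L[ℂ] H)} (hΦ : IsCPOp Φ) :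
    ∃ (K : Type (max u v)) (_ : NormedAddCommGroup K) (_ : InnerProductSpace ℂ K)
      (_ : CompleteSpace K) (ρ : M →⋆ₐ[ℂ] (K →L[ℂ] K)) (V : H →L[ℂ] K),
      (∀ a h h', ⟪V h, ρ a (V h')⟫_ℂ = ⟪h, Φ a h'⟫_ℂ) ∧
      Dense (Submodule.span ℂ (Set.range fun p : M × H => ρ p.1 (V p.2)) : Set K) := by
  let k : Matrix M M (H →L[ℂ] H) := Matrix.of fun a b => Φ (star a * b)
  have hk : k.PosSemidef := by
    have htfae := (RKHS.posSemidef_tfae (K := k)).out 0 2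
    refine htfae.mpr ⟨?_, fun vv => ?_⟩
    · ext a b h
      refine ext_inner_left ℂ fun h' => ?_
      simp only [k, Matrix.conjTranspose_apply, Matrix.of_apply, ContinuousLinearMap.star_eq_adjoint,
        ContinuousLinearMap.adjoint_inner_right]
      rw [← hΦ.conj_symm, Complex.star_def, inner_conj_symm]
    · have := (Complex.le_def.mp (hΦ.sum_nonneg vv.support (fun a => a) vv)).1
      refine this.trans_eq ?_
      simp only [Finsupp.sum, k, Matrix.of_apply]
      refine congrArg Complex.re (Finset.sum_congr rfl fun a _ => Finset.sum_congr rfl fun b _ => ?_)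
      rw [← hΦ.conj_symm, Complex.star_def, inner_conj_symm]
  have : Fact k.PosSemidef := ⟨hk⟩
  let K := RKHS.OfKernel k
  let w : M × H → K := fun p => RKHS.kerFun K p.1 p.2
  have hwi : ∀ a b h h', ⟪w (a, h), w (b, h')⟫_ℂ = ⟪h, Φ (star a * b) h'⟫_ℂ := fun a b h h' => by
    rw [RKHS.kerFun_inner, RKHS.kerFun_apply, RKHS.OfKernel.kernel_ofKernel]
    rfl
  have hw : ∀ x : K, (∀ p, ⟪w p, x⟫_ℂ = 0) → x = 0 := fun x hx =>
    RKHS.ext fun a => ext_inner_left ℂ fun h => by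
      rw [← RKHS.kerFun_inner, RKHS.coe_zero, Pi.zero_apply, inner_zero_right]
      exact hx (a, h)
  have hwd := dense_span_of_forall_inner hw
  have hlin : ∀ {x y : K}, (∀ p, ⟪w p, x⟫_ℂ = ⟪w p, y⟫_ℂ) → x = y := fun h =>
    sub_eq_zero.mp (hw _ fun p => by rw [inner_sub_right, h, sub_self])
  obtain ⟨ρ, hρ⟩ := exists_representation w hwd (fun a p => (a * p.1, p.2)) (fun x => by simp)
    (fun a b x => by simp [mul_assoc])
    (fun a b x => hlin fun p => by
      rw [inner_add_right]; simp only [hwi, add_mul, mul_add, map_add, ContinuousLinearMap.add_apply, inner_add_right])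
    (fun c a x => hlin fun p => by
      rw [inner_smul_right]; simp only [hwi, smul_mul_assoc, mul_smul_comm, map_smul]
      simp [inner_smul_right])
    (fun a x y => by simp only [hwi, star_mul, mul_assoc])
  refine ⟨K, inferInstance, inferInstance, inferInstance, ρ, RKHS.kerFun K 1, fun a h h' => ?_, ?_⟩
  · change ⟪w (1, h), ρ a (w (1, h'))⟫_ℂ = _
    rw [hρ, hwi]; simp
  · convert hwd using 5 with p
    exact (hρ p.1 (1, p.2)).trans (by simp)

end Stinespring

section Positivity

variable {M : Type*} [CStarAlgebra M]
variable {H : Type*} [NormedAddCommGroup H] [InnerProductSpace ℂ H] [CompleteSpace H]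

lemma inner_rep_star (ρ : M →⋆ₐ[ℂ] (H →L[ℂ] H)) (a : M) (h k : H) :
    ⟪ρ (star a) h, k⟫_ℂ = ⟪h, ρ a k⟫_ℂ := by
  rw [map_star, ContinuousLinearMap.star_eq_adjoint, ContinuousLinearMap.adjoint_inner_left]

lemma inner_rep_star_mul (ρ : M →⋆ₐ[ℂ] (H →L[ℂ] H)) (a b : M) (h k : H) :
    ⟪h, ρ (star a * b) k⟫_ℂ = ⟪ρ a h, ρ b k⟫_ℂ := by
  rw [map_mul, ContinuousLinearMap.mul_apply, ← inner_rep_star ρ (star a), star_star]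

lemma norm_rep_apply_le (ρ : M →⋆ₐ[ℂ] (H →L[ℂ] H)) (a : M) (h : H) : ‖ρ a h‖ ≤ ‖a‖ * ‖h‖ :=
  (ρ a).le_of_opNorm_le (NonUnitalStarAlgHom.norm_apply_le ρ a) h

lemma sum_inner_rep_nonneg (ρ : M →⋆ₐ[ℂ] (H →L[ℂ] H)) {n : ℕ} {P : Fin n → Fin n → M}
    (hP : ∀ c : Fin n → M, ∃ d, ∑ i, ∑ j, star (c i) * P i j * c j = star d * d) (h : Fin n → H) :
    0 ≤ ∑ i, ∑ j, ⟪h i, ρ (P i j) (h j)⟫_ℂ := by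
  obtain ⟨Q, hQ⟩ := exists_eq_sum_star_mul hP
  have h1 : ∑ i, ∑ j, ⟪h i, ρ (P i j) (h j)⟫_ℂ =
      ∑ k, ⟪∑ i, ρ (Q k i) (h i), ∑ j, ρ (Q k j) (h j)⟫_ℂ := by
    simp only [hQ, map_sum, ContinuousLinearMap.sum_apply, inner_sum, sum_inner,
      inner_rep_star_mul]
    rw [Finset.sum_comm (γ := Fin n)]
    calc _ = ∑ j, ∑ k, ∑ i, ⟪ρ (Q k i) (h i), ρ (Q k j) (h j)⟫_ℂ :=
          Finset.sum_congr rfl fun j _ => Finset.sum_comm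
      _ = ∑ k, ∑ j, ∑ i, ⟪ρ (Q k i) (h i), ρ (Q k j) (h j)⟫_ℂ := Finset.sum_comm
  rw [h1]
  exact Finset.sum_nonneg fun k _ => by rw [inner_self_eq_norm_sq_to_K]; positivity

lemma IsCompletelyPositive.isCPOp {N : Type*} [CStarAlgebra N] {θ : N →ₗ[ℂ] M}
    (hθ : IsCompletelyPositive θ) (ρ : M →⋆ₐ[ℂ] (H →L[ℂ] H)) :
    IsCPOp (ρ.toAlgHom.toLinearMap ∘ₗ θ) := fun n a h =>
  sum_inner_rep_nonneg ρ (P := fun i j => θ (star (a i) * a j)) (hθ n a) h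

lemma IsCompletelyPositive.apply_star {N : Type*} [CStarAlgebra N] {θ : N →ₗ[ℂ] M}
    (hθ : IsCompletelyPositive θ) (a : N) : θ (star a) = star (θ a) := by
  obtain ⟨Q, hQ⟩ := exists_eq_sum_star_mul (P := fun i j => θ (star (![1, a] i) * ![1, a] j))
    (hθ 2 ![1, a])
  have h1 := hQ 0 1
  have h2 := hQ 1 0
  simp only [Matrix.cons_val_zero, Matrix.cons_val_one, star_one, one_mul, mul_one] at h1 h2
  rw [h1, h2, star_sum]
  simp

lemma exists_eq_star_mul_self_of_forall_inner {F : Type*} {H : F → Type*}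
    [∀ f, NormedAddCommGroup (H f)] [∀ f, InnerProductSpace ℂ (H f)] [∀ f, CompleteSpace (H f)]
    (ρ : ∀ f, M →⋆ₐ[ℂ] (H f →L[ℂ] H f)) (hρ : ∀ y, (∀ f, ρ f y = 0) → y = 0) {s : M}
    (hs : ∀ f h, 0 ≤ ⟪h, ρ f s h⟫_ℂ) : ∃ d, s = star d * d := by
  have hsa : IsSelfAdjoint s := by
    refine sub_eq_zero.mp (hρ _ fun f => ?_)
    rw [map_sub, map_star, sub_eq_zero]
    have : ((ρ f s : H f →L[ℂ] H f) : H f →ₗ[ℂ] H f).IsSymmetric := by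
      rw [LinearMap.isSymmetric_iff_inner_map_self_real]
      intro v
      have h1 := Complex.conj_eq_iff_im.mpr (Complex.le_def.mp (hs f v)).2.symm
      rw [inner_conj_symm] at h1
      exact (inner_conj_symm _ _).trans h1.symm
    exact (ContinuousLinearMap.isSelfAdjoint_iff_isSymmetric.mpr this)
  obtain ⟨m, t, hm, hmt, ht⟩ := hsa.exists_negPart
  refine ht (hρ t fun f => ?_)
  ext h
  have h1 := hs f (ρ f m h)
  have h2 : ⟪ρ f m h, ρ f s (ρ f m h)⟫_ℂ = -⟪ρ f t h, ρ f t h⟫_ℂ := by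
    rw [← inner_rep_star_mul (ρ f) t t, ← inner_neg_right, ← ContinuousLinearMap.neg_apply,
      ← map_neg, ← hmt]
    nth_rw 1 [← hm]
    rw [inner_rep_star]
    simp
  rw [h2, inner_self_eq_norm_sq_to_K] at h1
  have h3 : ‖ρ f t h‖ ^ 2 ≤ 0 := by
    have := neg_nonneg.mp h1
    simp only [Complex.coe_algebraMap] at this
    exact_mod_cast this
  simpa using h3

end Positivity

section NormalOp

variable {M : Type*} [CStarAlgebra M] [PartialOrder M] 
variable {H : Type*} [NormedAddCommGroup H] [InnerProductSpace ℂ H]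

/-- Continuity from the σ-weak topology to the weak operator topology. -/
def IsNormalOp (Φ : M → (H →L[ℂ] H)) : Prop :=
  ∀ h k, ∃ f ∈ normalDual M, ∀ x, f x = ⟪h, Φ x k⟫_ℂ

lemma IsNormalOp.tendsto {Φ : M → (H →L[ℂ] H)} (hΦ : IsNormalOp Φ) {α : Type*} {l : Filter α}
    {u : α → M} {x : M} (hu : NormalLim l u x) (h k : H) :
    Tendsto (fun a => ⟪h, Φ (u a) k⟫_ℂ) l (𝓝 ⟪h, Φ x k⟫_ℂ) := by
  obtain ⟨f, hf, hfx⟩ := hΦ h k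
  simpa [hfx] using hu f hf

lemma IsNormalOp.add {Φ Ψ : M → (H →L[ℂ] H)} (hΦ : IsNormalOp Φ) (hΨ : IsNormalOp Ψ) :
    IsNormalOp fun x => Φ x + Ψ x := fun h k => by
  obtain ⟨f, hf, hfx⟩ := hΦ h k
  obtain ⟨g, hg, hgx⟩ := hΨ h k
  exact ⟨f + g, add_mem hf hg, fun x => by simp [hfx, hgx, inner_add_right]⟩

lemma IsNormalOp.conj {K : Type*} [NormedAddCommGroup K] [InnerProductSpace ℂ K] [CompleteSpace K]
    [CompleteSpace H] {Φ : M → (H →L[ℂ] H)} (hΦ : IsNormalOp Φ) (V : K →L[ℂ] H) :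
    IsNormalOp fun x => V.adjoint ∘L Φ x ∘L V := fun h k => by
  obtain ⟨f, hf, hfx⟩ := hΦ (V h) (V k)
  exact ⟨f, hf, fun x => by simp [hfx, ContinuousLinearMap.adjoint_inner_right]⟩

variable [StarOrderedRing M] [WStarAlgebra M]

lemma IsNormalOp.comp {N : Type*} [CStarAlgebra N] [PartialOrder N] {Φ : N → (H →L[ℂ] H)} 
    (hΦ : IsNormalOp Φ) {T : M →ₗ[ℂ] N} (hT : IsNormalMap T) : IsNormalOp fun x => Φ (T x) :=
  fun h k => by
  obtain ⟨f, hf, hfx⟩ := hΦ h k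
  exact ⟨f ∘ₗ T, isNormalMap_iff.mp hT f hf, fun x => hfx _⟩

lemma isNormalOp_of_dense {X : Type*} {w : X → H}
    (hw : Dense (Submodule.span ℂ (Set.range w) : Set H)) {Φ : M →ₗ[ℂ] (H →L[ℂ] H)} {C : ℝ}
    (hC : ∀ x, ‖Φ x‖ ≤ C * ‖x‖)
    (h : ∀ x y, ∃ f ∈ normalDual M, ∀ m, f m = ⟪w x, Φ m (w y)⟫_ℂ) : IsNormalOp Φ := by
  have hlin : ∀ h k, ∃ f : M →ₗ[ℂ] ℂ, ∀ m, f m = ⟪h, Φ m k⟫_ℂ := fun h k =>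
    ⟨{ toFun := fun m => ⟪h, Φ m k⟫_ℂ
       map_add' := by simp [inner_add_right]
       map_smul' := by simp [inner_smul_right] }, fun m => rfl⟩
  have key : ∀ h h' k k', ∀ m : M, ‖⟪h, Φ m k⟫_ℂ - ⟪h', Φ m k'⟫_ℂ‖ ≤
      C * (‖h - h'‖ * ‖k‖ + ‖h'‖ * ‖k - k'‖) * ‖m‖ := fun h h' k k' m => by
    have h1 : ⟪h, Φ m k⟫_ℂ - ⟪h', Φ m k'⟫_ℂ = ⟪h - h', Φ m k⟫_ℂ + ⟪h', Φ m (k - k')⟫_ℂ := by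
      rw [map_sub, inner_sub_left, inner_sub_right]; ring
    have h2 : ∀ u v, ‖⟪u, Φ m v⟫_ℂ‖ ≤ ‖u‖ * (C * ‖m‖ * ‖v‖) := fun u v =>
      (norm_inner_le_norm _ _).trans (by gcongr; exact (Φ m).le_of_opNorm_le (hC m) v)
    rw [h1]
    refine (norm_add_le _ _).trans ((add_le_add (h2 _ _) (h2 _ _)).trans_eq (by ring))
  have hspan : ∀ h ∈ Submodule.span ℂ (Set.range w), ∀ k ∈ Submodule.span ℂ (Set.range w),
      ∃ f ∈ normalDual M, ∀ m, f m = ⟪h, Φ m k⟫_ℂ := fun h' hh k hk => by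
    induction hh using Submodule.span_induction with
    | mem v hv =>
      obtain ⟨x, rfl⟩ := hv
      induction hk using Submodule.span_induction with
      | mem v hv => obtain ⟨y, rfl⟩ := hv; exact h x y
      | zero => exact ⟨0, zero_mem _, by simp⟩
      | add v v' _ _ h h' =>
        obtain ⟨f, hf, hfx⟩ := h
        obtain ⟨g, hg, hgx⟩ := h'
        exact ⟨f + g, add_mem hf hg, fun x => by simp [hfx, hgx, inner_add_right]⟩
      | smul c v _ h =>
        obtain ⟨f, hf, hfx⟩ := h
        exact ⟨c • f, Submodule.smul_mem _ _ hf, fun x => by simp [hfx, inner_smul_right]⟩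
    | zero => exact ⟨0, zero_mem _, by simp⟩
    | add v v' _ _ h h' =>
      obtain ⟨f, hf, hfx⟩ := h
      obtain ⟨g, hg, hgx⟩ := h'
      exact ⟨f + g, add_mem hf hg, fun x => by simp [hfx, hgx, inner_add_left]⟩
    | smul c v _ h =>
      obtain ⟨f, hf, hfx⟩ := h
      exact ⟨star c • f, Submodule.smul_mem _ _ hf, fun x => by
        simp [hfx, inner_smul_left, mul_comm]⟩
  intro h k
  obtain ⟨f, hf⟩ := hlin h k
  refine ⟨f, mem_normalDual_of_approx fun ε hε => ?_, hf⟩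
  have hcont : Tendsto (fun p : H × H => C * (‖h - p.1‖ * ‖k‖ + ‖p.1‖ * ‖k - p.2‖)) (𝓝 (h, k))
      (𝓝 0) := by
    have : Continuous fun p : H × H => C * (‖h - p.1‖ * ‖k‖ + ‖p.1‖ * ‖k - p.2‖) := by fun_prop
    simpa using this.tendsto (h, k)
  obtain ⟨p, ⟨hp2, hp3⟩, hp1⟩ := (hw.prod hw).inter_nhds_nonempty (hcont.eventually_lt_const hε)
  obtain ⟨g, hg, hgx⟩ := hspan _ hp2 _ hp3
  refine ⟨g, hg, fun x => ?_⟩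
  rw [hf, hgx]
  exact (key _ _ _ _ _).trans (by gcongr; exact le_of_lt hp1)

lemma isNormalOp_of_stinespring {K : Type*} [NormedAddCommGroup K] [InnerProductSpace ℂ K]
    [CompleteSpace K] {Φ : M → (H →L[ℂ] H)} (hΦ : IsNormalOp Φ) {ρ : M →⋆ₐ[ℂ] (K →L[ℂ] K)}
    {V : H →L[ℂ] K} (hV : ∀ a h h', ⟪V h, ρ a (V h')⟫_ℂ = ⟪h, Φ a h'⟫_ℂ)
    (hd : Dense (Submodule.span ℂ (Set.range fun p : M × H => ρ p.1 (V p.2)) : Set K)) :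
    IsNormalOp ρ := by
  refine isNormalOp_of_dense (Φ := ρ.toAlgHom.toLinearMap) hd (C := 1) (fun x => ?_) fun p q => ?_
  · rw [one_mul]; exact NonUnitalStarAlgHom.norm_apply_le ρ x
  · obtain ⟨f, hf, hfx⟩ := hΦ p.2 q.2
    refine ⟨_, mulLeft_mem_normalDual (mulRight_mem_normalDual hf q.1) (star p.1), fun m => ?_⟩
    have h1 : ⟪ρ p.1 (V p.2), ρ m (ρ q.1 (V q.2))⟫_ℂ = ⟪V p.2, ρ (star p.1 * m * q.1) (V q.2)⟫_ℂ := by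
      rw [mul_assoc, inner_rep_star_mul, map_mul]; rfl
    refine Eq.trans ?_ h1.symm
    rw [hV, ← hfx]
    rfl

end NormalOp

section Extension

variable {M N : Type*} [CStarAlgebra M] [CStarAlgebra N]
variable {H : Type*} [NormedAddCommGroup H] [InnerProductSpace ℂ H] [CompleteSpace H]

lemma IsCPOp.norm_inner_apply_le {Φ : M →ₗ[ℂ] (H →L[ℂ] H)} (hΦ : IsCPOp Φ) {h h' : H}
    (h1 : ⟪h, Φ 1 h⟫_ℂ = ⟪h, h⟫_ℂ) (h2 : ⟪h', Φ 1 h'⟫_ℂ = ⟪h', h'⟫_ℂ) (x : M) :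
    ‖⟪h, Φ x h'⟫_ℂ‖ ≤ ‖x‖ * ‖h‖ * ‖h'‖ := by
  obtain ⟨K, _, _, _, ρ, V, hV, -⟩ := hΦ.exists_stinespring
  have key : ∀ k, ⟪k, Φ 1 k⟫_ℂ = ⟪k, k⟫_ℂ → ‖V k‖ = ‖k‖ := fun k hk => by
    rw [← hV, map_one, ContinuousLinearMap.one_apply, inner_self_eq_norm_sq_to_K,
      inner_self_eq_norm_sq_to_K] at hk
    simp only [Complex.coe_algebraMap] at hk
    exact (sq_eq_sq₀ (norm_nonneg _) (norm_nonneg _)).mp (by exact_mod_cast hk)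
  rw [← hV, ← key h h1, ← key h' h2]
  refine (norm_inner_le_norm _ _).trans ?_
  calc _ ≤ ‖V h‖ * (‖x‖ * ‖V h'‖) := by gcongr; exact norm_rep_apply_le ρ x _
    _ = _ := by ring

lemma norm_apply_le_of_dense {T : H →L[ℂ] H} {𝒟 : Set H} (h𝒟 : Dense 𝒟) {C : ℝ}
    (hT : ∀ h ∈ 𝒟, ∀ h' ∈ 𝒟, ‖⟪h, T h'⟫_ℂ‖ ≤ C * ‖h‖ * ‖h'‖) (k : H) : ‖T k‖ ≤ C * ‖k‖ := by
  have hcl : IsClosed {p : H × H | ‖⟪p.1, T p.2⟫_ℂ‖ ≤ C * ‖p.1‖ * ‖p.2‖} :=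
    isClosed_le (by fun_prop) (by fun_prop)
  have h1 : (T k, k) ∈ {p : H × H | ‖⟪p.1, T p.2⟫_ℂ‖ ≤ C * ‖p.1‖ * ‖p.2‖} :=
    hcl.closure_subset_iff.mpr (fun p hp => hT _ hp.1 _ hp.2)
      ((h𝒟.prod h𝒟).closure_eq ▸ Set.mem_univ _)
  simp only [Set.mem_setOf_eq, inner_self_eq_norm_sq_to_K] at h1
  rcases eq_or_ne (T k) 0 with h0 | h0
  · have h2 : 0 ≤ C * ‖k‖ := by
      rcases eq_or_ne k 0 with rfl | hk
      · simp
      have h3 : (k, k) ∈ {p : H × H | ‖⟪p.1, T p.2⟫_ℂ‖ ≤ C * ‖p.1‖ * ‖p.2‖} :=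
        hcl.closure_subset_iff.mpr (fun p hp => hT _ hp.1 _ hp.2)
          ((h𝒟.prod h𝒟).closure_eq ▸ Set.mem_univ _)
      have h4 : 0 ≤ C * ‖k‖ * ‖k‖ := (norm_nonneg _).trans h3
      exact nonneg_of_mul_nonneg_left h4 (norm_pos_iff.mpr hk)
    simpa [h0] using h2
  · have h3 : 0 < ‖T k‖ := norm_pos_iff.mpr h0
    have h4 : ‖T k‖ * ‖T k‖ ≤ ‖T k‖ * (C * ‖k‖) := by
      simp only [norm_pow, RCLike.norm_ofReal, abs_norm] at h1
      nlinarith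
    exact le_of_mul_le_mul_left h4 h3

section Family

variable {F : Type*} {H : F → Type*} [∀ f, NormedAddCommGroup (H f)]
  [∀ f, InnerProductSpace ℂ (H f)] [∀ f, CompleteSpace (H f)]
  (ρ : ∀ f, N →⋆ₐ[ℂ] (H f →L[ℂ] H f)) (hρ : ∀ y, (∀ f, ρ f y = 0) → y = 0)
include hρ

lemma norm_le_of_forall_norm_rep_le {y : N} {C : ℝ} (hC : 0 ≤ C)
    (h : ∀ f h, ‖ρ f y h‖ ≤ C * ‖h‖) : ‖y‖ ≤ C := by
  let _ := CStarAlgebra.spectralOrder N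
  have _ := CStarAlgebra.spectralOrderedRing N
  obtain ⟨d, hd⟩ := exists_eq_star_mul_self_of_forall_inner ρ hρ
    (s := ((C ^ 2 : ℝ) : ℂ) • 1 - star y * y) fun f h' => by
      have h1 : ⟪h', ρ f (star y * y) h'⟫_ℂ = ((‖ρ f y h'‖ ^ 2 : ℝ) : ℂ) := by
        rw [inner_rep_star_mul, inner_self_eq_norm_sq_to_K]; simp
      have h2 : ⟪h', h'⟫_ℂ = ((‖h'‖ ^ 2 : ℝ) : ℂ) := by
        rw [inner_self_eq_norm_sq_to_K]; simp
      have h3 : ⟪h', ρ f (((C ^ 2 : ℝ) : ℂ) • 1 - star y * y) h'⟫_ℂ =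
          (((C * ‖h'‖) ^ 2 - ‖ρ f y h'‖ ^ 2 : ℝ) : ℂ) := by
        rw [map_sub, ContinuousLinearMap.sub_apply, inner_sub_right, h1, map_smul, map_one,
          ContinuousLinearMap.smul_apply, ContinuousLinearMap.one_apply, inner_smul_right, h2]
        push_cast; ring
      rw [h3]
      have := pow_le_pow_left₀ (norm_nonneg _) (h f h') 2
      exact_mod_cast sub_nonneg.mpr this
  have h1 : star y * y ≤ algebraMap ℝ N (C ^ 2) := by
    rw [← sub_nonneg]
    have : algebraMap ℝ N (C ^ 2) - star y * y = star d * d := by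
      rw [← hd, Algebra.algebraMap_eq_smul_one, Complex.coe_smul]
    rw [this]
    exact star_mul_self_nonneg d
  have h2 : ‖star y * y‖ ≤ C ^ 2 :=
    (CStarAlgebra.norm_le_iff_le_algebraMap _ (by positivity) (star_mul_self_nonneg y)).mpr h1
  rw [CStarRing.norm_star_mul_self, ← sq] at h2
  exact (sq_le_sq₀ (norm_nonneg _) hC).mp h2

end Family

end Extension

section Main

variable {M N : Type*} [CStarAlgebra M] [PartialOrder M] [StarOrderedRing M] [WStarAlgebra M]
  [CStarAlgebra N] [PartialOrder N] [StarOrderedRing N] [WStarAlgebra N]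
variable {F : Type*} {H : F → Type*} [∀ f, NormedAddCommGroup (H f)]
  [∀ f, InnerProductSpace ℂ (H f)] [∀ f, CompleteSpace (H f)]

/-- A densely defined linear relation between von Neumann algebras extends to a normal completely
positive map if it is, on finitely many vectors at a time, implemented by normal completely positive
maps into bounded operators. -/
theorem exists_normal_cp_extension {Γ : Submodule ℂ (M × N)}
    (hd : @Dense M (sigmaWeak M) (Γ.map (LinearMap.fst ℂ M N))) (h1 : (1, 1) ∈ Γ)
    (ρ : ∀ f, N →⋆ₐ[ℂ] (H f →L[ℂ] H f)) (hρn : ∀ f, IsNormalOp (ρ f))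
    (hρ : ∀ y, (∀ f, ρ f y = 0) → y = 0)
    (𝒟 : ∀ f, Submodule ℂ (H f)) (h𝒟 : ∀ f, Dense (𝒟 f : Set (H f)))
    (hΦ : ∀ f (s : Finset (H f)), (s : Set (H f)) ⊆ 𝒟 f → ∃ Φ : M →ₗ[ℂ] (H f →L[ℂ] H f),
      IsCPOp Φ ∧ IsNormalOp Φ ∧
        ∀ p ∈ Γ, ∀ h ∈ s, ∀ h' ∈ s, ⟪h, Φ p.1 h'⟫_ℂ = ⟪h, ρ f p.2 h'⟫_ℂ) :
    ∃ θ : M →ₗ[ℂ] N, IsNormalMap θ ∧ IsCompletelyPositive θ ∧ ∀ p ∈ Γ, θ p.1 = p.2 := by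
  classical
  have hmem : ∀ {f} {T : H f →L[ℂ] H f}, (∀ h ∈ 𝒟 f, ∀ h' ∈ 𝒟 f, ⟪h, T h'⟫_ℂ = 0) → T = 0 :=
    fun {f T} hT => by
      ext k
      have := norm_apply_le_of_dense (h𝒟 f) (T := T) (C := 0)
        (fun h hh h' hh' => by simp [hT h hh h' hh']) k
      simpa using this
  let Valid : ∀ f, Finset (H f) → (M →ₗ[ℂ] (H f →L[ℂ] H f)) → Prop := fun f s Φ =>
    IsCPOp Φ ∧ IsNormalOp Φ ∧ ∀ p ∈ Γ, ∀ h ∈ s, ∀ h' ∈ s, ⟪h, Φ p.1 h'⟫_ℂ = ⟪h, ρ f p.2 h'⟫_ℂ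
  let R : Submodule ℂ (M × N) :=
    { carrier := {p | ∀ f s Φ, Valid f s Φ → ∀ h ∈ s, ∀ h' ∈ s,
        ⟪h, Φ p.1 h'⟫_ℂ = ⟪h, ρ f p.2 h'⟫_ℂ}
      add_mem' := fun {p q} hp hq f s Φ hv h hh h' hh' => by
        simp [inner_add_right, hp f s Φ hv h hh h' hh', hq f s Φ hv h hh h' hh']
      zero_mem' := fun f s Φ hv h hh h' hh' => by simp
      smul_mem' := fun c p hp f s Φ hv h hh h' hh' => by
        simp [inner_smul_right, hp f s Φ hv h hh h' hh'] }
  have hΓR : Γ ≤ R := fun p hp f s Φ hv h hh h' hh' => hv.2.2 p hp h hh h' hh'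
  have hpair : ∀ f, ∀ h ∈ 𝒟 f, ∀ h' ∈ 𝒟 f, ∃ Φ, Valid f {h, h'} Φ := fun f h hh h' hh' =>
    hΦ f {h, h'} (by simp [Set.insert_subset_iff, hh, hh'])
  have hnorm : ∀ p ∈ R, ‖p.2‖ ≤ ‖p.1‖ := fun p hp =>
    norm_le_of_forall_norm_rep_le ρ hρ (norm_nonneg _) fun f k =>
      norm_apply_le_of_dense (h𝒟 f) (fun h hh h' hh' => by
        obtain ⟨Φ, hv⟩ := hpair f h hh h' hh'
        rw [← hp f _ Φ hv h (by simp) h' (by simp)]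
        exact hv.1.norm_inner_apply_le (by simpa using hv.2.2 _ h1 h (by simp) h (by simp))
          (by simpa using hv.2.2 _ h1 h' (by simp) h' (by simp)) _) k
  have htop : R.map (LinearMap.fst ℂ M N) = ⊤ := by
    refine eq_top_of_dense_of_normalLim
      (@Dense.mono M (sigmaWeak M) _ _ (Submodule.map_mono hΓR) hd) fun U r x hU hx => ?_
    let y : M → N := fun m => if h : m ∈ R.map (LinearMap.fst ℂ M N) then h.choose.2 else 0
    have hy : ∀ m ∈ R.map (LinearMap.fst ℂ M N), (m, y m) ∈ R := fun m hm => by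
      have h2 := hm.choose_spec
      have h3 : y m = hm.choose.2 := dif_pos hm
      have h4 : (m, y m) = hm.choose := Prod.ext h2.2.symm h3
      rw [h4]; exact h2.1
    obtain ⟨z, -, hz⟩ := exists_normalLim U y (r := r)
      (hU.mono fun m hm => (hnorm _ (hy m hm.1)).trans hm.2)
    refine ⟨(x, z), fun f s Φ hv h hh h' hh' => ?_, rfl⟩
    refine tendsto_nhds_unique (hv.2.1.tendsto hx h h') (((hρn f).tendsto hz h h').congr' ?_)
    filter_upwards [hU] with m hm
    exact (hy m hm.1 f s Φ hv h hh h' hh').symm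
  have huniq : ∀ x y y', (x, y) ∈ R → (x, y') ∈ R → y = y' := fun x y y' h h' => by
    have := hnorm _ (R.sub_mem h h')
    simpa [sub_eq_zero] using this
  have hex : ∀ x, ∃ y, (x, y) ∈ R := fun x => by
    obtain ⟨p, hp, rfl⟩ : x ∈ R.map (LinearMap.fst ℂ M N) := htop ▸ Submodule.mem_top
    exact ⟨p.2, hp⟩
  choose T hT using hex
  let θ : M →ₗ[ℂ] N :=
    { toFun := T
      map_add' := fun x y => huniq _ _ _ (hT _) (R.add_mem (hT x) (hT y))
      map_smul' := fun c x => huniq _ _ _ (hT _) (R.smul_mem c (hT x)) }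
  have hθ : ∀ x, (x, θ x) ∈ R := hT
  refine ⟨θ, ?_, ?_, fun p hp => huniq _ _ _ (hθ _) (hΓR hp)⟩
  · refine isNormalMap_of_separating (C := 1) (fun x => by simpa using hnorm _ (hθ x))
      (F := {g | g ∈ normalDual N ∧ ∃ f, ∃ h ∈ 𝒟 f, ∃ h' ∈ 𝒟 f, ∀ x, g x = ⟪h, ρ f x h'⟫_ℂ})
      (fun g hg => hg.1) (fun y hy => hρ y fun f => hmem fun h hh h' hh' => ?_) ?_
    · obtain ⟨g, hg, hgx⟩ := hρn f h h'
      rw [← hgx]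
      exact hy g ⟨hg, f, h, hh, h', hh', hgx⟩
    · rintro g ⟨-, f, h, hh, h', hh', hgx⟩
      obtain ⟨Φ, hv⟩ := hpair f h hh h' hh'
      obtain ⟨g', hg', hgx'⟩ := hv.2.1 h h'
      convert hg'
      ext x
      rw [LinearMap.comp_apply, hgx, hgx']
      exact (hθ x f _ Φ hv h (by simp) h' (by simp)).symm
  · intro n a c
    refine exists_eq_star_mul_self_of_forall_inner ρ hρ fun f h => ?_
    have key : ∀ k : Fin n → H f, 0 ≤ ∑ i, ∑ j, ⟪k i, ρ f (θ (star (a i) * a j)) (k j)⟫_ℂ := by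
      have hcl : IsClosed {k : Fin n → H f |
          0 ≤ ∑ i, ∑ j, ⟪k i, ρ f (θ (star (a i) * a j)) (k j)⟫_ℂ} :=
        isClosed_le (by fun_prop) (by fun_prop)
      have hdense : Dense (Set.univ.pi fun _ : Fin n => (𝒟 f : Set (H f))) :=
        dense_pi _ fun _ _ => h𝒟 f
      intro k
      refine hcl.closure_subset_iff.mpr (fun k hk => ?_) (hdense.closure_eq ▸ Set.mem_univ k)
      obtain ⟨Φ, hv⟩ := hΦ f (Finset.univ.image k) (by
        intro x hx
        simp only [Finset.coe_image, Finset.coe_univ, Set.image_univ, Set.mem_range] at hx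
        obtain ⟨i, rfl⟩ := hx
        exact hk i trivial)
      refine (hv.1 n a k).trans_eq (Finset.sum_congr rfl fun i _ => Finset.sum_congr rfl fun j _ => ?_)
      exact hθ _ f _ Φ hv _ (by simp) _ (by simp)
    refine (key fun i => ρ f (c i) h).trans_eq ?_
    simp only [map_sum, ContinuousLinearMap.sum_apply, inner_sum]
    refine Finset.sum_congr rfl fun i _ => Finset.sum_congr rfl fun j _ => ?_
    rw [mul_assoc, inner_rep_star_mul, map_mul (ρ f)]
    rfl

end Main

section PartialIsometry

variable {E : Type*} [NormedAddCommGroup E] [InnerProductSpace ℂ E] [CompleteSpace E]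
variable {K : Type*} [NormedAddCommGroup K] [InnerProductSpace ℂ K] [CompleteSpace K]

lemma ContinuousLinearMap.ext_of_orthogonal {G : Type*} [NormedAddCommGroup G] [NormedSpace ℂ G]
    {X : Type*} (w : X → E) {T T' : E →L[ℂ] G} (h1 : ∀ x, T (w x) = T' (w x))
    (h2 : ∀ η, (∀ x, ⟪w x, η⟫_ℂ = 0) → T η = T' η) : T = T' := by
  ext η
  let F := (Submodule.span ℂ (Set.range w)).topologicalClosure
  have hF : F ≤ LinearMap.eqLocus T.toLinearMap T'.toLinearMap :=
    Submodule.topologicalClosure_minimal _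
      (Submodule.span_le.mpr (by rintro _ ⟨x, rfl⟩; exact h1 x))
      (isClosed_eq T.continuous T'.continuous)
  have h3 : T (F.starProjection η) = T' (F.starProjection η) :=
    hF (Submodule.starProjection_apply_mem _ _)
  have h4 : T (η - F.starProjection η) = T' (η - F.starProjection η) := by
    refine h2 _ fun x => ?_
    rw [← inner_conj_symm, Submodule.starProjection_inner_eq_zero, map_zero]
    exact Submodule.le_topologicalClosure _ (Submodule.subset_span ⟨x, rfl⟩)
  rw [map_sub, map_sub, h3] at h4
  exact sub_left_injective h4

/-- Two families of vectors with the same Gram matrix are intertwined by a partial isometry. -/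
lemma exists_partialIsometry {X : Type*} (w : X → E) (w' : X → K)
    (hw : ∀ x y, ⟪w x, w y⟫_ℂ = ⟪w' x, w' y⟫_ℂ) :
    ∃ J : E →L[ℂ] K, (∀ x, J (w x) = w' x) ∧ (∀ η, (∀ x, ⟪w x, η⟫_ℂ = 0) → J η = 0) ∧
      ∀ η, J (J.adjoint (J η)) = J η := by
  let F := (Submodule.span ℂ (Set.range w)).topologicalClosure
  let f : (X →₀ ℂ) →ₗ[ℂ] K := Finsupp.linearCombination ℂ w'
  have hmem : ∀ ξ, Finsupp.linearCombination ℂ w ξ ∈ F := fun ξ =>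
    Submodule.le_topologicalClosure _ (Finsupp.range_linearCombination ℂ (v := w) ▸ ⟨ξ, rfl⟩)
  let e : (X →₀ ℂ) →ₗ[ℂ] F := (Finsupp.linearCombination ℂ w).codRestrict F hmem
  have he : DenseRange e := by
    have h1 : Set.range e = ((↑) : F → E) ⁻¹' (Submodule.span ℂ (Set.range w)) := by
      ext x
      rw [← Finsupp.range_linearCombination]
      simp only [Set.mem_range, Set.mem_preimage, SetLike.mem_coe, LinearMap.mem_range]
      exact exists_congr fun ξ => Subtype.ext_iff
    rw [DenseRange, h1]
    intro x
    rw [closure_subtype, Set.image_preimage_eq_inter_range, Subtype.range_coe,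
      Set.inter_eq_left.mpr (Submodule.le_topologicalClosure _)]
    exact x.2
  have hnorm : ∀ ξ, ‖f ξ‖ = ‖e ξ‖ := fun ξ => by
    have h1 : ⟪f ξ, f ξ⟫_ℂ = ⟪(e ξ : E), e ξ⟫_ℂ := by
      simp only [f, e, LinearMap.codRestrict_apply, Finsupp.linearCombination_apply,
        Finsupp.sum, sum_inner, inner_sum, inner_smul_left, inner_smul_right, hw]
    simp only [inner_self_eq_norm_sq_to_K, Complex.coe_algebraMap] at h1
    exact (sq_eq_sq₀ (norm_nonneg _) (norm_nonneg _)).mp (by exact_mod_cast h1)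
  let J : E →L[ℂ] K := f.extendOfNorm e ∘L F.orthogonalProjection
  have hJ : ∀ x, J (w x) = w' x := fun x => by
    have h1 := LinearMap.extendOfNorm_eq he (f := f) ⟨1, fun ξ => by rw [one_mul, hnorm]⟩
      (Finsupp.single x 1)
    have h2 : F.orthogonalProjection (w x) = e (Finsupp.single x 1) := by
      have := Submodule.orthogonalProjection_mem_subspace_eq_self (K := F) (e (Finsupp.single x 1))
      simpa [e] using this
    simp only [J, ContinuousLinearMap.comp_apply, h2, h1]
    simp [f]
  have hJ0 : ∀ η, (∀ x, ⟪w x, η⟫_ℂ = 0) → J η = 0 := fun η hη => by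
    have h1 : η ∈ Fᗮ := by
      rw [Submodule.orthogonal_closure, Submodule.mem_orthogonal]
      intro u hu
      induction hu using Submodule.span_induction with
      | mem v hv => obtain ⟨x, rfl⟩ := hv; exact hη x
      | zero => simp
      | add v v' _ _ h h' => rw [inner_add_left, h, h', add_zero]
      | smul c v _ h => rw [inner_smul_left, h, mul_zero]
    simp [J, Submodule.orthogonalProjection_mem_subspace_orthogonalComplement_eq_zero h1]
  refine ⟨J, hJ, hJ0, ?_⟩
  have h1 : ∀ x, J.adjoint (J (w x)) = w x := fun x => by
    refine ext_inner_right ℂ fun η => ?_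
    rw [ContinuousLinearMap.adjoint_inner_left]
    have := ContinuousLinearMap.ext_of_orthogonal w (T := innerSL ℂ (J (w x)) ∘L J)
      (T' := innerSL ℂ (w x)) (fun y => by simp [hJ, hw]) (fun η hη => by simp [hJ0 η hη, hη])
    exact congr($this η)
  intro η
  have := ContinuousLinearMap.ext_of_orthogonal w (T := J ∘L J.adjoint ∘L J)
    (T' := J) (fun y => by simp [h1]) (fun η hη => by simp [hJ0 η hη])
  exact congr($this η)

end PartialIsometry

section Conj

variable {M : Type*} [CStarAlgebra M]
variable {H : Type*} [NormedAddCommGroup H] [InnerProductSpace ℂ H] [CompleteSpace H]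
variable {K : Type*} [NormedAddCommGroup K] [InnerProductSpace ℂ K] [CompleteSpace K]

/-- The compression `T ↦ V⋆ T V`. -/
def compression (V : H →L[ℂ] K) : (K →L[ℂ] K) →ₗ[ℂ] (H →L[ℂ] H) where
  toFun T := V.adjoint ∘L T ∘L V
  map_add' T T' := by
    rw [ContinuousLinearMap.add_comp, ContinuousLinearMap.comp_add]
  map_smul' c T := by
    rw [ContinuousLinearMap.smul_comp, ContinuousLinearMap.comp_smul, RingHom.id_apply]

lemma inner_compression (V : H →L[ℂ] K) (T : K →L[ℂ] K) (h k : H) :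
    ⟪h, compression V T k⟫_ℂ = ⟪V h, T (V k)⟫_ℂ :=
  ContinuousLinearMap.adjoint_inner_right V h (T (V k))

lemma IsCPOp.compression {Φ : M →ₗ[ℂ] (K →L[ℂ] K)} (hΦ : IsCPOp Φ) (V : H →L[ℂ] K) :
    IsCPOp (compression V ∘ₗ Φ) := fun n a h =>
  (hΦ n a fun i => V (h i)).trans_eq
    (Finset.sum_congr rfl fun _ _ => Finset.sum_congr rfl fun _ _ =>
      (inner_compression V _ _ _).symm)

lemma IsCPOp.add {Φ Ψ : M →ₗ[ℂ] (H →L[ℂ] H)} (hΦ : IsCPOp Φ) (hΨ : IsCPOp Ψ) :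
    IsCPOp (Φ + Ψ) := fun n a h => by
  have := add_nonneg (hΦ n a h) (hΨ n a h)
  simpa only [← Finset.sum_add_distrib, ← inner_add_right, LinearMap.add_apply,
    ContinuousLinearMap.add_apply] using this

lemma isCPOp_rep (ρ : M →⋆ₐ[ℂ] (H →L[ℂ] H)) : IsCPOp ρ.toAlgHom.toLinearMap := fun n a h => by
  have h1 : ∑ i, ∑ j, ⟪h i, ρ (star (a i) * a j) (h j)⟫_ℂ =
      ⟪∑ i, ρ (a i) (h i), ∑ j, ρ (a j) (h j)⟫_ℂ := by
    simp only [inner_rep_star_mul, sum_inner, inner_sum]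
    exact Finset.sum_comm
  refine le_of_le_of_eq ?_ h1.symm
  rw [inner_self_eq_norm_sq_to_K]; positivity

end Conj

section Extension

variable {M N A : Type*} [CStarAlgebra M] [PartialOrder M] [StarOrderedRing M] [WStarAlgebra M]
  [CStarAlgebra N] [PartialOrder N] [StarOrderedRing N] [WStarAlgebra N]
  [CStarAlgebra A] [PartialOrder A] [StarOrderedRing A] [WStarAlgebra A]
variable {H : Type*} [NormedAddCommGroup H] [InnerProductSpace ℂ H] [CompleteSpace H]

/-- Enlarging the space of vectors on which a relation is implemented by a normal completely
positive map into bounded operators. -/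
theorem exists_isCPOp_sup (emb : A →⋆ₐ[ℂ] M) (θ : A →ₗ[ℂ] N) (hθ : IsCompletelyPositive θ)
    (hθn : IsNormalMap θ) (hθ1 : θ 1 = 1) (P : M →ₗ[ℂ] A) (hP : IsCompletelyPositive P) (hPn : IsNormalMap P)
    (hPe : ∀ a, P (emb a) = a) (σ : N →⋆ₐ[ℂ] (H →L[ℂ] H)) (hσ : IsNormalOp σ)
    (𝓗 Ht Hs : Submodule ℂ H) [Ht.HasOrthogonalProjection] [Hs.HasOrthogonalProjection]
    (ht : Ht ≤ 𝓗) (horth : Hs ⟂ 𝓗) (hact : ∀ a, ∀ h ∈ Hs ⊔ Ht, σ (θ a) h ∈ Hs ⊔ Ht)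
    (Γ Γ₁ Γ₂ : Submodule ℂ (M × N))
    (hA0 : ∀ k ∈ Hs, ∀ p ∈ Γ₁, ∀ h ∈ 𝓗, ⟪k, σ p.2 h⟫_ℂ = 0)
    (hleft : ∀ a, ∀ p ∈ Γ₁, (emb a, θ a) * p ∈ Γ)
    (hright : ∀ a, ∀ p ∈ Γ₂, p * (emb a, θ a) ∈ Γ₁)
    (hstar₂ : ∀ p ∈ Γ₂, star p ∈ Γ₁)
    (hΓ₂ : ∀ p ∈ Γ₂, ∀ k ∈ Hs, ∀ k' ∈ Hs, ⟪k, σ p.2 k'⟫_ℂ = 0)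
    (hPΓ₂ : ∀ p ∈ Γ₂, ∀ a a', P (emb a * p.1 * emb a') = 0)
    (hspan₁ : Γ ≤ Submodule.span ℂ {q | ∃ a, ∃ p ∈ Γ₁, q = (emb a, θ a) * p})
    (hspan₂ : Γ ≤ Submodule.span ℂ ({q | ∃ a, q = (emb a, θ a)} ∪
      {q | ∃ a, ∃ p ∈ Γ₂, ∃ a', q = (emb a, θ a) * p * (emb a', θ a')}))
    (hstar : ∀ p ∈ Γ, star p ∈ Γ) (hτ : ∀ a, (emb a, θ a) ∈ Γ)
    {Φ : M →ₗ[ℂ] (H →L[ℂ] H)} (hΦ : IsCPOp Φ) (hΦn : IsNormalOp Φ)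
    (hΦΓ : ∀ p ∈ Γ, ∀ h ∈ 𝓗, ∀ h' ∈ 𝓗, ⟪h, Φ p.1 h'⟫_ℂ = ⟪h, σ p.2 h'⟫_ℂ) :
    ∃ Ψ : M →ₗ[ℂ] (H →L[ℂ] H), IsCPOp Ψ ∧ IsNormalOp Ψ ∧
      ∀ p ∈ Γ, ∀ h ∈ 𝓗 ⊔ Hs, ∀ h' ∈ 𝓗 ⊔ Hs, ⟪h, Ψ p.1 h'⟫_ℂ = ⟪h, σ p.2 h'⟫_ℂ := by
  obtain ⟨K, _, _, _, π, V, hV, hVd⟩ := hΦ.exists_stinespring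
  have hπ : IsNormalOp π := isNormalOp_of_stinespring hΦn hV hVd
  obtain ⟨E, _, _, _, ρ, U, hU, hUd⟩ := (hθ.isCPOp σ).exists_stinespring
  have hρ : IsNormalOp ρ := isNormalOp_of_stinespring (hσ.comp hθn) hU hUd
  replace hU : ∀ a h h', ⟪U h, ρ a (U h')⟫_ℂ = ⟪h, σ (θ a) h'⟫_ℂ := hU
  have hθstar : ∀ a, θ (star a) = star (θ a) := hθ.apply_star
  obtain ⟨J, hJ, hJ0, hJJ⟩ := exists_partialIsometry
    (fun x : A × Ht => ρ x.1 (U x.2)) (fun x : A × Ht => π (emb x.1) (V x.2)) (fun x y => by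
      rw [← inner_rep_star_mul, ← inner_rep_star_mul, ← map_star, ← map_mul emb, hU, hV]
      exact (hΦΓ _ (hτ _) _ (ht x.2.2) _ (ht y.2.2)).symm)
  have hJρ : ∀ a η, J (ρ a η) = π (emb a) (J η) := fun a η => by
    have := ContinuousLinearMap.ext_of_orthogonal (fun x : A × Ht => ρ x.1 (U x.2))
      (T := J ∘L ρ a) (T' := π (emb a) ∘L J) (fun x => by
        have h1 := hJ (a * x.1, x.2)
        simp only [map_mul, ContinuousLinearMap.mul_apply] at h1
        simp [hJ, h1]) (fun η hη => by
        rw [ContinuousLinearMap.comp_apply, ContinuousLinearMap.comp_apply, hJ0 η hη, map_zero]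
        refine hJ0 _ fun x => ?_
        rw [← inner_rep_star, ← ContinuousLinearMap.mul_apply, ← map_mul]
        exact hη (star a * x.1, x.2))
    exact congr($this η)
  have hUs : ∀ a h, U.adjoint (ρ a (U h)) = σ (θ a) h := fun a h =>
    ext_inner_left ℂ fun v => by rw [ContinuousLinearMap.adjoint_inner_right, hU]
  have hperp : ∀ k ∈ Hs, ∀ h ∈ 𝓗, ⟪k, h⟫_ℂ = 0 := fun k hk h hh =>
    Submodule.inner_right_of_mem_orthogonal hk ((Submodule.isOrtho_iff_le.mp horth.symm) hh)
  have hdec : ∀ v ∈ Hs ⊔ Ht, ∃ k ∈ Hs, v = k + Ht.starProjection v := fun v hv => by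
    obtain ⟨k, hk, m, hm, rfl⟩ := Submodule.mem_sup.mp hv
    refine ⟨k, hk, ?_⟩
    have h1 : Ht.starProjection k = 0 := (Submodule.starProjection_apply_eq_zero_iff _).mpr
      ((Submodule.mem_orthogonal' _ _).mpr fun u hu => hperp k hk u (ht hu))
    rw [map_add, h1, zero_add, Submodule.starProjection_eq_self_iff.mpr hm]
  have hPt : ∀ v, Ht.starProjection v ∈ 𝓗 := fun v => ht (Submodule.starProjection_apply_mem _ _)
  have hproj : ∀ v ∈ Hs ⊔ Ht, ∀ p ∈ Γ₁, ∀ h ∈ 𝓗,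
      ⟪Ht.starProjection v, σ p.2 h⟫_ℂ = ⟪v, σ p.2 h⟫_ℂ := fun v hv p hp h hh => by
    obtain ⟨k, hk, hvk⟩ := hdec v hv
    conv_rhs => rw [hvk]
    rw [inner_add_left, hA0 k hk p hp h hh, zero_add]
  have hA0' : ∀ k ∈ Hs, ∀ p ∈ Γ₂, ∀ h ∈ 𝓗, ⟪h, σ p.2 k⟫_ℂ = 0 := fun k hk p hp h hh => by
    rw [← inner_rep_star, ← inner_conj_symm, ← Prod.snd_star, hA0 k hk _ (hstar₂ p hp) h hh, map_zero]
  have hproj' : ∀ v ∈ Hs ⊔ Ht, ∀ p ∈ Γ₂, ∀ h ∈ 𝓗,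
      ⟪h, σ p.2 (Ht.starProjection v)⟫_ℂ = ⟪h, σ p.2 v⟫_ℂ := fun v hv p hp h hh => by
    obtain ⟨k, hk, hvk⟩ := hdec v hv
    conv_rhs => rw [hvk]
    rw [map_add, inner_add_right, hA0' k hk p hp h hh, zero_add]
  have hker : ∀ η, (∀ x : A × Ht, ⟪ρ x.1 (U x.2), η⟫_ℂ = 0) →
      Ht.starProjection (U.adjoint η) = 0 := fun η hη =>
    (Submodule.starProjection_apply_eq_zero_iff _).mpr
      ((Submodule.mem_orthogonal _ _).mpr fun u hu => by
        rw [ContinuousLinearMap.adjoint_inner_right]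
        simpa using hη (1, ⟨u, hu⟩))
  have hA1 : ∀ η, ∀ p ∈ Γ₁, ∀ h ∈ 𝓗,
      ⟪J η, π p.1 (V h)⟫_ℂ = ⟪Ht.starProjection (U.adjoint η), σ p.2 h⟫_ℂ := fun η p hp h hh => by
    have := ContinuousLinearMap.ext_of_orthogonal (fun x : A × Ht => ρ x.1 (U x.2))
      (T := innerSL ℂ (π p.1 (V h)) ∘L J)
      (T' := innerSL ℂ (σ p.2 h) ∘L Ht.starProjection ∘L U.adjoint) (fun x => by
        simp only [ContinuousLinearMap.comp_apply, innerSL_apply_apply, hJ, hUs]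
        rw [← inner_conj_symm, ← inner_conj_symm (σ p.2 h),
          hproj _ (hact _ _ (le_sup_right (a := Hs) x.2.2)) p hp h hh, ← inner_rep_star_mul,
          ← inner_rep_star_mul, hV, ← hθstar, ← map_star emb]
        exact congrArg _ (hΦΓ _ (hleft _ p hp) _ (ht x.2.2) h hh)) (fun η hη => by
        simp [hJ0 η hη, hker η hη])
    rw [← inner_conj_symm, ← inner_conj_symm (Ht.starProjection (U.adjoint η))]
    exact congrArg _ congr($this η)
  have hA2 : ∀ η η', ∀ p ∈ Γ₂, ⟪J η, π p.1 (J η')⟫_ℂ =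
      ⟪Ht.starProjection (U.adjoint η), σ p.2 (Ht.starProjection (U.adjoint η'))⟫_ℂ :=
    fun η η' p hp => by
    have := ContinuousLinearMap.ext_of_orthogonal (fun x : A × Ht => ρ x.1 (U x.2))
      (T := innerSL ℂ (J η) ∘L π p.1 ∘L J)
      (T' := innerSL ℂ (Ht.starProjection (U.adjoint η)) ∘L σ p.2 ∘L
        Ht.starProjection ∘L U.adjoint) (fun x => by
        simp only [ContinuousLinearMap.comp_apply, innerSL_apply_apply, hJ, hUs]
        rw [hproj' _ (hact _ _ (le_sup_right (a := Hs) x.2.2)) p hp _ (hPt _)]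
        have h1 := hA1 η _ (hright x.1 p hp) x.2 (ht x.2.2)
        simpa only [Prod.fst_mul, Prod.snd_mul, map_mul, ContinuousLinearMap.mul_apply] using h1)
        (fun η hη => by simp [hJ0 η hη, hker η hη])
    exact congr($this η')
  let Q : H →L[ℂ] H := Hs.starProjection
  have hQs : ∀ k ∈ Hs, Q k = k := fun k hk => Submodule.starProjection_eq_self_iff.mpr hk
  have hQ0 : ∀ h ∈ 𝓗, Q h = 0 := fun h hh => (Submodule.starProjection_apply_eq_zero_iff _).mpr
      ((Submodule.mem_orthogonal _ _).mpr fun k hk => hperp k hk h hh)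
  let X : H →L[ℂ] K := V ∘L (1 - Q) + J ∘L U ∘L Q
  let Y : H →L[ℂ] E := (1 - J.adjoint ∘L J) ∘L U ∘L Q
  have hXs : ∀ k ∈ Hs, X k = J (U k) := fun k hk => by simp [X, hQs k hk]
  have hX0 : ∀ h ∈ 𝓗, X h = V h := fun h hh => by simp [X, hQ0 h hh]
  have hYs : ∀ k ∈ Hs, Y k = U k - J.adjoint (J (U k)) := fun k hk => by simp [Y, hQs k hk]
  have hY0 : ∀ h ∈ 𝓗, Y h = 0 := fun h hh => by simp [Y, hQ0 h hh]
  let Ψ : M →ₗ[ℂ] (H →L[ℂ] H) := compression X ∘ₗ π.toAlgHom.toLinearMap +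
    compression Y ∘ₗ (ρ.toAlgHom.toLinearMap ∘ₗ P)
  have hΨ : ∀ h x h', ⟪h, Ψ x h'⟫_ℂ = ⟪X h, π x (X h')⟫_ℂ + ⟪Y h, ρ (P x) (Y h')⟫_ℂ :=
    fun h x h' => by
    rw [← inner_compression, ← inner_compression, ← inner_add_right]; rfl
  have hΨcp : IsCPOp Ψ := ((isCPOp_rep π).compression X).add ((hP.isCPOp ρ).compression Y)
  have hΨn : IsNormalOp Ψ := (hπ.conj X).add ((hρ.comp hPn).conj Y)
  have hYρ : ∀ a, ∀ k ∈ Hs, ∀ k' ∈ Hs,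
      ⟪X k, π (emb a) (X k')⟫_ℂ + ⟪Y k, ρ a (Y k')⟫_ℂ = ⟪k, σ (θ a) k'⟫_ℂ := fun a k hk k' hk' => by
    have h1 : ρ a (J.adjoint (J (U k'))) = J.adjoint (π (emb a) (J (U k'))) :=
      ext_inner_left ℂ fun v => by
        rw [← inner_rep_star, ContinuousLinearMap.adjoint_inner_right, hJρ, map_star,
          inner_rep_star, ContinuousLinearMap.adjoint_inner_right]
    rw [hXs k hk, hXs k' hk', hYs k hk, hYs k' hk', map_sub, h1, inner_sub_right,
      ContinuousLinearMap.adjoint_inner_right, map_sub, hJJ, sub_self, inner_zero_left, sub_zero,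
      inner_sub_left, ContinuousLinearMap.adjoint_inner_left, hJρ, hU]
    ring
  have hmix : ∀ p ∈ Γ, ∀ k ∈ Hs, ∀ h ∈ 𝓗, ⟪X k, π p.1 (X h)⟫_ℂ = ⟪k, σ p.2 h⟫_ℂ := by
    intro p hp k hk h hh
    rw [hXs k hk, hX0 h hh]
    refine Submodule.span_induction (p := fun (p : M × N) _ => ⟪J (U k), π p.1 (V h)⟫_ℂ =
      ⟪k, σ p.2 h⟫_ℂ) ?_ (by simp) (fun p q _ _ hp hq => by simp [inner_add_right, hp, hq])
      (fun c p _ hp => by simp [inner_smul_right, hp]) (hspan₁ hp)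
    rintro _ ⟨a, p, hp, rfl⟩
    have h1 := hA1 (ρ (star a) (U k)) p hp h hh
    rw [hUs, hproj _ (hact _ _ (le_sup_left (b := Ht) hk)) p hp h hh, hJρ, map_star, hθstar,
      inner_rep_star, inner_rep_star] at h1
    simpa using h1
  refine ⟨Ψ, hΨcp, hΨn, ?_⟩
  have h00 : ∀ p ∈ Γ, ∀ h ∈ 𝓗, ∀ h' ∈ 𝓗, ⟪h, Ψ p.1 h'⟫_ℂ = ⟪h, σ p.2 h'⟫_ℂ :=
    fun p hp h hh h' hh' => by
    rw [hΨ, hX0 h hh, hX0 h' hh', hY0 h hh, inner_zero_left, add_zero, hV, hΦΓ p hp h hh h' hh']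
  have hs0 : ∀ p ∈ Γ, ∀ k ∈ Hs, ∀ h ∈ 𝓗, ⟪k, Ψ p.1 h⟫_ℂ = ⟪k, σ p.2 h⟫_ℂ :=
    fun p hp k hk h hh => by
    rw [hΨ, hY0 h hh, map_zero, inner_zero_right, add_zero, hmix p hp k hk h hh]
  have h0s : ∀ p ∈ Γ, ∀ h ∈ 𝓗, ∀ k ∈ Hs, ⟪h, Ψ p.1 k⟫_ℂ = ⟪h, σ p.2 k⟫_ℂ :=
    fun p hp h hh k hk => by
    have h1 := hmix _ (hstar p hp) k hk h hh
    rw [hΨ, hY0 h hh, inner_zero_left, add_zero, ← inner_rep_star, ← inner_rep_star,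
      ← inner_conj_symm, ← inner_conj_symm _ k]
    exact congrArg _ h1
  have hss : ∀ p ∈ Γ, ∀ k ∈ Hs, ∀ k' ∈ Hs, ⟪k, Ψ p.1 k'⟫_ℂ = ⟪k, σ p.2 k'⟫_ℂ := by
    intro p hp k hk k' hk'
    refine Submodule.span_induction (p := fun (p : M × N) _ => ⟪k, Ψ p.1 k'⟫_ℂ =
      ⟪k, σ p.2 k'⟫_ℂ) ?_ (by simp) (fun p q _ _ hp hq => by simp [inner_add_right, hp, hq])
      (fun c p _ hp => by simp [inner_smul_right, hp]) (hspan₂ hp)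
    rintro _ (⟨a, rfl⟩ | ⟨a, p, hp, a', rfl⟩)
    · rw [hΨ, hPe]
      exact hYρ a k hk k' hk'
    · have hv : σ (θ (star a)) k ∈ Hs ⊔ Ht := hact _ _ (le_sup_left (b := Ht) hk)
      have hv' : σ (θ a') k' ∈ Hs ⊔ Ht := hact _ _ (le_sup_left (b := Ht) hk')
      have h1 := hA2 (ρ (star a) (U k)) (ρ a' (U k')) p hp
      rw [hUs, hUs, hJρ, hJρ, map_star, inner_rep_star] at h1
      rw [hΨ, Prod.fst_mul, Prod.fst_mul, hPΓ₂ p hp, map_zero, ContinuousLinearMap.zero_apply,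
        inner_zero_right, add_zero, hXs k hk, hXs k' hk', Prod.snd_mul, Prod.snd_mul]
      simp only [map_mul, ContinuousLinearMap.mul_apply]
      rw [h1, ← inner_rep_star σ (θ a), ← hθstar]
      obtain ⟨u, hu, hvu⟩ := hdec _ hv
      obtain ⟨u', hu', hvu'⟩ := hdec _ hv'
      conv_rhs => rw [hvu, hvu', inner_add_left, map_add, inner_add_right, inner_add_right,
        hΓ₂ p hp u hu u' hu']
      have h2 : ⟪u, σ p.2 (Ht.starProjection (σ (θ a') k'))⟫_ℂ = 0 := by
        have h3 : p ∈ Γ₁ := by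
          have h4 := hright 1 p hp
          have h5 : ((emb 1, θ 1) : M × N) = 1 := by rw [map_one, hθ1]; rfl
          rwa [h5, mul_one] at h4
        exact hA0 u hu p h3 _ (hPt _)
      have h3 := hA0' u' hu' p hp _ (hPt (σ (θ (star a)) k))
      rw [h2, h3]
      ring
  intro p hp h hh h' hh'
  obtain ⟨m, hm, k, hk, rfl⟩ := Submodule.mem_sup.mp hh
  obtain ⟨m', hm', k', hk', rfl⟩ := Submodule.mem_sup.mp hh'
  simp only [map_add, inner_add_left, inner_add_right, h00 p hp m hm m' hm', h0s p hp m hm k' hk',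
    hs0 p hp k hk m' hm', hss p hp k hk k' hk']

end Extension

section Words

variable {I R : Type*} [Ring R] [Algebra ℂ R]

/-- The span of the products of letters along a list of indices. -/
def wordSpan (B₀ : Submodule ℂ R) (L : I → Submodule ℂ R) (s : List I) : Submodule ℂ R :=
  (s.map L).prod * B₀

lemma wordSpan_nil (B₀ : Submodule ℂ R) (L : I → Submodule ℂ R) : wordSpan B₀ L [] = B₀ := by
  simp [wordSpan]

lemma wordSpan_cons (B₀ : Submodule ℂ R) (L : I → Submodule ℂ R) (i : I) (s : List I) :
    wordSpan B₀ L (i :: s) = L i * wordSpan B₀ L s := by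
  simp [wordSpan, mul_assoc]

lemma map_wordSpan {R' : Type*} [Ring R'] [Algebra ℂ R'] (f : R →ₐ[ℂ] R') (B₀ : Submodule ℂ R)
    (L : I → Submodule ℂ R) (s : List I) : (wordSpan B₀ L s).map f.toLinearMap =
      wordSpan (B₀.map f.toLinearMap) (fun i => (L i).map f.toLinearMap) s := by
  induction s with
  | nil => simp only [wordSpan_nil]
  | cons i s ih => rw [wordSpan_cons, wordSpan_cons, Submodule.map_mul, ih]

lemma wordSpan_mono {B₀ B₁ : Submodule ℂ R} {L L' : I → Submodule ℂ R} (hB : B₀ ≤ B₁)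
    (hL : ∀ i, L i ≤ L' i) (s : List I) : wordSpan B₀ L s ≤ wordSpan B₁ L' s := by
  induction s with
  | nil => simpa only [wordSpan_nil]
  | cons i s ih => rw [wordSpan_cons, wordSpan_cons]; exact mul_le_mul' (hL i) ih

/-- The compatibility of the letters with the coefficients and the involution. -/
structure IsWordSystem [StarRing R] (B₀ : Submodule ℂ R) (L : I → Submodule ℂ R) : Prop where
  one_mem : 1 ∈ B₀
  mul_le : B₀ * B₀ ≤ B₀
  left_le : ∀ i, B₀ * L i ≤ L i
  right_le : ∀ i, L i * B₀ ≤ L i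
  star_mem : ∀ x ∈ B₀, star x ∈ B₀
  star_mem_letter : ∀ i, ∀ x ∈ L i, star x ∈ L i

namespace IsWordSystem

variable [StarRing R] {B₀ : Submodule ℂ R} {L : I → Submodule ℂ R} (h : IsWordSystem B₀ L)
include h

lemma base_mul (s : List I) : B₀ * wordSpan B₀ L s = wordSpan B₀ L s := by
  refine le_antisymm ?_ fun x hx => by simpa using Submodule.mul_mem_mul h.one_mem hx
  cases s with
  | nil => rw [wordSpan_nil]; exact h.mul_le
  | cons i s => rw [wordSpan_cons, ← mul_assoc]; exact mul_le_mul' (h.left_le i) le_rfl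

lemma mul_base (s : List I) : wordSpan B₀ L s * B₀ = wordSpan B₀ L s := by
  have h1 := h.base_mul []
  rw [wordSpan_nil] at h1
  rw [wordSpan, mul_assoc, h1]

lemma wordSpan_singleton (i : I) : wordSpan B₀ L [i] = L i := by
  rw [wordSpan_cons, wordSpan_nil]
  exact le_antisymm (h.right_le i) fun x hx => by simpa using Submodule.mul_mem_mul hx h.one_mem

lemma mul_wordSpan (s t : List I) :
    wordSpan B₀ L s * wordSpan B₀ L t = wordSpan B₀ L (s ++ t) := by
  have h1 := h.base_mul t
  rw [wordSpan] at h1 ⊢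
  rw [mul_assoc]
  simp only [wordSpan] at h1 ⊢
  rw [h1, List.map_append, List.prod_append, mul_assoc]

lemma mul_mem {s t : List I} {x y : R} (hx : x ∈ wordSpan B₀ L s) (hy : y ∈ wordSpan B₀ L t) :
    x * y ∈ wordSpan B₀ L (s ++ t) :=
  h.mul_wordSpan s t ▸ Submodule.mul_mem_mul hx hy

lemma star_mem_wordSpan {s : List I} {x : R} (hx : x ∈ wordSpan B₀ L s) :
    star x ∈ wordSpan B₀ L s.reverse := by
  induction s generalizing x with
  | nil => rw [wordSpan_nil] at hx; simpa [wordSpan_nil] using h.star_mem x hx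
  | cons i s ih =>
    rw [wordSpan_cons] at hx
    induction hx using Submodule.mul_induction_on' with
    | mem_mul_mem y hy z hz =>
      rw [star_mul, List.reverse_cons]
      exact h.mul_mem (ih hz) (h.wordSpan_singleton i ▸ h.star_mem_letter i y hy)
    | add x _ y _ hx hy => rw [star_add]; exact add_mem hx hy

/-- The span of the reduced words. -/
lemma letter_mul_le (hL : ∀ i, L i * L i ≤ L i ⊔ B₀) (i : I) (s : List I) :
    L i * wordSpan B₀ L (i :: s) ≤ wordSpan B₀ L (i :: s) ⊔ wordSpan B₀ L s := by
  rw [wordSpan_cons, ← mul_assoc]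
  refine (mul_le_mul' (hL i) le_rfl).trans ?_
  rw [Submodule.sup_mul, h.base_mul]

lemma mul_le_iSup (hL : ∀ i, L i * L i ≤ L i ⊔ B₀) {u r : List I} (hu : u.IsChain (· ≠ ·))
    (hr : r.IsChain (· ≠ ·)) : wordSpan B₀ L u * wordSpan B₀ L r ≤
      ⨆ w ∈ {w : List I | w.IsChain (· ≠ ·) ∧ (w <:+ r ∨ (u ≠ [] ∧ w.head? = u.head?))},
        wordSpan B₀ L w := by
  induction u with
  | nil =>
    rw [wordSpan_nil, h.base_mul]
    exact le_iSup₂_of_le r ⟨hr, Or.inl (List.suffix_refl r)⟩ le_rfl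
  | cons j u ih =>
    rw [wordSpan_cons, mul_assoc]
    refine (mul_le_mul' le_rfl (ih hu.tail)).trans ?_
    simp only [Submodule.mul_iSup]
    refine iSup₂_le fun w ⟨hw, hw'⟩ => ?_
    by_cases hjw : (j :: w).IsChain (· ≠ ·)
    · rw [← wordSpan_cons]
      exact le_iSup₂_of_le (j :: w) ⟨hjw, Or.inr ⟨by simp, by simp⟩⟩ le_rfl
    · obtain ⟨w', rfl⟩ : ∃ w', w = j :: w' := by
        cases w with
        | nil => exact absurd (List.isChain_singleton j) hjw
        | cons k w' =>
          rw [List.isChain_cons_cons] at hjw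
          obtain rfl : j = k := by
            by_contra hne
            exact hjw ⟨hne, hw⟩
          exact ⟨w', rfl⟩
      have hsuf : j :: w' <:+ r := by
        refine hw'.resolve_right ?_
        rintro ⟨hne, hhead⟩
        cases u with
        | nil => exact hne rfl
        | cons k u =>
          simp only [List.head?_cons, Option.some.injEq] at hhead
          exact (List.isChain_cons_cons.mp hu).1 hhead
      refine (h.letter_mul_le hL j w').trans (sup_le ?_ ?_)
      · exact le_iSup₂_of_le (j :: w') ⟨hw, Or.inl hsuf⟩ le_rfl
      · exact le_iSup₂_of_le w' ⟨hw.tail, Or.inl ((List.suffix_cons j w').trans hsuf)⟩ le_rfl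

end IsWordSystem

end Words

section FreeProduct

variable {B : Type*} [CStarAlgebra B] {I : Type*} {A : I → Type*} [∀ i, CStarAlgebra (A i)]
  {jB : ∀ i, B →⋆ₐ[ℂ] A i} {φ : ∀ i, A i →ₗ[ℂ] B}

lemma IsCondExp.apply_star {A : Type*} [CStarAlgebra A] {j : B →⋆ₐ[ℂ] A} {E : A →ₗ[ℂ] B}
    (hE : IsCondExp j E) (a : A) : E (star a) = star (E a) := by
  have h1 : ∀ x, star (E (star x * x)) = E (star x * x) := fun x => by
    obtain ⟨b, hb⟩ := hE.positive x
    rw [hb, star_mul, star_star]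
  have h2 := h1 (a + 1)
  have h3 := h1 (a + Complex.I • (1 : A))
  have h4 := h1 a
  have h5 := h1 (1 : A)
  simp only [star_add, star_one, star_smul, add_mul, mul_add, one_mul, mul_one, map_add, map_smul,
    smul_mul_assoc, mul_smul_comm, h4, smul_smul] at h2 h3 h5
  simp only [h5, Complex.star_def, Complex.conj_I] at h2 h3
  have h6 : star (E (star a)) + star (E a) = E (star a) + E a := by
    have := sub_eq_zero.mpr h2
    rw [← sub_eq_zero, ← this]
    abel
  have h7 : star (E (star a)) - star (E a) = E a - E (star a) := by
    refine smul_right_injective B Complex.I_ne_zero ?_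
    have := sub_eq_zero.mpr h3
    simp only [smul_sub]
    rw [← sub_eq_zero, ← neg_eq_zero, ← this]
    simp only [neg_smul, neg_neg, map_neg, Complex.conj_I, smul_neg, smul_add]
    abel
  have h8 : (2 : ℂ) • star (E (star a)) = (2 : ℂ) • E a := by
    rw [two_smul, two_smul]
    calc _ = (star (E (star a)) + star (E a)) + (star (E (star a)) - star (E a)) := by abel
      _ = _ := by rw [h6, h7]; abel
  rw [← star_star (E (star a)), smul_right_injective B two_ne_zero h8]

lemma IsCondExp.apply_one {A : Type*} [CStarAlgebra A] {j : B →⋆ₐ[ℂ] A} {E : A →ₗ[ℂ] B}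
    (hE : IsCondExp j E) : E 1 = 1 := by
  rw [← map_one j, hE.left_inverse]

/-- The letters of a free product. -/
def letters {R : Type*} [Ring R] [Algebra ℂ R] (φ : ∀ i, A i →ₗ[ℂ] B) (e : ∀ i, A i →ₗ[ℂ] R)
    (i : I) : Submodule ℂ R := (LinearMap.ker (φ i)).map (e i)

/-- The image of the algebra of coefficients. -/
def coeffs {R : Type*} [Ring R] [Algebra ℂ R] [StarRing R] (j : B →⋆ₐ[ℂ] R) : Submodule ℂ R :=
  LinearMap.range j.toAlgHom.toLinearMap

lemma isWordSystem_letters {R : Type*} [Ring R] [Algebra ℂ R] [StarRing R]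
    (hφ : ∀ i, IsCondExp (jB i) (φ i)) (j : B →⋆ₐ[ℂ] R) (e : ∀ i, A i →ₗ[ℂ] R)
    (he : ∀ i b₁ a b₂, e i (jB i b₁ * a * jB i b₂) = j b₁ * e i a * j b₂)
    (hes : ∀ i a, e i (star a) = star (e i a)) :
    IsWordSystem (coeffs j) (letters φ e) where
  one_mem := ⟨1, map_one j⟩
  mul_le := by
    rw [Submodule.mul_le]
    rintro _ ⟨b, rfl⟩ _ ⟨b', rfl⟩
    exact ⟨b * b', map_mul j b b'⟩
  left_le i := by
    rw [Submodule.mul_le]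
    rintro _ ⟨b, rfl⟩ _ ⟨a, ha, rfl⟩
    refine ⟨jB i b * a, ?_, ?_⟩
    · have := (hφ i).bimodule b 1 a
      simp only [map_one, mul_one] at this
      rw [SetLike.mem_coe, LinearMap.mem_ker, this, ha, mul_zero]
    · have := he i b a 1
      simp only [map_one, mul_one] at this
      exact this
  right_le i := by
    rw [Submodule.mul_le]
    rintro _ ⟨a, ha, rfl⟩ _ ⟨b, rfl⟩
    refine ⟨a * jB i b, ?_, ?_⟩
    · have := (hφ i).bimodule 1 b a
      simp only [map_one, one_mul] at this
      rw [SetLike.mem_coe, LinearMap.mem_ker, this, ha, zero_mul]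
    · have := he i 1 a b
      simp only [map_one, one_mul] at this
      exact this
  star_mem := by
    rintro _ ⟨b, rfl⟩
    exact ⟨star b, map_star j b⟩
  star_mem_letter i := by
    rintro _ ⟨a, ha, rfl⟩
    refine ⟨star a, ?_, hes i a⟩
    rw [SetLike.mem_coe, LinearMap.mem_ker, (hφ i).apply_star, ha, star_zero]

end FreeProduct

section WordSup

variable {I R : Type*} [Ring R] [Algebra ℂ R]

/-- The span of the words whose lists of indices belong to a given set. -/
def wordSup (B₀ : Submodule ℂ R) (L : I → Submodule ℂ R) (S : Set (List I)) : Submodule ℂ R :=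
  ⨆ s ∈ S, wordSpan B₀ L s

lemma wordSpan_le_wordSup (B₀ : Submodule ℂ R) (L : I → Submodule ℂ R) {S : Set (List I)}
    {s : List I} (hs : s ∈ S) : wordSpan B₀ L s ≤ wordSup B₀ L S :=
  le_iSup₂_of_le s hs le_rfl

lemma wordSup_le {B₀ : Submodule ℂ R} {L : I → Submodule ℂ R} {S : Set (List I)}
    {T : Submodule ℂ R} (h : ∀ s ∈ S, wordSpan B₀ L s ≤ T) : wordSup B₀ L S ≤ T :=
  iSup₂_le h

lemma map_wordSup {R' : Type*} [Ring R'] [Algebra ℂ R'] (f : R →ₐ[ℂ] R') (B₀ : Submodule ℂ R)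
    (L : I → Submodule ℂ R) (S : Set (List I)) : (wordSup B₀ L S).map f.toLinearMap =
      wordSup (B₀.map f.toLinearMap) (fun i => (L i).map f.toLinearMap) S := by
  simp only [wordSup, Submodule.map_iSup, map_wordSpan]

/-- The index lists of reduced words. -/
def reducedLists (I : Type*) : Set (List I) := {s | s.IsChain (· ≠ ·)}

/-- The index lists of reduced words that remain reduced after prepending `i`. -/
def reducedListsAfter (i : I) : Set (List I) := {s | (i :: s).IsChain (· ≠ ·)}

/-- The index lists of reduced words that remain reduced after adding `i` on both sides. -/
def reducedListsBetween (i : I) : Set (List I) := {s | (i :: (s ++ [i])).IsChain (· ≠ ·)}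

lemma List.IsChain.reverse_ne {s : List I} (hs : s.IsChain (· ≠ ·)) :
    s.reverse.IsChain (· ≠ ·) := by
  rw [List.isChain_reverse]
  exact hs.imp fun _ _ h => h.symm

namespace IsWordSystem

variable [StarRing R] {B₀ : Submodule ℂ R} {L : I → Submodule ℂ R} (h : IsWordSystem B₀ L)
include h

lemma sup_mul_wordSup_le (i : I) :
    (L i ⊔ B₀) * wordSup B₀ L (reducedListsAfter i) ≤ wordSup B₀ L (reducedLists I) := by
  simp only [wordSup, Submodule.mul_iSup]
  refine iSup₂_le fun s hs => ?_
  rw [Submodule.sup_mul, ← wordSpan_cons, h.base_mul]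
  exact sup_le (wordSpan_le_wordSup _ _ hs) (wordSpan_le_wordSup _ _ hs.tail)

lemma wordSup_mul_sup_le (i : I) : wordSup B₀ L (reducedListsBetween i) * (L i ⊔ B₀) ≤
    wordSup B₀ L (reducedListsAfter i) := by
  simp only [wordSup, Submodule.iSup_mul]
  refine iSup₂_le fun s hs => ?_
  rw [Submodule.mul_sup, h.mul_base, ← h.wordSpan_singleton, h.mul_wordSpan]
  refine sup_le (wordSpan_le_wordSup _ _ hs) (wordSpan_le_wordSup _ _ ?_)
  exact List.IsChain.left_of_append (l₁ := i :: s) (l₂ := [i]) hs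

lemma star_mem_wordSup {S S' : Set (List I)} (hS : ∀ s ∈ S, s.reverse ∈ S') {x : R}
    (hx : x ∈ wordSup B₀ L S) : star x ∈ wordSup B₀ L S' := by
  simp only [wordSup] at hx
  induction hx using Submodule.iSup_induction' with
  | zero => simp
  | add x y _ _ hx hy => rw [star_add]; exact add_mem hx hy
  | mem s x hx =>
    induction hx using Submodule.iSup_induction' with
    | zero => simp
    | add x y _ _ hx hy => rw [star_add]; exact add_mem hx hy
    | mem hs x hx => exact wordSpan_le_wordSup _ _ (hS s hs) (h.star_mem_wordSpan hx)

lemma wordSup_le_sup_mul (i : I) :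
    wordSup B₀ L (reducedLists I) ≤ (L i ⊔ B₀) * wordSup B₀ L (reducedListsAfter i) := by
  refine wordSup_le fun s hs => ?_
  by_cases his : (i :: s).IsChain (· ≠ ·)
  · rw [← h.base_mul]
    exact mul_le_mul' le_sup_right (wordSpan_le_wordSup _ _ his)
  · obtain ⟨s', rfl⟩ : ∃ s', s = i :: s' := by
      cases s with
      | nil => exact absurd (List.isChain_singleton i) his
      | cons k s' =>
        rw [List.isChain_cons_cons] at his
        obtain rfl : i = k := by
          by_contra hne
          exact his ⟨hne, hs⟩
        exact ⟨s', rfl⟩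
    rw [wordSpan_cons]
    exact mul_le_mul' le_sup_left (wordSpan_le_wordSup _ _ hs)

lemma wordSup_le_sup_sup_mul (i : I) : wordSup B₀ L (reducedLists I) ≤
    (L i ⊔ B₀) ⊔ (L i ⊔ B₀) * wordSup B₀ L (reducedListsBetween i) * (L i ⊔ B₀) := by
  have hBT : B₀ ≤ L i ⊔ B₀ := le_sup_right
  have hTT : (L i ⊔ B₀) * B₀ ≤ L i ⊔ B₀ := by
    rw [Submodule.sup_mul]
    exact sup_le_sup (h.right_le i) h.mul_le
  refine (h.wordSup_le_sup_mul i).trans ?_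
  conv_lhs => rw [wordSup]
  simp only [Submodule.mul_iSup]
  refine iSup₂_le fun s hs => ?_
  have hs : (i :: s).IsChain (· ≠ ·) := hs
  induction s using List.reverseRecOn with
  | nil => rw [wordSpan_nil]; exact hTT.trans le_sup_left
  | append_singleton s k _ =>
    refine le_sup_of_le_right ?_
    by_cases hk : k = i
    · subst hk
      rw [← h.mul_wordSpan, ← mul_assoc, h.wordSpan_singleton]
      exact mul_le_mul' (mul_le_mul' le_rfl (wordSpan_le_wordSup _ _ hs)) le_sup_left
    · rw [← h.mul_base, ← mul_assoc]
      refine mul_le_mul' (mul_le_mul' le_rfl (wordSpan_le_wordSup _ _ ?_)) le_sup_right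
      change (i :: ((s ++ [k]) ++ [i])).IsChain (· ≠ ·)
      rw [← List.cons_append, List.isChain_append]
      refine ⟨hs, List.isChain_singleton i, ?_⟩
      intro x hx y hy
      rw [← List.cons_append, List.getLast?_append] at hx
      simp only [List.getLast?_singleton, Option.some_or, Option.mem_def, Option.some.injEq] at hx
      simp only [List.head?_cons, Option.mem_def, Option.some.injEq] at hy
      rw [← hx, ← hy]
      exact hk

end IsWordSystem

end WordSup

section FreeProduct

variable {B : Type*} [CStarAlgebra B] {I : Type*} {A : I → Type*} [∀ i, CStarAlgebra (A i)]
  {jB : ∀ i, B →⋆ₐ[ℂ] A i} {φ : ∀ i, A i →ₗ[ℂ] B}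

lemma range_eq_letters_sup_coeffs {R : Type*} [Ring R] [Algebra ℂ R] [StarRing R]
    (hφ : ∀ i, IsCondExp (jB i) (φ i)) (j : B →⋆ₐ[ℂ] R) (e : ∀ i, A i →ₗ[ℂ] R)
    (hej : ∀ i b, e i (jB i b) = j b) (i : I) :
    LinearMap.range (e i) = letters φ e i ⊔ coeffs j := by
  apply le_antisymm
  · rintro _ ⟨a, rfl⟩
    rw [← sub_add_cancel a (jB i (φ i a)), map_add, hej]
    refine Submodule.add_mem_sup ⟨_, ?_, rfl⟩ ⟨_, rfl⟩
    rw [SetLike.mem_coe, LinearMap.mem_ker, map_sub, (hφ i).left_inverse, sub_self]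
  · refine sup_le ?_ ?_
    · rintro _ ⟨a, -, rfl⟩
      exact ⟨a, rfl⟩
    · rintro _ ⟨b, rfl⟩
      exact ⟨jB i b, hej i b⟩

lemma prod_map_mem_wordSpan {R : Type*} [Ring R] [Algebra ℂ R] [StarRing R] (j : B →⋆ₐ[ℂ] R)
    (e : ∀ i, A i →ₗ[ℂ] R) (l : List (Σ i, A i)) (hl : ∀ p ∈ l, φ p.1 p.2 = 0) :
    (l.map fun p => e p.1 p.2).prod ∈ wordSpan (coeffs j) (letters φ e) (l.map Sigma.fst) := by
  induction l with
  | nil => simpa [wordSpan_nil] using ⟨1, map_one j⟩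
  | cons p l ih =>
    simp only [List.map_cons, List.prod_cons, wordSpan_cons]
    refine Submodule.mul_mem_mul ⟨p.2, ?_, rfl⟩ (ih fun q hq => hl q (List.mem_cons_of_mem _ hq))
    exact hl p List.mem_cons_self

lemma prod_letters_le {R : Type*} [Ring R] [Algebra ℂ R] (e : ∀ i, A i →ₗ[ℂ] R) (s : List I) :
    (s.map (letters φ e)).prod ≤ Submodule.span ℂ {x | ∃ l : List (Σ i, A i),
      l.map Sigma.fst = s ∧ (∀ p ∈ l, φ p.1 p.2 = 0) ∧ (l.map fun p => e p.1 p.2).prod = x} := by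
  induction s with
  | nil =>
    simp only [List.map_nil, List.prod_nil]
    rw [Submodule.one_le]
    exact Submodule.subset_span ⟨[], by simp⟩
  | cons i s ih =>
    rw [List.map_cons, List.prod_cons, Submodule.mul_le]
    rintro _ ⟨a, ha, rfl⟩ y hy
    replace hy := ih hy
    induction hy using Submodule.span_induction with
    | zero => simp
    | add y z _ _ hy hz => rw [mul_add]; exact add_mem hy hz
    | smul c y _ hy => rw [mul_smul_comm]; exact Submodule.smul_mem _ _ hy
    | mem y hy =>
      obtain ⟨l, rfl, hl, rfl⟩ := hy
      refine Submodule.subset_span ⟨⟨i, a⟩ :: l, by simp, ?_, by simp⟩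
      intro p hp
      rcases List.mem_cons.mp hp with rfl | hp
      · exact ha
      · exact hl p hp

end FreeProduct

section FreeProduct

variable {B : Type*} [CStarAlgebra B] [PartialOrder B] [StarOrderedRing B] [WStarAlgebra B]
  {I : Type*} {A : I → Type*} [∀ i, CStarAlgebra (A i)] [∀ i, PartialOrder (A i)]
  [∀ i, StarOrderedRing (A i)] [∀ i, WStarAlgebra (A i)] {jB : ∀ i, B →⋆ₐ[ℂ] A i}
  {φ : ∀ i, A i →ₗ[ℂ] B} {M : Type*} [CStarAlgebra M] [PartialOrder M] [StarOrderedRing M]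
  [WStarAlgebra M] {jC : B →⋆ₐ[ℂ] M} {emb : ∀ i, A i →⋆ₐ[ℂ] M} {E : M →ₗ[ℂ] B}

namespace IsVNAmalgProd

variable (hM : IsVNAmalgProd B jB φ jC emb E)
include hM

lemma emb_apply (i : I) (b : B) : emb i (jB i b) = jC b := DFunLike.congr_fun (hM.compat i) b

lemma apply_mul_right (x : M) (b : B) : E (x * jC b) = E x * b := by
  have := hM.condExp.bimodule 1 b x
  simpa using this

/-- The span of the words in the letters of the free product. -/
abbrev words (_ : IsVNAmalgProd B jB φ jC emb E) : List I → Submodule ℂ M :=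
  wordSpan (coeffs jC) (letters φ fun i => (emb i).toAlgHom.toLinearMap)

variable (hφ : ∀ i, IsCondExp (jB i) (φ i))
include hφ

lemma isWordSystem :
    IsWordSystem (coeffs jC) (letters φ fun i => (emb i).toAlgHom.toLinearMap) :=
  isWordSystem_letters hφ jC _
    (fun i b₁ a b₂ => by
      change emb i _ = _ * emb i a * _
      rw [map_mul, map_mul, hM.emb_apply, hM.emb_apply])
    fun i a => map_star (emb i) a

lemma range_emb (i : I) : LinearMap.range (emb i).toAlgHom.toLinearMap =
    letters φ (fun i => (emb i).toAlgHom.toLinearMap) i ⊔ coeffs jC :=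
  range_eq_letters_sup_coeffs hφ jC (fun i => (emb i).toAlgHom.toLinearMap) hM.emb_apply i

lemma letter_mul_letter_le (i : I) :
    letters φ (fun i => (emb i).toAlgHom.toLinearMap) i *
      letters φ (fun i => (emb i).toAlgHom.toLinearMap) i ≤
    letters φ (fun i => (emb i).toAlgHom.toLinearMap) i ⊔ coeffs jC := by
  rw [Submodule.mul_le, ← hM.range_emb hφ]
  rintro _ ⟨a, -, rfl⟩ _ ⟨b, -, rfl⟩
  exact ⟨a * b, map_mul (emb i) a b⟩

omit hφ in
lemma apply_eq_zero {s : List I} (hs : s.IsChain (· ≠ ·)) (hne : s ≠ []) {x : M}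
    (hx : x ∈ hM.words s) : E x = 0 := by
  suffices H : hM.words s ≤ LinearMap.ker E from H hx
  rw [words, wordSpan, Submodule.mul_le]
  rintro y hy _ ⟨b, rfl⟩
  change E (y * jC b) = 0
  rw [hM.apply_mul_right]
  suffices H : E y = 0 by rw [H, zero_mul]
  replace hy := prod_letters_le _ s hy
  induction hy using Submodule.span_induction with
  | zero => simp
  | add y z _ _ hy hz => rw [map_add, hy, hz, add_zero]
  | smul c y _ hy => rw [map_smul, hy, smul_zero]
  | mem y hy =>
    obtain ⟨l, rfl, hl, rfl⟩ := hy
    obtain ⟨n, hn⟩ : ∃ n, l.length = n + 1 := by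
      refine Nat.exists_eq_succ_of_ne_zero fun h0 => hne ?_
      rw [List.length_eq_zero_iff] at h0
      simp [h0]
    have key := hM.free n (fun k => (l.get (k.cast hn.symm)).1) ?_
      (fun k => (l.get (k.cast hn.symm)).2) fun k => hl _ (List.get_mem _ _)
    · rw [← key]
      congr 2
      apply List.ext_get
      · simp [hn]
      · intro k h1 h2
        simp only [List.get_eq_getElem, List.getElem_map, List.getElem_ofFn]
        rfl
    · intro k
      have := List.isChain_iff_getElem.mp hs k (by simp [hn])
      simpa using this

lemma apply_star_mul {s t : List I} (hs : s.IsChain (· ≠ ·)) (ht : t.IsChain (· ≠ ·))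
    (hst : s ≠ t) {x y : M} (hx : x ∈ hM.words s) (hy : y ∈ hM.words t) :
    E (star x * y) = 0 := by
  have hW := hM.isWordSystem hφ
  induction s generalizing t x y with
  | nil =>
    have hxy := hW.mul_mem (hW.star_mem_wordSpan hx) hy
    rw [List.reverse_nil, List.nil_append] at hxy
    exact hM.apply_eq_zero ht hst.symm hxy
  | cons i s ih =>
    by_cases hc : ((i :: s).reverse ++ t).IsChain (· ≠ ·)
    · exact hM.apply_eq_zero hc (by simp) (hW.mul_mem (hW.star_mem_wordSpan hx) hy)
    obtain ⟨t', rfl⟩ : ∃ t', t = i :: t' := by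
      rw [List.isChain_append] at hc
      cases t with
      | nil => exact absurd ⟨hs.reverse_ne, ht, by simp⟩ hc
      | cons k t' =>
        obtain rfl : i = k := by
          by_contra hne
          refine hc ⟨hs.reverse_ne, ht, ?_⟩
          simpa using hne
        exact ⟨t', rfl⟩
    have hst' : s ≠ t' := fun h0 => hst (by rw [h0])
    rw [words, wordSpan_cons] at hx hy
    induction hx using Submodule.mul_induction_on' with
    | add x₁ _ x₂ _ h1 h2 => rw [star_add, add_mul, map_add, h1, h2, add_zero]
    | mem_mul_mem l hl x hx =>
      induction hy using Submodule.mul_induction_on' with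
      | add y₁ _ y₂ _ h1 h2 => rw [mul_add, map_add, h1, h2, add_zero]
      | mem_mul_mem m hm y hy =>
        have hlm := hM.letter_mul_letter_le hφ i
          (Submodule.mul_mem_mul (hW.star_mem_letter i l hl) hm)
        obtain ⟨c, hc, d, hd, hcd⟩ := Submodule.mem_sup.mp hlm
        rw [star_mul, mul_assoc, ← mul_assoc (star l), ← hcd, add_mul, mul_add, map_add]
        have h1 : E (star x * (c * y)) = 0 := by
          rw [← hW.wordSpan_singleton] at hc
          refine hM.apply_eq_zero (s := s.reverse ++ ([i] ++ t')) ?_ (by simp)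
            (hW.mul_mem (hW.star_mem_wordSpan hx) (hW.mul_mem hc hy))
          have h1 : (s.reverse ++ [i]).IsChain (· ≠ ·) := by
            simpa using hs.reverse_ne
          simpa using h1.append_overlap ht (by simp)
        have h2 : E (star x * (d * y)) = 0 := by
          refine ih hs.tail ht.tail hst' hx ?_
          rw [List.tail_cons, words, ← hW.base_mul t']
          exact Submodule.mul_mem_mul hd hy
        rw [h1, h2, add_zero]

/-- The span of all reduced words is `σ`-weakly dense in the free product. -/
lemma dense_wordSup : @Dense M (sigmaWeak M)
    (wordSup (coeffs jC) (letters φ fun i => (emb i).toAlgHom.toLinearMap) (reducedLists I) :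
      Set M) := by
  have hW := hM.isWordSystem hφ
  refine @Dense.mono M (sigmaWeak M) _ _ ?_ hM.generating
  set T := wordSup (coeffs jC) (letters φ fun i => (emb i).toAlgHom.toLinearMap) (reducedLists I)
  have hT : ∀ i a, ∀ y ∈ T, emb i a * y ∈ T := by
    intro i a y hy
    replace hy := hW.wordSup_le_sup_mul i hy
    rw [← hM.range_emb hφ] at hy
    induction hy using Submodule.mul_induction_on' with
    | add y₁ _ y₂ _ h1 h2 =>
      rw [mul_add]
      exact add_mem h1 h2
    | mem_mul_mem m hm y hy =>
      obtain ⟨b, rfl⟩ := hm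
      rw [← mul_assoc]
      refine hW.sup_mul_wordSup_le i (Submodule.mul_mem_mul ?_ hy)
      rw [← hM.range_emb hφ]
      exact ⟨a * b, map_mul (emb i) a b⟩
  intro x hx
  suffices H : ∀ y ∈ T, x * y ∈ T by
    have h1 : (1 : M) ∈ T := by
      refine wordSpan_le_wordSup _ _ (s := []) List.isChain_nil ?_
      rw [wordSpan_nil]
      exact hW.one_mem
    simpa using H 1 h1
  replace hx : x ∈ Algebra.adjoin ℂ ((⋃ i, Set.range (emb i)) ∪ star (⋃ i, Set.range (emb i))) := hx
  induction hx using Algebra.adjoin_induction with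
  | mem x hx =>
    rcases hx with hx | hx
    · obtain ⟨i, a, rfl⟩ := Set.mem_iUnion.mp hx
      exact hT i a
    · obtain ⟨i, a, ha⟩ := Set.mem_iUnion.mp hx
      rw [← star_star x, ← ha, ← map_star]
      exact hT i _
  | algebraMap r =>
    intro y hy
    rw [← Algebra.smul_def]
    exact T.smul_mem r hy
  | add x₁ x₂ _ _ h1 h2 =>
    intro y hy
    rw [add_mul]
    exact add_mem (h1 y hy) (h2 y hy)
  | mul x₁ x₂ _ _ h1 h2 =>
    intro y hy
    rw [mul_assoc]
    exact h1 _ (h2 y hy)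

end IsVNAmalgProd

end FreeProduct

section GNS

universe u

variable {M : Type u} [CStarAlgebra M] [PartialOrder M] [StarOrderedRing M] [WStarAlgebra M]
variable {K : Type*} [NormedAddCommGroup K] [InnerProductSpace ℂ K] [CompleteSpace K]

/-- A normal cyclic representation implementing a functional by its cyclic vector. -/
structure IsGNS (g : M →ₗ[ℂ] ℂ) (ρ : M →⋆ₐ[ℂ] (K →L[ℂ] K)) (ξ : K) : Prop where
  inner_apply (x y : M) : ⟪ρ x ξ, ρ y ξ⟫_ℂ = g (star x * y)
  dense : Dense (Set.range fun x => ρ x ξ)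
  normal : IsNormalOp ρ

lemma exists_isGNS {g : M →ₗ[ℂ] ℂ} (hg : IsPosFunctional g) (hgn : g ∈ normalDual M) :
    ∃ (K : Type u) (_ : NormedAddCommGroup K) (_ : InnerProductSpace ℂ K) (_ : CompleteSpace K)
      (ρ : M →⋆ₐ[ℂ] (K →L[ℂ] K)) (ξ : K), IsGNS g ρ ξ := by
  let Φ : M →ₗ[ℂ] (ℂ →L[ℂ] ℂ) := LinearMap.smulRight g (ContinuousLinearMap.id ℂ ℂ)
  have hΦ : ∀ (x : M) (h k : ℂ), ⟪h, Φ x k⟫_ℂ = star h * g x * k := fun x h k => by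
    simp [Φ]
    ring
  have hcp : IsCPOp Φ := fun n a h => by
    have h1 : ∑ i, ∑ j, ⟪h i, Φ (star (a i) * a j) (h j)⟫_ℂ =
        g (star (∑ i, h i • a i) * ∑ j, h j • a j) := by
      simp only [hΦ, star_sum, star_smul, Finset.sum_mul_sum, map_sum, smul_mul_smul_comm,
        map_smul, smul_eq_mul]
      exact Finset.sum_congr rfl fun i _ => Finset.sum_congr rfl fun j _ => by ring
    rw [h1]
    exact hg _ (star_mul_self_nonneg _)
  obtain ⟨K, _, _, _, ρ, V, hV, hd⟩ := hcp.exists_stinespring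
  have hV1 : ∀ z, V z = z • V 1 := fun z => by rw [← map_smul, smul_eq_mul, mul_one]
  refine ⟨K, _, _, _, ρ, V 1, ⟨fun x y => ?_, ?_, ?_⟩⟩
  · rw [← inner_rep_star_mul, hV, hΦ]
    simp
  · refine hd.mono ?_
    have h1 : Submodule.span ℂ (Set.range fun p : M × ℂ => ρ p.1 (V p.2)) ≤
        LinearMap.range ((ContinuousLinearMap.apply ℂ K (V 1)).toLinearMap ∘ₗ
          ρ.toAlgHom.toLinearMap) := by
      rw [Submodule.span_le]
      rintro _ ⟨⟨x, z⟩, rfl⟩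
      refine ⟨z • x, ?_⟩
      simp [hV1 z]
    exact h1
  · refine isNormalOp_of_stinespring (Φ := Φ) (fun h k => ?_) hV hd
    exact ⟨(star h * k) • g, Submodule.smul_mem _ _ hgn, fun x => by
      rw [hΦ]
      simp only [LinearMap.smul_apply, smul_eq_mul]
      ring⟩

/-- The compression of a positive normal functional along a family of vectors with the same Gram
matrix. -/
lemma exists_isCPOp_of_inner {g : M →ₗ[ℂ] ℂ} (hg : IsPosFunctional g) (hgn : g ∈ normalDual M)
    {X : Type*} (w : X → K) (m : X → M) (hw : ∀ x y, ⟪w x, w y⟫_ℂ = g (star (m x) * m y)) :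
    ∃ Φ : M →ₗ[ℂ] (K →L[ℂ] K), IsCPOp Φ ∧ IsNormalOp Φ ∧
      ∀ a x y, ⟪w x, Φ a (w y)⟫_ℂ = g (star (m x) * a * m y) := by
  obtain ⟨H, _, _, _, ρ, ξ, hρ⟩ := exists_isGNS hg hgn
  obtain ⟨J, hJ, -, -⟩ := exists_partialIsometry w (fun x => ρ (m x) ξ) fun x y => by
    rw [hw, hρ.inner_apply]
  refine ⟨compression J ∘ₗ ρ.toAlgHom.toLinearMap, (isCPOp_rep ρ).compression J,
    hρ.normal.conj J, fun a x y => ?_⟩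
  rw [LinearMap.comp_apply, inner_compression, hJ, hJ]
  change ⟪ρ (m x) ξ, ρ a (ρ (m y) ξ)⟫_ℂ = _
  rw [← ContinuousLinearMap.mul_apply, ← map_mul, hρ.inner_apply, mul_assoc]

end GNS

section CondExp

variable {B A : Type*} [CStarAlgebra B] [PartialOrder B] [StarOrderedRing B] [WStarAlgebra B]
  [CStarAlgebra A] [PartialOrder A] [StarOrderedRing A] [WStarAlgebra A] {j : B →⋆ₐ[ℂ] A}
  {E : A →ₗ[ℂ] B}

lemma IsCondExp.isPosFunctional_comp (hE : IsCondExp j E) {f : B →ₗ[ℂ] ℂ}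
    (hf : IsNormalPosFunctional f) : IsPosFunctional (f ∘ₗ E) := fun x hx => by
  obtain ⟨a, rfl⟩ := CStarAlgebra.nonneg_iff_eq_star_mul_self.mp hx
  obtain ⟨b, hb⟩ := hE.positive a
  rw [LinearMap.comp_apply, hb]
  exact hf.isPosFunctional _ (star_mul_self_nonneg b)

lemma comp_mem_normalDual (hE : IsNormalMap E) {f : B →ₗ[ℂ] ℂ} (hf : IsNormalPosFunctional f) :
    f ∘ₗ E ∈ normalDual A :=
  isNormalMap_iff.mp hE f hf.mem_normalDual

/-- The GNS representations attached to a normal conditional expectation are jointly faithful. -/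
lemma FaithfulGNS.eq_zero_of_forall (hE : FaithfulGNS E)
    {H : {f : B →ₗ[ℂ] ℂ // IsNormalPosFunctional f} → Type*} [∀ f, NormedAddCommGroup (H f)]
    [∀ f, InnerProductSpace ℂ (H f)] [∀ f, CompleteSpace (H f)]
    {ρ : ∀ f, A →⋆ₐ[ℂ] (H f →L[ℂ] H f)} {ξ : ∀ f, H f}
    (hρ : ∀ f, IsGNS (f.1 ∘ₗ E) (ρ f) (ξ f)) {y : A} (hy : ∀ f, ρ f y = 0) : y = 0 := by
  refine hE y fun x => eq_zero_of_normalDual fun f hf => ?_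
  have h1 := (hρ ⟨f, hf⟩).inner_apply (y * x) (y * x)
  rw [map_mul, hy, zero_mul, ContinuousLinearMap.zero_apply, inner_zero_left] at h1
  exact h1.symm

end CondExp

section Projection

variable {B : Type*} [CStarAlgebra B] [PartialOrder B] [StarOrderedRing B] [WStarAlgebra B]
  {I : Type*} {A : I → Type*} [∀ i, CStarAlgebra (A i)] [∀ i, PartialOrder (A i)]
  [∀ i, StarOrderedRing (A i)] [∀ i, WStarAlgebra (A i)] {jB : ∀ i, B →⋆ₐ[ℂ] A i}
  {φ : ∀ i, A i →ₗ[ℂ] B} {M : Type*} [CStarAlgebra M] [PartialOrder M] [StarOrderedRing M]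
  [WStarAlgebra M] {jC : B →⋆ₐ[ℂ] M} {emb : ∀ i, A i →⋆ₐ[ℂ] M} {E : M →ₗ[ℂ] B}

namespace IsVNAmalgProd

variable (hM : IsVNAmalgProd B jB φ jC emb E) (hφ : ∀ i, IsCondExp (jB i) (φ i))
include hM hφ

lemma apply_emb_mul_mul_emb {i : I} {x : M} (hx : x ∈ wordSup (coeffs jC)
    (letters φ fun i => (emb i).toAlgHom.toLinearMap) (reducedListsBetween i)) (a a' : A i) :
    E (emb i a * x * emb i a') = 0 := by
  have hW := hM.isWordSystem hφ
  have ha : ∀ a, emb i a ∈ letters φ (fun i => (emb i).toAlgHom.toLinearMap) i ⊔ coeffs jC :=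
    fun a => hM.range_emb hφ i ▸ ⟨a, rfl⟩
  have hker : ∀ s : List I, s.IsChain (· ≠ ·) → s ≠ [] → hM.words s ≤ LinearMap.ker E :=
    fun s hs hne y hy => hM.apply_eq_zero hs hne hy
  refine (?_ : _ ≤ LinearMap.ker E) (Submodule.mul_mem_mul (Submodule.mul_mem_mul (ha a) hx) (ha a'))
  simp only [wordSup, Submodule.mul_iSup, Submodule.iSup_mul]
  refine iSup₂_le fun s hs => ?_
  have hs : (i :: (s ++ [i])).IsChain (· ≠ ·) := hs
  have hne : s ≠ [] := by
    rintro rfl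
    simp at hs
  rw [Submodule.sup_mul, ← wordSpan_cons, hW.base_mul, Submodule.sup_mul, Submodule.mul_sup,
    Submodule.mul_sup, hW.mul_base, hW.mul_base, ← hW.wordSpan_singleton, hW.mul_wordSpan,
    hW.mul_wordSpan]
  have h1 : (i :: s).IsChain (· ≠ ·) := List.IsChain.left_of_append (l₁ := i :: s) (l₂ := [i]) hs
  exact sup_le (sup_le (hker _ hs (by simp)) (hker _ h1 (by simp)))
    (sup_le (hker _ hs.tail (by simp)) (hker _ h1.tail hne))

/-- The normal conditional expectation of a free product onto one of its factors. -/
theorem exists_projection (hφn : ∀ i, IsNormalMap (φ i)) (hφf : ∀ i, FaithfulGNS (φ i)) (i : I) :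
    ∃ P : M →ₗ[ℂ] A i, IsNormalMap P ∧ IsCompletelyPositive P ∧ (∀ a, P (emb i a) = a) ∧
      ∀ x ∈ wordSup (coeffs jC) (letters φ fun i => (emb i).toAlgHom.toLinearMap)
        (reducedListsBetween i), ∀ a a', P (emb i a * x * emb i a') = 0 := by
  have hW := hM.isWordSystem hφ
  let Γ : Submodule ℂ (M × A i) :=
    { carrier := {p | ∀ a a', E (emb i a * p.1 * emb i a') = φ i (a * p.2 * a')}
      add_mem' := fun {p q} hp hq a a' => by
        simp only [Prod.fst_add, Prod.snd_add, mul_add, add_mul, map_add, hp a a', hq a a']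
      zero_mem' := by simp
      smul_mem' := fun c p hp a a' => by
        simp only [Prod.smul_fst, Prod.smul_snd, mul_smul_comm, smul_mul_assoc, map_smul, hp a a'] }
  have hΓ₁ : ∀ a, (emb i a, a) ∈ Γ := fun a b b' => by
    rw [← map_mul (emb i), ← map_mul (emb i), hM.restrict]
  have hΓ₂ : ∀ x ∈ wordSup (coeffs jC) (letters φ fun i => (emb i).toAlgHom.toLinearMap)
      (reducedListsBetween i), ∀ a a', (emb i a * x * emb i a', (0 : A i)) ∈ Γ := by
    intro x hx a a' b b'
    simp only [mul_zero, zero_mul, map_zero]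
    rw [← hM.apply_emb_mul_mul_emb hφ hx (b * a) (a' * b'), map_mul (emb i), map_mul (emb i)]
    simp only [mul_assoc]
  choose H i₁ i₂ i₃ ρ ξ hρ using fun f : {f : B →ₗ[ℂ] ℂ // IsNormalPosFunctional f} =>
    exists_isGNS ((hφ i).isPosFunctional_comp f.2) (comp_mem_normalDual (hφn i) f.2)
  let Λ : ∀ f, A i →ₗ[ℂ] H f := fun f =>
    (ContinuousLinearMap.apply ℂ (H f) (ξ f)).toLinearMap ∘ₗ (ρ f).toAlgHom.toLinearMap
  have hdense : @Dense M (sigmaWeak M) (Γ.map (LinearMap.fst ℂ M (A i))) := by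
    refine @Dense.mono M (sigmaWeak M) _ _ ?_ (hM.dense_wordSup hφ)
    refine SetLike.coe_subset_coe.mpr ((hW.wordSup_le_sup_sup_mul i).trans ?_)
    rw [← hM.range_emb hφ]
    refine sup_le ?_ ?_
    · rintro _ ⟨a, rfl⟩
      exact ⟨_, hΓ₁ a, rfl⟩
    · rw [Submodule.mul_le]
      rintro y hy _ ⟨a', rfl⟩
      induction hy using Submodule.mul_induction_on' with
      | add y₁ _ y₂ _ h1 h2 => rw [add_mul]; exact add_mem h1 h2
      | mem_mul_mem y hy x hx =>
        obtain ⟨a, rfl⟩ := hy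
        exact ⟨_, hΓ₂ x hx a a', rfl⟩
  have hΦ : ∀ f (s : Finset (H f)), (s : Set (H f)) ⊆ LinearMap.range (Λ f) →
      ∃ Φ : M →ₗ[ℂ] (H f →L[ℂ] H f), IsCPOp Φ ∧ IsNormalOp Φ ∧
        ∀ p ∈ Γ, ∀ h ∈ s, ∀ h' ∈ s, ⟪h, Φ p.1 h'⟫_ℂ = ⟪h, ρ f p.2 h'⟫_ℂ := by
    intro f s hs
    obtain ⟨Φ, hΦ, hΦn, hΦe⟩ := exists_isCPOp_of_inner (hM.condExp.isPosFunctional_comp f.2)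
      (comp_mem_normalDual hM.normal f.2) (fun a => Λ f a) (emb i) fun a b => by
        rw [← map_star, ← map_mul (emb i), f.1.comp_apply, hM.restrict]
        exact (hρ f).inner_apply a b
    refine ⟨Φ, hΦ, hΦn, fun p hp h hh h' hh' => ?_⟩
    obtain ⟨a, rfl⟩ := hs hh
    obtain ⟨a', rfl⟩ := hs hh'
    rw [hΦe, ← map_star, f.1.comp_apply, hp]
    change _ = ⟪ρ f a (ξ f), ρ f p.2 (ρ f a' (ξ f))⟫_ℂ
    rw [← ContinuousLinearMap.mul_apply, ← map_mul, (hρ f).inner_apply, mul_assoc]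
    rfl
  obtain ⟨P, hPn, hP, hPΓ⟩ := exists_normal_cp_extension hdense
    (by simpa only [map_one] using hΓ₁ 1) ρ (fun f => (hρ f).normal)
    (fun y hy => (hφf i).eq_zero_of_forall hρ hy) (fun f => LinearMap.range (Λ f))
    (fun f => (hρ f).dense) hΦ
  exact ⟨P, hPn, hP, fun a => hPΓ _ (hΓ₁ a), fun x hx a a' => hPΓ _ (hΓ₂ x hx a a')⟩

end IsVNAmalgProd

end Projection

lemma IsCompletelyPositive.starAlgHom_comp {A D N : Type*} [CStarAlgebra A] [CStarAlgebra D]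
    [CStarAlgebra N] [PartialOrder N] [StarOrderedRing N] {θ : A →ₗ[ℂ] D}
    (hθ : IsCompletelyPositive θ) (f : D →⋆ₐ[ℂ] N) :
    IsCompletelyPositive (f.toAlgHom.toLinearMap ∘ₗ θ) := by
  intro n a c
  obtain ⟨Q, hQ⟩ := exists_eq_sum_star_mul (P := fun i j => θ (star (a i) * a j)) fun c => hθ n a c
  have h1 : ∑ i, ∑ j, star (c i) * f (θ (star (a i) * a j)) * c j =
      ∑ k, star (∑ i, f (Q k i) * c i) * ∑ j, f (Q k j) * c j := by
    have h2 : ∀ i j, f (θ (star (a i) * a j)) = ∑ k, star (f (Q k i)) * f (Q k j) := fun i j => by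
      rw [hQ]
      simp only [map_sum, map_mul, map_star]
    have h3 : ∀ k, star (∑ i, f (Q k i) * c i) * ∑ j, f (Q k j) * c j =
        ∑ i, ∑ j, star (c i) * (star (f (Q k i)) * f (Q k j)) * c j := fun k => by
      rw [star_sum, Finset.sum_mul_sum]
      simp only [star_mul, mul_assoc]
    simp only [h2, h3, Finset.mul_sum, Finset.sum_mul]
    conv_rhs => rw [Finset.sum_comm]
    exact Finset.sum_congr rfl fun i _ => Finset.sum_comm
  obtain ⟨d, hd⟩ := CStarAlgebra.nonneg_iff_eq_star_mul_self.mp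
    (Finset.sum_nonneg fun k _ => star_mul_self_nonneg (∑ i, f (Q k i) * c i) :
      0 ≤ ∑ k, star (∑ i, f (Q k i) * c i) * ∑ j, f (Q k j) * c j)
  exact ⟨d, h1.trans hd⟩

section Pairs

variable {B : Type*} [CStarAlgebra B] [PartialOrder B] [StarOrderedRing B] [WStarAlgebra B]
  {I : Type*} {A D : I → Type*} [∀ i, CStarAlgebra (A i)] [∀ i, PartialOrder (A i)]
  [∀ i, StarOrderedRing (A i)] [∀ i, WStarAlgebra (A i)] [∀ i, CStarAlgebra (D i)]
  [∀ i, PartialOrder (D i)] [∀ i, StarOrderedRing (D i)] [∀ i, WStarAlgebra (D i)]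
  {jA : ∀ i, B →⋆ₐ[ℂ] A i} {jD : ∀ i, B →⋆ₐ[ℂ] D i}
  {φ : ∀ i, A i →ₗ[ℂ] B} {ψ : ∀ i, D i →ₗ[ℂ] B} {θi : ∀ i, A i →ₗ[ℂ] D i}
  {CA : Type*} [CStarAlgebra CA] [PartialOrder CA] [StarOrderedRing CA] [WStarAlgebra CA]
  {jCA : B →⋆ₐ[ℂ] CA} {embA : ∀ i, A i →⋆ₐ[ℂ] CA} {EA : CA →ₗ[ℂ] B}
  {CD : Type*} [CStarAlgebra CD] [PartialOrder CD] [StarOrderedRing CD] [WStarAlgebra CD]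
  {jCD : B →⋆ₐ[ℂ] CD} {embD : ∀ i, D i →⋆ₐ[ℂ] CD} {ED : CD →ₗ[ℂ] B}

/-- A family of unital completely positive bimodule maps intertwining conditional expectations. -/
structure IsUCPFamily (jA : ∀ i, B →⋆ₐ[ℂ] A i) (jD : ∀ i, B →⋆ₐ[ℂ] D i)
    (φ : ∀ i, A i →ₗ[ℂ] B) (ψ : ∀ i, D i →ₗ[ℂ] B) (θi : ∀ i, A i →ₗ[ℂ] D i) : Prop where
  cp (i : I) : IsCompletelyPositive (θi i)
  apply_one (i : I) : θi i 1 = 1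
  bimodule (i : I) (b₁ b₂ : B) (a : A i) :
    θi i (jA i b₁ * a * jA i b₂) = jD i b₁ * θi i a * jD i b₂
  compat (i : I) (a : A i) : ψ i (θi i a) = φ i a

lemma IsUCPFamily.apply_coeff (hθ : IsUCPFamily jA jD φ ψ θi) (i : I) (b : B) :
    θi i (jA i b) = jD i b := by
  have := hθ.bimodule i b 1 1
  simpa [hθ.apply_one] using this

/-- The graph of `θi i` inside the product of the two free products. -/
def pairEmb (embA : ∀ i, A i →⋆ₐ[ℂ] CA) (embD : ∀ i, D i →⋆ₐ[ℂ] CD) (θi : ∀ i, A i →ₗ[ℂ] D i)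
    (i : I) : A i →ₗ[ℂ] CA × CD :=
  (embA i).toAlgHom.toLinearMap.prod ((embD i).toAlgHom.toLinearMap ∘ₗ θi i)

/-- The span of the words in the letters `(a, θi i a)` with index lists in `S`. -/
def pairSup (φ : ∀ i, A i →ₗ[ℂ] B) (jCA : B →⋆ₐ[ℂ] CA) (jCD : B →⋆ₐ[ℂ] CD)
    (embA : ∀ i, A i →⋆ₐ[ℂ] CA) (embD : ∀ i, D i →⋆ₐ[ℂ] CD) (θi : ∀ i, A i →ₗ[ℂ] D i)
    (S : Set (List I)) : Submodule ℂ (CA × CD) :=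
  wordSup (coeffs (jCA.prod jCD)) (letters φ (pairEmb embA embD θi)) S

variable (hφ : ∀ i, IsCondExp (jA i) (φ i)) (hθ : IsUCPFamily jA jD φ ψ θi)
  (hA : IsVNAmalgProd B jA φ jCA embA EA) (hD : IsVNAmalgProd B jD ψ jCD embD ED)

include hθ hA hD in
lemma pairEmb_coeff (i : I) (b : B) : pairEmb embA embD θi i (jA i b) = jCA.prod jCD b := by
  refine Prod.ext (hA.emb_apply i b) ?_
  change embD i (θi i (jA i b)) = jCD b
  rw [hθ.apply_coeff, hD.emb_apply]

include hφ hθ hA hD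

lemma isWordSystem_pairs :
    IsWordSystem (coeffs (jCA.prod jCD)) (letters φ (pairEmb embA embD θi)) := by
  refine isWordSystem_letters hφ _ _ (fun i b₁ a b₂ => ?_) fun i a => ?_
  · refine Prod.ext ?_ ?_
    · change embA i _ = jCA b₁ * embA i a * jCA b₂
      rw [map_mul, map_mul, hA.emb_apply, hA.emb_apply]
    · change embD i (θi i _) = jCD b₁ * embD i (θi i a) * jCD b₂
      rw [hθ.bimodule, map_mul, map_mul, hD.emb_apply, hD.emb_apply]
  · refine Prod.ext (map_star (embA i) a) ?_
    change embD i (θi i (star a)) = star (embD i (θi i a))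
    rw [(hθ.cp i).apply_star, map_star]

lemma range_pairEmb (i : I) : LinearMap.range (pairEmb embA embD θi i) =
    letters φ (pairEmb embA embD θi) i ⊔ coeffs (jCA.prod jCD) :=
  range_eq_letters_sup_coeffs hφ _ _ (pairEmb_coeff hθ hA hD) i

omit hφ hθ hA hD in
lemma map_fst_pairSup (S : Set (List I)) :
    (pairSup φ jCA jCD embA embD θi S).map (LinearMap.fst ℂ CA CD) =
      wordSup (coeffs jCA) (letters φ fun i => (embA i).toAlgHom.toLinearMap) S := by
  have h1 := map_wordSup (AlgHom.fst ℂ CA CD) (coeffs (jCA.prod jCD))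
    (letters φ (pairEmb embA embD θi)) S
  refine h1.trans ?_
  congr 1
  · rw [coeffs, coeffs, ← LinearMap.range_comp]
    rfl
  · funext i
    rw [letters, letters, ← Submodule.map_comp]
    rfl

omit hφ hA in
lemma map_snd_wordSpan_le (s : List I) :
    (wordSpan (coeffs (jCA.prod jCD)) (letters φ (pairEmb embA embD θi)) s).map
      (LinearMap.snd ℂ CA CD) ≤ hD.words s := by
  have h1 := map_wordSpan (AlgHom.snd ℂ CA CD) (coeffs (jCA.prod jCD))
    (letters φ (pairEmb embA embD θi)) s
  refine h1.trans_le (wordSpan_mono ?_ (fun i => ?_) s)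
  · rw [coeffs, coeffs, ← LinearMap.range_comp]
    exact le_rfl
  · rw [letters, ← Submodule.map_comp]
    rintro _ ⟨a, ha, rfl⟩
    refine ⟨θi i a, ?_, rfl⟩
    have ha : φ i a = 0 := ha
    change ψ i (θi i a) = 0
    rw [hθ.compat, ha]

omit hφ in
lemma apply_fst_eq_apply_snd {p : CA × CD}
    (hp : p ∈ pairSup φ jCA jCD embA embD θi (reducedLists I)) : EA p.1 = ED p.2 := by
  suffices H : pairSup φ jCA jCD embA embD θi (reducedLists I) ≤
      LinearMap.eqLocus (EA ∘ₗ LinearMap.fst ℂ CA CD) (ED ∘ₗ LinearMap.snd ℂ CA CD) from H hp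
  refine wordSup_le fun s hs p hp => ?_
  change EA p.1 = ED p.2
  have h1 : p.1 ∈ wordSup (coeffs jCA) (letters φ fun i => (embA i).toAlgHom.toLinearMap) {s} := by
    have h1 : p ∈ pairSup φ jCA jCD embA embD θi {s} :=
      wordSpan_le_wordSup _ _ (Set.mem_singleton s) hp
    rw [← map_fst_pairSup (jCD := jCD) (embD := embD) (θi := θi)]
    exact Submodule.mem_map_of_mem (f := LinearMap.fst ℂ CA CD) h1
  have h2 : p.2 ∈ hD.words s := map_snd_wordSpan_le hθ hD s ⟨p, hp, rfl⟩
  rcases eq_or_ne s [] with rfl | hne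
  · rw [wordSpan_nil] at hp
    obtain ⟨b, rfl⟩ := hp
    exact (hA.condExp.left_inverse b).trans (hD.condExp.left_inverse b).symm
  · rw [hD.apply_eq_zero hs hne h2, hA.apply_eq_zero hs hne]
    simpa [wordSup] using h1

lemma pairEmb_mem_pairSup (i : I) (a : A i) :
    pairEmb embA embD θi i a ∈ pairSup φ jCA jCD embA embD θi (reducedLists I) := by
  have h := isWordSystem_pairs hφ hθ hA hD
  have h1 : pairEmb embA embD θi i a ∈ LinearMap.range (pairEmb embA embD θi i) := ⟨a, rfl⟩
  rw [range_pairEmb hφ hθ hA hD, ← h.wordSpan_singleton] at h1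
  refine sup_le (wordSpan_le_wordSup _ _ (List.isChain_singleton i)) ?_ h1
  exact (wordSpan_nil _ _).ge.trans (wordSpan_le_wordSup _ _ List.isChain_nil)

lemma pairEmb_mul_mem {i : I} (a : A i) {p : CA × CD}
    (hp : p ∈ pairSup φ jCA jCD embA embD θi (reducedListsAfter i)) :
    pairEmb embA embD θi i a * p ∈ pairSup φ jCA jCD embA embD θi (reducedLists I) :=
  (isWordSystem_pairs hφ hθ hA hD).sup_mul_wordSup_le i
    (Submodule.mul_mem_mul (range_pairEmb hφ hθ hA hD i ▸ ⟨a, rfl⟩) hp)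

lemma mul_pairEmb_mem {i : I} (a : A i) {p : CA × CD}
    (hp : p ∈ pairSup φ jCA jCD embA embD θi (reducedListsBetween i)) :
    p * pairEmb embA embD θi i a ∈ pairSup φ jCA jCD embA embD θi (reducedListsAfter i) :=
  (isWordSystem_pairs hφ hθ hA hD).wordSup_mul_sup_le i
    (Submodule.mul_mem_mul hp (range_pairEmb hφ hθ hA hD i ▸ ⟨a, rfl⟩))

lemma star_mem_pairSup_between {i : I} {p : CA × CD}
    (hp : p ∈ pairSup φ jCA jCD embA embD θi (reducedListsBetween i)) :
    star p ∈ pairSup φ jCA jCD embA embD θi (reducedListsAfter i) := by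
  refine (isWordSystem_pairs hφ hθ hA hD).star_mem_wordSup (fun s hs => ?_) hp
  have h1 := List.IsChain.reverse_ne hs
  simp only [List.reverse_cons, List.reverse_append, List.reverse_nil, List.nil_append,
    List.cons_append] at h1
  exact List.IsChain.left_of_append (l₁ := i :: s.reverse) h1

lemma star_mem_pairSup {p : CA × CD} (hp : p ∈ pairSup φ jCA jCD embA embD θi (reducedLists I)) :
    star p ∈ pairSup φ jCA jCD embA embD θi (reducedLists I) :=
  (isWordSystem_pairs hφ hθ hA hD).star_mem_wordSup (fun _ hs => List.IsChain.reverse_ne hs) hp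

lemma pairSup_le_span_mul (i : I) : pairSup φ jCA jCD embA embD θi (reducedLists I) ≤
    Submodule.span ℂ {q | ∃ a, ∃ p ∈ pairSup φ jCA jCD embA embD θi (reducedListsAfter i),
      q = pairEmb embA embD θi i a * p} := by
  refine ((isWordSystem_pairs hφ hθ hA hD).wordSup_le_sup_mul i).trans ?_
  rw [← range_pairEmb hφ hθ hA hD, Submodule.mul_le]
  rintro _ ⟨a, rfl⟩ p hp
  exact Submodule.subset_span ⟨a, p, hp, rfl⟩

lemma pairSup_le_span_mul_mul (i : I) : pairSup φ jCA jCD embA embD θi (reducedLists I) ≤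
    Submodule.span ℂ ({q | ∃ a, q = pairEmb embA embD θi i a} ∪
      {q | ∃ a, ∃ p ∈ pairSup φ jCA jCD embA embD θi (reducedListsBetween i), ∃ a',
        q = pairEmb embA embD θi i a * p * pairEmb embA embD θi i a'}) := by
  refine ((isWordSystem_pairs hφ hθ hA hD).wordSup_le_sup_sup_mul i).trans ?_
  rw [← range_pairEmb hφ hθ hA hD]
  refine sup_le ?_ ?_
  · rintro _ ⟨a, rfl⟩
    exact Submodule.subset_span (Or.inl ⟨a, rfl⟩)
  · rw [Submodule.mul_le]
    rintro x hx _ ⟨a', rfl⟩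
    induction hx using Submodule.mul_induction_on' with
    | add x _ y _ h1 h2 => rw [add_mul]; exact add_mem h1 h2
    | mem_mul_mem x hx p hp =>
      obtain ⟨a, rfl⟩ := hx
      exact Submodule.subset_span (Or.inr ⟨a, p, hp, a', rfl⟩)

end Pairs

section Hilbert

variable {K : Type*} [NormedAddCommGroup K] [InnerProductSpace ℂ K]

lemma inner_eq_zero_of_mem_topologicalClosure (T : K →L[ℂ] K) {X Y : Submodule ℂ K}
    (h : ∀ x ∈ X, ∀ y ∈ Y, ⟪x, T y⟫_ℂ = 0) {x y : K} (hx : x ∈ X.topologicalClosure)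
    (hy : y ∈ Y.topologicalClosure) : ⟪x, T y⟫_ℂ = 0 := by
  have h1 : Y ≤ Xᗮ.comap T.toLinearMap := fun y hy x hx => h x hx y hy
  have h2 : Y.topologicalClosure ≤ Xᗮ.comap T.toLinearMap :=
    Submodule.topologicalClosure_minimal _ h1 (X.isClosed_orthogonal.preimage T.continuous)
  have h3 : T y ∈ X.topologicalClosureᗮ := by
    rw [Submodule.orthogonal_closure]
    exact h2 hy
  exact h3 x hx

lemma Submodule.IsOrtho.isClosed_sup {U V : Submodule ℂ K} [U.HasOrthogonalProjection]
    [V.HasOrthogonalProjection] (h : U ⟂ V) : IsClosed ((U ⊔ V : Submodule ℂ K) : Set K) := by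
  have h1 : ((U ⊔ V : Submodule ℂ K) : Set K) =
      {v | U.starProjection v + V.starProjection v = v} := by
    ext v
    constructor
    · intro hv
      obtain ⟨u, hu, w, hw, rfl⟩ := Submodule.mem_sup.mp hv
      have hu' : V.starProjection u = 0 :=
        (Submodule.starProjection_apply_eq_zero_iff V).mpr fun x hx => h.symm.inner_eq hx hu
      have hw' : U.starProjection w = 0 :=
        (Submodule.starProjection_apply_eq_zero_iff U).mpr fun x hx => h.inner_eq hx hw
      simp [hu', hw', Submodule.starProjection_eq_self_iff.mpr hu,
        Submodule.starProjection_eq_self_iff.mpr hw]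
    · intro hv
      rw [← Set.mem_setOf_eq.mp hv]
      exact Submodule.add_mem_sup (U.starProjection_apply_mem v) (V.starProjection_apply_mem v)
  rw [h1]
  exact isClosed_eq (by fun_prop) continuous_id

end Hilbert

section WordSpace

variable {M : Type*} [CStarAlgebra M]
  {K : Type*} [NormedAddCommGroup K] [InnerProductSpace ℂ K] [CompleteSpace K]

/-- The orbit map of a vector under a representation. -/
def orbit (ρ : M →⋆ₐ[ℂ] (K →L[ℂ] K)) (ξ : K) : M →ₗ[ℂ] K :=
  (ContinuousLinearMap.apply ℂ K ξ).toLinearMap ∘ₗ ρ.toAlgHom.toLinearMap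

lemma orbit_apply (ρ : M →⋆ₐ[ℂ] (K →L[ℂ] K)) (ξ : K) (x : M) : orbit ρ ξ x = ρ x ξ := rfl

lemma rep_orbit (ρ : M →⋆ₐ[ℂ] (K →L[ℂ] K)) (ξ : K) (x y : M) :
    ρ x (orbit ρ ξ y) = orbit ρ ξ (x * y) := by
  rw [orbit_apply, orbit_apply, map_mul, ContinuousLinearMap.mul_apply]

/-- The closure of the orbit of a vector under a subspace. -/
def orbitClosure (ρ : M →⋆ₐ[ℂ] (K →L[ℂ] K)) (ξ : K) (W : Submodule ℂ M) : Submodule ℂ K :=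
  (W.map (orbit ρ ξ)).topologicalClosure

instance (ρ : M →⋆ₐ[ℂ] (K →L[ℂ] K)) (ξ : K) (W : Submodule ℂ M) :
    (orbitClosure ρ ξ W).HasOrthogonalProjection :=
  haveI : CompleteSpace (orbitClosure ρ ξ W) :=
    (W.map (orbit ρ ξ)).isClosed_topologicalClosure.completeSpace_coe
  inferInstance

lemma IsGNS.inner_eq_zero [PartialOrder M] [StarOrderedRing M] [WStarAlgebra M]
    {g : M →ₗ[ℂ] ℂ} {ρ : M →⋆ₐ[ℂ] (K →L[ℂ] K)} {ξ : K}
    (hρ : IsGNS g ρ ξ) {W W' : Submodule ℂ M} {a : M}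
    (h : ∀ x ∈ W, ∀ y ∈ W', g (star x * (a * y)) = 0) {k k' : K} (hk : k ∈ orbitClosure ρ ξ W)
    (hk' : k' ∈ orbitClosure ρ ξ W') : ⟪k, ρ a k'⟫_ℂ = 0 := by
  refine inner_eq_zero_of_mem_topologicalClosure (ρ a) ?_ hk hk'
  rintro _ ⟨x, hx, rfl⟩ _ ⟨y, hy, rfl⟩
  rw [rep_orbit, orbit_apply, orbit_apply, hρ.inner_apply, h x hx y hy]

end WordSpace

section FreeProduct

variable {B : Type*} [CStarAlgebra B] [PartialOrder B] [StarOrderedRing B] [WStarAlgebra B]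
  {I : Type*} {A : I → Type*} [∀ i, CStarAlgebra (A i)] [∀ i, PartialOrder (A i)]
  [∀ i, StarOrderedRing (A i)] [∀ i, WStarAlgebra (A i)] {jB : ∀ i, B →⋆ₐ[ℂ] A i}
  {φ : ∀ i, A i →ₗ[ℂ] B} {M : Type*} [CStarAlgebra M] [PartialOrder M] [StarOrderedRing M]
  [WStarAlgebra M] {jC : B →⋆ₐ[ℂ] M} {emb : ∀ i, A i →⋆ₐ[ℂ] M} {E : M →ₗ[ℂ] B}
  {K : Type*} [NormedAddCommGroup K] [InnerProductSpace ℂ K] [CompleteSpace K]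
  {f : B →ₗ[ℂ] ℂ} {ρ : M →⋆ₐ[ℂ] (K →L[ℂ] K)} {ξ : K}

namespace IsVNAmalgProd

/-- The closed subspace of the GNS space spanned by the words with index list `r`. -/
def wordSpace (hM : IsVNAmalgProd B jB φ jC emb E) (ρ : M →⋆ₐ[ℂ] (K →L[ℂ] K)) (ξ : K)
    (r : List I) : Submodule ℂ K := orbitClosure ρ ξ (hM.words r)

instance (hM : IsVNAmalgProd B jB φ jC emb E) (ρ : M →⋆ₐ[ℂ] (K →L[ℂ] K)) (ξ : K)
    (r : List I) : (hM.wordSpace ρ ξ r).HasOrthogonalProjection :=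
  inferInstanceAs (orbitClosure ρ ξ (hM.words r)).HasOrthogonalProjection

variable (hM : IsVNAmalgProd B jB φ jC emb E) (hφ : ∀ i, IsCondExp (jB i) (φ i))
  (hρ : IsGNS (f ∘ₗ E) ρ ξ)
include hφ hρ

lemma inner_eq_zero_of_disjoint {u r s : List I} (hu : u.IsChain (· ≠ ·))
    (hr : r.IsChain (· ≠ ·)) (hs : s.IsChain (· ≠ ·))
    (hsu : ∀ w : List I, w <:+ r ∨ (u ≠ [] ∧ w.head? = u.head?) → s ≠ w) {a : M}
    (ha : a ∈ hM.words u) {k h : K} (hk : k ∈ hM.wordSpace ρ ξ s) (hh : h ∈ hM.wordSpace ρ ξ r) :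
    ⟪k, ρ a h⟫_ℂ = 0 := by
  refine hρ.inner_eq_zero (fun x hx y hy => ?_) hk hh
  have hL : ∀ i, letters φ (fun i => (emb i).toAlgHom.toLinearMap) i *
      letters φ (fun i => (emb i).toAlgHom.toLinearMap) i ≤
      letters φ (fun i => (emb i).toAlgHom.toLinearMap) i ⊔ coeffs jC :=
    hM.letter_mul_letter_le hφ
  have h1 := (hM.isWordSystem hφ).mul_le_iSup hL hu hr (Submodule.mul_mem_mul ha hy)
  suffices H : (⨆ w ∈ {w : List I | w.IsChain (· ≠ ·) ∧
      (w <:+ r ∨ (u ≠ [] ∧ w.head? = u.head?))}, hM.words w) ≤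
      LinearMap.ker (f ∘ₗ E ∘ₗ LinearMap.mulLeft ℂ (star x)) from H h1
  refine iSup₂_le fun w hw z hz => ?_
  change f (E (star x * z)) = 0
  rw [hM.apply_star_mul hφ hs hw.1 (hsu w hw.2) hx hz, map_zero]

lemma isOrtho_wordSpace {s t : List I} (hs : s.IsChain (· ≠ ·)) (ht : t.IsChain (· ≠ ·))
    (hst : s ≠ t) : hM.wordSpace ρ ξ s ⟂ hM.wordSpace ρ ξ t := by
  rw [Submodule.isOrtho_iff_inner_eq]
  intro k hk h hh
  have h1 : ∀ x ∈ hM.words s, ∀ y ∈ hM.words t, (f ∘ₗ E) (star x * (1 * y)) = 0 :=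
    fun x hx y hy => by
      rw [one_mul, LinearMap.comp_apply, hM.apply_star_mul hφ hs ht hst hx hy, map_zero]
  simpa using hρ.inner_eq_zero h1 hk hh

lemma inner_eq_zero_of_between {i : I} {t u : List I} (hs : (i :: t).IsChain (· ≠ ·))
    (hu : u ∈ reducedListsBetween i) {a : M} (ha : a ∈ hM.words u) {k h : K}
    (hk : k ∈ hM.wordSpace ρ ξ (i :: t)) (hh : h ∈ hM.wordSpace ρ ξ (i :: t)) :
    ⟪k, ρ a h⟫_ℂ = 0 := by
  refine hρ.inner_eq_zero (fun x hx y hy => ?_) hk hh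
  have hu : (i :: (u ++ [i])).IsChain (· ≠ ·) := hu
  have hne : u ≠ [] := by
    rintro rfl
    simp at hu
  have h2 : (u ++ [i] ++ t).IsChain (· ≠ ·) := hu.tail.append_overlap hs (by simp)
  rw [LinearMap.comp_apply, hM.apply_star_mul hφ hs (t := u ++ (i :: t)) (by simpa using h2) ?_ hx
    ((hM.isWordSystem hφ).mul_mem ha hy), map_zero]
  intro h
  have := congrArg List.length h
  rw [List.length_append, eq_comm, add_eq_right, List.length_eq_zero_iff] at this
  exact hne this

lemma rep_emb_mem_sup {i : I} {t : List I} (hs : (i :: t).IsChain (· ≠ ·)) (a : A i) {h : K}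
    (hh : h ∈ hM.wordSpace ρ ξ (i :: t) ⊔ hM.wordSpace ρ ξ t) :
    ρ (emb i a) h ∈ hM.wordSpace ρ ξ (i :: t) ⊔ hM.wordSpace ρ ξ t := by
  have hW := hM.isWordSystem hφ
  have hcl := (hM.isOrtho_wordSpace hφ hρ hs hs.tail
    (fun h => List.cons_ne_self i t h)).isClosed_sup
  have ha : emb i a ∈ letters φ (fun i => (emb i).toAlgHom.toLinearMap) i ⊔ coeffs jC :=
    hM.range_emb hφ i ▸ ⟨a, rfl⟩
  have h1 : ∀ r, (∀ y ∈ hM.words r, emb i a * y ∈ hM.words (i :: t) ⊔ hM.words t) →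
      hM.wordSpace ρ ξ r ≤ (hM.wordSpace ρ ξ (i :: t) ⊔ hM.wordSpace ρ ξ t).comap
        (ρ (emb i a)).toLinearMap := by
    intro r hr
    refine Submodule.topologicalClosure_minimal _ ?_ (hcl.preimage (ρ (emb i a)).continuous)
    rintro _ ⟨y, hy, rfl⟩
    change ρ (emb i a) (orbit ρ ξ y) ∈ hM.wordSpace ρ ξ (i :: t) ⊔ hM.wordSpace ρ ξ t
    rw [rep_orbit]
    have h2 := Submodule.mem_map_of_mem (f := orbit ρ ξ) (hr y hy)
    rw [Submodule.map_sup] at h2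
    have h3 : ∀ r, (hM.words r).map (orbit ρ ξ) ≤ hM.wordSpace ρ ξ r :=
      fun r => Submodule.le_topologicalClosure _
    exact (sup_le_sup (h3 _) (h3 _) :
      _ ≤ hM.wordSpace ρ ξ (i :: t) ⊔ hM.wordSpace ρ ξ t) h2
  refine (sup_le (h1 _ fun y hy => ?_) (h1 _ fun y hy => ?_) :
    _ ≤ (hM.wordSpace ρ ξ (i :: t) ⊔ hM.wordSpace ρ ξ t).comap (ρ (emb i a)).toLinearMap) hh
  · refine (?_ : _ ≤ hM.words (i :: t) ⊔ hM.words t) (Submodule.mul_mem_mul ha hy)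
    rw [Submodule.sup_mul, hW.base_mul]
    exact sup_le (hW.letter_mul_le (hM.letter_mul_letter_le hφ) i t) le_sup_left
  · refine (?_ : _ ≤ hM.words (i :: t) ⊔ hM.words t) (Submodule.mul_mem_mul ha hy)
    rw [Submodule.sup_mul, hW.base_mul, words, wordSpan_cons]

end IsVNAmalgProd

end FreeProduct

lemma List.mem_of_suffix_of_tail_mem {I : Type*} {T : Finset (List I)} (hT : ∀ r ∈ T, r.tail ∈ T)
    {w r : List I} (hw : w <:+ r) (hr : r ∈ T) : w ∈ T := by
  induction r with
  | nil => rwa [List.suffix_nil.mp hw]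
  | cons i r ih =>
    rcases List.suffix_cons_iff.mp hw with rfl | hw
    · exact hr
    · exact ih hw (hT _ hr)

section Induction

variable {B : Type*} [CStarAlgebra B] [PartialOrder B] [StarOrderedRing B] [WStarAlgebra B]
  {I : Type*} {A D : I → Type*} [∀ i, CStarAlgebra (A i)] [∀ i, PartialOrder (A i)]
  [∀ i, StarOrderedRing (A i)] [∀ i, WStarAlgebra (A i)] [∀ i, CStarAlgebra (D i)]
  [∀ i, PartialOrder (D i)] [∀ i, StarOrderedRing (D i)] [∀ i, WStarAlgebra (D i)]
  {jA : ∀ i, B →⋆ₐ[ℂ] A i} {jD : ∀ i, B →⋆ₐ[ℂ] D i}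
  {φ : ∀ i, A i →ₗ[ℂ] B} {ψ : ∀ i, D i →ₗ[ℂ] B} {θi : ∀ i, A i →ₗ[ℂ] D i}
  {CA : Type*} [CStarAlgebra CA] [PartialOrder CA] [StarOrderedRing CA] [WStarAlgebra CA]
  {jCA : B →⋆ₐ[ℂ] CA} {embA : ∀ i, A i →⋆ₐ[ℂ] CA} {EA : CA →ₗ[ℂ] B}
  {CD : Type*} [CStarAlgebra CD] [PartialOrder CD] [StarOrderedRing CD] [WStarAlgebra CD]
  {jCD : B →⋆ₐ[ℂ] CD} {embD : ∀ i, D i →⋆ₐ[ℂ] CD} {ED : CD →ₗ[ℂ] B}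
  {K : Type*} [NormedAddCommGroup K] [InnerProductSpace ℂ K] [CompleteSpace K]
  {f : B →ₗ[ℂ] ℂ} {ρ : CD →⋆ₐ[ℂ] (K →L[ℂ] K)} {ξ : K}

lemma inner_rep_snd_eq_zero (hθ : IsUCPFamily jA jD φ ψ θi)
    (hD : IsVNAmalgProd B jD ψ jCD embD ED) {S : Set (List I)} {k h : K}
    (H : ∀ u ∈ S, ∀ a ∈ hD.words u, ⟪k, ρ a h⟫_ℂ = 0) {p : CA × CD}
    (hp : p ∈ pairSup φ jCA jCD embA embD θi S) : ⟪k, ρ p.2 h⟫_ℂ = 0 := by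
  suffices H' : pairSup φ jCA jCD embA embD θi S ≤
      LinearMap.ker (innerₛₗ ℂ k ∘ₗ orbit ρ h ∘ₗ LinearMap.snd ℂ CA CD) from H' hp
  refine wordSup_le fun u hu q hq => ?_
  exact H u hu q.2 (map_snd_wordSpan_le hθ hD u (Submodule.mem_map_of_mem hq))

variable (hφ : ∀ i, IsCondExp (jA i) (φ i)) (hψ : ∀ i, IsCondExp (jD i) (ψ i))
  (hθ : IsUCPFamily jA jD φ ψ θi)
  (hA : IsVNAmalgProd B jA φ jCA embA EA) (hD : IsVNAmalgProd B jD ψ jCD embD ED)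
  (hf : IsNormalPosFunctional f) (hρ : IsGNS (f ∘ₗ ED) ρ ξ)
include hθ hA hD hf hρ

lemma exists_isCPOp_nil : ∃ Φ : CA →ₗ[ℂ] (K →L[ℂ] K), IsCPOp Φ ∧ IsNormalOp Φ ∧
    ∀ p ∈ pairSup φ jCA jCD embA embD θi (reducedLists I),
      ∀ h ∈ hD.wordSpace ρ ξ [], ∀ h' ∈ hD.wordSpace ρ ξ [],
        ⟪h, Φ p.1 h'⟫_ℂ = ⟪h, ρ p.2 h'⟫_ℂ := by
  have hEA : ∀ x a y, EA (star (jCA x) * a * jCA y) = star x * EA a * y := fun x a y => by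
    rw [← map_star, hA.condExp.bimodule]
  have hED : ∀ x a y, ED (star (jCD x) * a * jCD y) = star x * ED a * y := fun x a y => by
    rw [← map_star, hD.condExp.bimodule]
  obtain ⟨Φ, hΦ, hΦn, hΦe⟩ := exists_isCPOp_of_inner (hA.condExp.isPosFunctional_comp hf)
    (comp_mem_normalDual hA.normal hf) (fun b => orbit ρ ξ (jCD b)) jCA fun x y => by
      have h1 := hEA x 1 y
      have h2 := hED x 1 y
      rw [mul_one, hA.condExp.apply_one] at h1
      rw [mul_one, hD.condExp.apply_one] at h2
      rw [orbit_apply, orbit_apply, hρ.inner_apply, LinearMap.comp_apply, LinearMap.comp_apply,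
        h1, h2]
  refine ⟨Φ, hΦ, hΦn, fun p hp h hh h' hh' => ?_⟩
  rw [← sub_eq_zero, ← inner_sub_right, ← ContinuousLinearMap.sub_apply]
  refine inner_eq_zero_of_mem_topologicalClosure _ ?_ hh hh'
  rintro _ ⟨_, hx, rfl⟩ _ ⟨_, hy, rfl⟩
  rw [SetLike.mem_coe, IsVNAmalgProd.words, wordSpan_nil] at hx hy
  obtain ⟨x, rfl⟩ := hx
  obtain ⟨y, rfl⟩ := hy
  change ⟪orbit ρ ξ (jCD x), (Φ p.1 - ρ p.2) (orbit ρ ξ (jCD y))⟫_ℂ = 0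
  rw [ContinuousLinearMap.sub_apply, inner_sub_right, hΦe, rep_orbit, orbit_apply, orbit_apply,
    hρ.inner_apply, ← mul_assoc, LinearMap.comp_apply, LinearMap.comp_apply, hEA, hED,
    apply_fst_eq_apply_snd hθ hA hD hp, sub_self]

variable (hφn : ∀ i, IsNormalMap (φ i)) (hφf : ∀ i, FaithfulGNS (φ i))
  (hθn : ∀ i, IsNormalMap (θi i))
include hφ hψ hφn hφf hθn

theorem exists_isCPOp_finset (T : Finset (List I)) (hT : ∀ r ∈ T, r.IsChain (· ≠ ·))
    (hTt : ∀ r ∈ T, r.tail ∈ T) : ∃ Φ : CA →ₗ[ℂ] (K →L[ℂ] K), IsCPOp Φ ∧ IsNormalOp Φ ∧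
      ∀ p ∈ pairSup φ jCA jCD embA embD θi (reducedLists I),
        ∀ h ∈ ⨆ r ∈ T, hD.wordSpace ρ ξ r, ∀ h' ∈ ⨆ r ∈ T, hD.wordSpace ρ ξ r,
          ⟪h, Φ p.1 h'⟫_ℂ = ⟪h, ρ p.2 h'⟫_ℂ := by
  classical
  induction T using Finset.strongInduction with
  | H T ih =>
  by_cases hTn : ∀ r ∈ T, r = []
  · obtain ⟨Φ, hΦ, hΦn, hΦe⟩ := exists_isCPOp_nil (θi := θi) hθ hA hD hf hρ
    have h1 : (⨆ r ∈ T, hD.wordSpace ρ ξ r) ≤ hD.wordSpace ρ ξ [] :=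
      iSup₂_le fun r hr => (hTn r hr) ▸ le_rfl
    exact ⟨Φ, hΦ, hΦn, fun p hp h hh h' hh' => hΦe p hp h (h1 hh) h' (h1 hh')⟩
  push Not at hTn
  obtain ⟨r₀, hr₀, hr₀n⟩ := hTn
  obtain ⟨s, hs, hmax⟩ := T.exists_max_image List.length ⟨r₀, hr₀⟩
  obtain ⟨i, t, rfl⟩ : ∃ i t, s = i :: t := by
    refine List.exists_cons_of_ne_nil ?_
    rintro rfl
    exact hr₀n (List.length_eq_zero_iff.mp (Nat.le_zero.mp (hmax r₀ hr₀)))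
  have hTt' : ∀ r ∈ T.erase (i :: t), r.tail ∈ T.erase (i :: t) := fun r hr => by
    have hr := Finset.mem_of_mem_erase hr
    refine Finset.mem_erase.mpr ⟨fun h => ?_, hTt r hr⟩
    have h1 := congrArg List.length h
    have h2 := hmax r hr
    simp only [List.length_tail, List.length_cons] at h1 h2
    omega
  have ht : t ∈ T.erase (i :: t) :=
    Finset.mem_erase.mpr ⟨(List.cons_ne_self i t).symm, hTt _ hs⟩
  obtain ⟨Φ, hΦ, hΦn, hΦe⟩ := ih _ (Finset.erase_ssubset hs)
    (fun r hr => hT r (Finset.mem_of_mem_erase hr)) hTt'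
  obtain ⟨P, hPn, hP, hPe, hPb⟩ := hA.exists_projection hφ hφn hφf i
  have hsc := hT _ hs
  have hsup : (⨆ r ∈ T, hD.wordSpace ρ ξ r) =
      (⨆ r ∈ T.erase (i :: t), hD.wordSpace ρ ξ r) ⊔ hD.wordSpace ρ ξ (i :: t) := by
    conv_lhs => rw [← Finset.insert_erase hs]
    rw [Finset.iSup_insert, sup_comm]
  rw [hsup]
  refine exists_isCPOp_sup (embA i) ((embD i).toAlgHom.toLinearMap ∘ₗ θi i)
    ((hθ.cp i).starAlgHom_comp (embD i)) ?_ ?_ P hP hPn hPe ρ hρ.normal _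
    (hD.wordSpace ρ ξ t) _ ?_ ?_ ?_ _ (pairSup φ jCA jCD embA embD θi (reducedListsAfter i))
    (pairSup φ jCA jCD embA embD θi (reducedListsBetween i)) ?_
    (fun a p hp => pairEmb_mul_mem hφ hθ hA hD a hp)
    (fun a p hp => mul_pairEmb_mem hφ hθ hA hD a hp)
    (fun p hp => star_mem_pairSup_between hφ hθ hA hD hp) ?_ ?_
    (pairSup_le_span_mul hφ hθ hA hD i) (pairSup_le_span_mul_mul hφ hθ hA hD i)
    (fun p hp => star_mem_pairSup hφ hθ hA hD hp)
    (fun a => pairEmb_mem_pairSup hφ hθ hA hD i a) hΦ hΦn hΦe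
  · exact @Continuous.comp _ _ _ (sigmaWeak (A i)) (sigmaWeak (D i)) (sigmaWeak CD) _ _
      (hD.emb_normal i) (hθn i)
  · change embD i (θi i 1) = 1
    rw [hθ.apply_one, map_one]
  · exact le_iSup₂_of_le t ht le_rfl
  · simp only [Submodule.isOrtho_iSup_right]
    intro r hr
    exact hD.isOrtho_wordSpace hψ hρ hsc (hT r (Finset.mem_of_mem_erase hr))
      (Finset.ne_of_mem_erase hr).symm
  · exact fun a h hh => hD.rep_emb_mem_sup hψ hρ hsc _ hh
  · intro k hk p hp h hh
    suffices H : (⨆ r ∈ T.erase (i :: t), hD.wordSpace ρ ξ r) ≤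
        LinearMap.ker (innerₛₗ ℂ k ∘ₗ (ρ p.2).toLinearMap) from H hh
    refine iSup₂_le fun r hr h hh => ?_
    refine inner_rep_snd_eq_zero hθ hD (fun u hu a ha => ?_) hp
    have hu : (i :: u).IsChain (· ≠ ·) := hu
    refine hD.inner_eq_zero_of_disjoint hψ hρ (u := u) hu.tail (hT r (Finset.mem_of_mem_erase hr)) hsc ?_
      ha hk hh
    rintro w (hw | ⟨hne, hw⟩) rfl
    · exact Finset.notMem_erase _ _ (List.mem_of_suffix_of_tail_mem hTt' hw hr)
    · cases u with
      | nil => exact hne rfl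
      | cons l u =>
        simp only [List.head?_cons, Option.some.injEq] at hw
        exact (List.isChain_cons_cons.mp hu).1 hw
  · exact fun p hp k hk k' hk' => inner_rep_snd_eq_zero hθ hD
      (fun u hu a ha => hD.inner_eq_zero_of_between hψ hρ hsc hu ha hk hk') hp
  · refine fun p hp a a' => hPb p.1 ?_ a a'
    rw [← map_fst_pairSup (jCD := jCD) (embD := embD) (θi := θi)]
    exact Submodule.mem_map_of_mem (f := LinearMap.fst ℂ CA CD) hp

end Induction

section FiniteSupport

variable {I : Type*} {K : Type*} [NormedAddCommGroup K] [InnerProductSpace ℂ K]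

lemma exists_finset_mem_iSup (V : List I → Submodule ℂ K) {h : K}
    (hh : h ∈ ⨆ r ∈ reducedLists I, V r) : ∃ T : Finset (List I),
      (∀ r ∈ T, r.IsChain (· ≠ ·)) ∧ (∀ r ∈ T, r.tail ∈ T) ∧ h ∈ ⨆ r ∈ T, V r := by
  classical
  have hadd : ∀ x y : K, (∃ T : Finset (List I), (∀ r ∈ T, r.IsChain (· ≠ ·)) ∧
      (∀ r ∈ T, r.tail ∈ T) ∧ x ∈ ⨆ r ∈ T, V r) → (∃ T : Finset (List I),
      (∀ r ∈ T, r.IsChain (· ≠ ·)) ∧ (∀ r ∈ T, r.tail ∈ T) ∧ y ∈ ⨆ r ∈ T, V r) →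
      ∃ T : Finset (List I), (∀ r ∈ T, r.IsChain (· ≠ ·)) ∧
      (∀ r ∈ T, r.tail ∈ T) ∧ x + y ∈ ⨆ r ∈ T, V r := by
    rintro x y ⟨T, h1, h2, h3⟩ ⟨T', h1', h2', h3'⟩
    refine ⟨T ∪ T', fun r hr => ?_, fun r hr => ?_, ?_⟩
    · exact (Finset.mem_union.mp hr).elim (h1 r) (h1' r)
    · exact (Finset.mem_union.mp hr).elim (fun hr => Finset.mem_union_left _ (h2 r hr))
        fun hr => Finset.mem_union_right _ (h2' r hr)
    · rw [Finset.iSup_union]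
      exact Submodule.add_mem_sup h3 h3'
  have hzero : ∃ T : Finset (List I), (∀ r ∈ T, r.IsChain (· ≠ ·)) ∧
      (∀ r ∈ T, r.tail ∈ T) ∧ (0 : K) ∈ ⨆ r ∈ T, V r :=
    ⟨∅, by simp, by simp, Submodule.zero_mem _⟩
  induction hh using Submodule.iSup_induction' with
  | zero => exact hzero
  | add x y _ _ hx hy => exact hadd x y hx hy
  | mem s x hx =>
    induction hx using Submodule.iSup_induction' with
    | zero => exact hzero
    | add x y _ _ hx hy => exact hadd x y hx hy
    | mem hs x hx =>
      have hs : s.IsChain (· ≠ ·) := hs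
      refine ⟨s.tails.toFinset, fun r hr => ?_, fun r hr => ?_,
        (le_iSup₂_of_le s (by simp) le_rfl : V s ≤ _) hx⟩
      · rw [List.mem_toFinset, List.mem_tails] at hr
        exact hs.suffix hr
      · rw [List.mem_toFinset, List.mem_tails] at hr ⊢
        exact (List.tail_suffix r).trans hr

lemma exists_finset_subset_iSup (V : List I → Submodule ℂ K) (s : Finset K)
    (hs : (s : Set K) ⊆ (⨆ r ∈ reducedLists I, V r : Submodule ℂ K)) : ∃ T : Finset (List I),
      (∀ r ∈ T, r.IsChain (· ≠ ·)) ∧ (∀ r ∈ T, r.tail ∈ T) ∧ ∀ h ∈ s, h ∈ ⨆ r ∈ T, V r := by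
  classical
  choose! T hT hTt hTm using fun h (hh : h ∈ s) => exists_finset_mem_iSup V (hs hh)
  refine ⟨s.biUnion T, fun r hr => ?_, fun r hr => ?_, fun h hh => ?_⟩
  · obtain ⟨h, hh, hr⟩ := Finset.mem_biUnion.mp hr
    exact hT h hh r hr
  · obtain ⟨h, hh, hr⟩ := Finset.mem_biUnion.mp hr
    exact Finset.mem_biUnion.mpr ⟨h, hh, hTt h hh r hr⟩
  · exact (biSup_mono fun r hr => Finset.mem_biUnion.mpr ⟨h, hh, hr⟩ :
      (⨆ r ∈ T h, V r) ≤ ⨆ r ∈ s.biUnion T, V r) (hTm h hh)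

end FiniteSupport

section FreeProduct

variable {B : Type*} [CStarAlgebra B] [PartialOrder B] [StarOrderedRing B] [WStarAlgebra B]
  {I : Type*} {A : I → Type*} [∀ i, CStarAlgebra (A i)] [∀ i, PartialOrder (A i)]
  [∀ i, StarOrderedRing (A i)] [∀ i, WStarAlgebra (A i)] {jB : ∀ i, B →⋆ₐ[ℂ] A i}
  {φ : ∀ i, A i →ₗ[ℂ] B} {M : Type*} [CStarAlgebra M] [PartialOrder M] [StarOrderedRing M]
  [WStarAlgebra M] {jC : B →⋆ₐ[ℂ] M} {emb : ∀ i, A i →⋆ₐ[ℂ] M} {E : M →ₗ[ℂ] B}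
  {K : Type*} [NormedAddCommGroup K] [InnerProductSpace ℂ K] [CompleteSpace K]
  {g : M →ₗ[ℂ] ℂ} {ρ : M →⋆ₐ[ℂ] (K →L[ℂ] K)} {ξ : K}

lemma IsVNAmalgProd.dense_iSup_wordSpace (hM : IsVNAmalgProd B jB φ jC emb E)
    (hφ : ∀ i, IsCondExp (jB i) (φ i)) (hρ : IsGNS g ρ ξ) :
    Dense ((⨆ r ∈ reducedLists I, hM.wordSpace ρ ξ r : Submodule ℂ K) : Set K) := by
  rw [Submodule.dense_iff_topologicalClosure_eq_top, Submodule.topologicalClosure_eq_top_iff,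
    Submodule.eq_bot_iff]
  intro η hη
  obtain ⟨f, hf, hfe⟩ := hρ.normal η ξ
  have h0 : ∀ x ∈ wordSup (coeffs jC) (letters φ fun i => (emb i).toAlgHom.toLinearMap)
      (reducedLists I), f x = 0 := by
    suffices H : wordSup (coeffs jC) (letters φ fun i => (emb i).toAlgHom.toLinearMap)
        (reducedLists I) ≤ LinearMap.ker f from fun x hx => H hx
    refine wordSup_le fun r hr x hx => ?_
    rw [LinearMap.mem_ker, hfe, ← inner_conj_symm]
    have h1 : orbit ρ ξ x ∈ ⨆ r ∈ reducedLists I, hM.wordSpace ρ ξ r :=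
      (le_iSup₂_of_le r hr (Submodule.le_topologicalClosure _) :
        (hM.words r).map (orbit ρ ξ) ≤ _) (Submodule.mem_map_of_mem hx)
    have h2 : ⟪ρ x ξ, η⟫_ℂ = 0 := hη _ h1
    rw [h2, map_zero]
  have h1 : ∀ x, ⟪η, ρ x ξ⟫_ℂ = 0 := fun x => by
    rw [← hfe]
    have hc := continuous_sigmaWeak_of_mem_normalDual hf
    have hc0 : Continuous[sigmaWeak M, inferInstance] fun _ : M => (0 : ℂ) :=
      @continuous_const _ _ (sigmaWeak M) _ _
    exact congrFun (@Continuous.ext_on ℂ M _ (sigmaWeak M) _ _ (hM.dense_wordSup hφ) _ _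
      hc hc0 h0) x
  refine hρ.dense.eq_zero_of_inner_left (𝕜 := ℂ) ?_
  rintro _ ⟨x, rfl⟩
  exact h1 x

end FreeProduct

/-- **Theorem (vNfpcpuBB).**  Let `B` be a von Neumann algebra, `I` a set, and for every
`i ∈ I` let `A i` and `D i` be von Neumann algebras containing copies of `B` as unital
von Neumann subalgebras (via `jA i`, `jD i`), with normal conditional expectations
`φ i : A i → B` and `ψ i : D i → B` whose GNS representations are faithful.  Suppose
that for each `i ∈ I` there is a normal unital completely positive map
`θi i : A i → D i` that is also a `B`–`B`-bimodule map and satisfies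
`ψ i ∘ θi i = φ i`.  Let `(CA, EA) = (⋆̄_B)_{i ∈ I}(A i, φ i)` and
`(CD, ED) = (⋆̄_B)_{i ∈ I}(D i, ψ i)` be the amalgamated free products of von Neumann
algebras.  Then there is a *normal* unital completely positive map `θ : CA → CD` such
that the restriction of `θ` to the canonical copy of `A i` in `CA` equals `θi i`
followed by the canonical embedding `D i ↪ CD` for every `i ∈ I`, and
`θ (a 1 * ⋯ * a n) = θ (a 1) * ⋯ * θ (a n)` whenever `a j ∈ A (ι j)` with
`φ (ι j) (a j) = 0` and `ι 1 ≠ ι 2, …, ι (n-1) ≠ ι n`. -/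
theorem exists_vnAmalgProd_normal_ucp_map
    {I : Type*} (B : Type*) [CStarAlgebra B] [PartialOrder B] [StarOrderedRing B]
    [WStarAlgebra B] (A D : I → Type*) [∀ i, CStarAlgebra (A i)] [∀ i, PartialOrder (A i)]
    [∀ i, StarOrderedRing (A i)] [∀ i, WStarAlgebra (A i)] [∀ i, CStarAlgebra (D i)]
    [∀ i, PartialOrder (D i)] [∀ i, StarOrderedRing (D i)] [∀ i, WStarAlgebra (D i)]
    (jA : ∀ i, B →⋆ₐ[ℂ] A i) (jD : ∀ i, B →⋆ₐ[ℂ] D i)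
    (φ : ∀ i, A i →ₗ[ℂ] B) (ψ : ∀ i, D i →ₗ[ℂ] B)
    (hφ : ∀ i, IsCondExp (jA i) (φ i)) (hψ : ∀ i, IsCondExp (jD i) (ψ i))
    (hφnormal : ∀ i, IsNormalMap (φ i)) (hψnormal : ∀ i, IsNormalMap (ψ i))
    (hφfaith : ∀ i, FaithfulGNS (φ i)) (hψfaith : ∀ i, FaithfulGNS (ψ i))
    (θi : ∀ i, A i →ₗ[ℂ] D i) (hcp : ∀ i, IsCompletelyPositive (θi i))
    (hunital : ∀ i, θi i 1 = 1) (hθnormal : ∀ i, IsNormalMap (θi i))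
    (hbimod : ∀ i (b₁ b₂ : B) (a : A i),
      θi i (jA i b₁ * a * jA i b₂) = jD i b₁ * θi i a * jD i b₂)
    (hcompat : ∀ i (a : A i), ψ i (θi i a) = φ i a)
    {CA : Type*} [CStarAlgebra CA] [PartialOrder CA] [StarOrderedRing CA] [WStarAlgebra CA]
    (jCA : B →⋆ₐ[ℂ] CA) (embA : ∀ i, A i →⋆ₐ[ℂ] CA) (EA : CA →ₗ[ℂ] B)
    (hprodA : IsVNAmalgProd B jA φ jCA embA EA)
    {CD : Type*} [CStarAlgebra CD] [PartialOrder CD] [StarOrderedRing CD] [WStarAlgebra CD]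
    (jCD : B →⋆ₐ[ℂ] CD) (embD : ∀ i, D i →⋆ₐ[ℂ] CD) (ED : CD →ₗ[ℂ] B)
    (hprodD : IsVNAmalgProd B jD ψ jCD embD ED) :
    ∃ θ : CA →ₗ[ℂ] CD,
      IsCompletelyPositive θ ∧ θ 1 = 1 ∧ IsNormalMap θ ∧
      (∀ i (a : A i), θ (embA i a) = embD i (θi i a)) ∧
      (∀ (n : ℕ) (ι : Fin (n + 1) → I), (∀ k : Fin n, ι k.castSucc ≠ ι k.succ) →
        ∀ a : (j : Fin (n + 1)) → A (ι j), (∀ j, φ (ι j) (a j) = 0) →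
          θ ((List.ofFn fun j => embA (ι j) (a j)).prod) =
            (List.ofFn fun j => θ (embA (ι j) (a j))).prod) := by
  have hθ : IsUCPFamily jA jD φ ψ θi := ⟨hcp, hunital, hbimod, hcompat⟩
  choose H i₁ i₂ i₃ ρ ξ hρ using fun f : {f : B →ₗ[ℂ] ℂ // IsNormalPosFunctional f} =>
    exists_isGNS (hprodD.condExp.isPosFunctional_comp f.2) (comp_mem_normalDual hprodD.normal f.2)
  have hone : (1 : CA × CD) ∈ pairSup φ jCA jCD embA embD θi (reducedLists I) := by
    refine wordSpan_le_wordSup _ _ (s := []) List.isChain_nil ?_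
    rw [wordSpan_nil]
    exact (isWordSystem_pairs hφ hθ hprodA hprodD).one_mem
  have hdense : @Dense CA (sigmaWeak CA)
      ((pairSup φ jCA jCD embA embD θi (reducedLists I)).map (LinearMap.fst ℂ CA CD)) := by
    rw [map_fst_pairSup]
    exact hprodA.dense_wordSup hφ
  have hΦ : ∀ f (s : Finset (H f)),
      (s : Set (H f)) ⊆ (⨆ r ∈ reducedLists I, hprodD.wordSpace (ρ f) (ξ f) r : Submodule ℂ (H f)) →
      ∃ Φ : CA →ₗ[ℂ] (H f →L[ℂ] H f), IsCPOp Φ ∧ IsNormalOp Φ ∧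
        ∀ p ∈ pairSup φ jCA jCD embA embD θi (reducedLists I), ∀ h ∈ s, ∀ h' ∈ s,
          ⟪h, Φ p.1 h'⟫_ℂ = ⟪h, ρ f p.2 h'⟫_ℂ := fun f s hs => by
    obtain ⟨T, hT, hTt, hTs⟩ := exists_finset_subset_iSup _ s hs
    obtain ⟨Φ, hΦ, hΦn, hΦe⟩ := exists_isCPOp_finset hφ hψ hθ hprodA hprodD f.2 (hρ f) hφnormal
      hφfaith hθnormal T hT hTt
    exact ⟨Φ, hΦ, hΦn, fun p hp h hh h' hh' => hΦe p hp h (hTs h hh) h' (hTs h' hh')⟩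
  obtain ⟨θ, hθn, hθc, hθe⟩ := exists_normal_cp_extension hdense hone ρ (fun f => (hρ f).normal)
    (fun y hy => hprodD.faithful.eq_zero_of_forall hρ hy)
    (fun f => ⨆ r ∈ reducedLists I, hprodD.wordSpace (ρ f) (ξ f) r)
    (fun f => hprodD.dense_iSup_wordSpace hψ (hρ f)) hΦ
  have hemb : ∀ i a, θ (embA i a) = embD i (θi i a) := fun i a =>
    hθe _ (pairEmb_mem_pairSup hφ hθ hprodA hprodD i a)
  refine ⟨θ, hθc, hθe _ hone, hθn, hemb, fun n ι hι a ha => ?_⟩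
  let l : List (Σ i, A i) := List.ofFn fun j => ⟨ι j, a j⟩
  have hl : ∀ p ∈ l, φ p.1 p.2 = 0 := by
    intro p hp
    obtain ⟨j, rfl⟩ := List.mem_ofFn.mp hp
    exact ha j
  have hmem : (l.map fun p => pairEmb embA embD θi p.1 p.2).prod ∈
      pairSup φ jCA jCD embA embD θi (reducedLists I) := by
    refine wordSpan_le_wordSup _ _ ?_ (prod_map_mem_wordSpan (jCA.prod jCD) _ l hl)
    rw [reducedLists, Set.mem_setOf_eq, List.isChain_iff_getElem]
    intro k hk
    have h1 : k < n := by simpa [l] using hk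
    simp only [l, List.map_ofFn, List.getElem_ofFn]
    exact hι ⟨k, h1⟩
  have key := hθe _ hmem
  rw [← RingHom.coe_fst, ← RingHom.coe_snd, map_list_prod (RingHom.fst CA CD),
    map_list_prod (RingHom.snd CA CD)] at key
  simp only [l, List.map_ofFn, Function.comp_def] at key
  simp only [hemb]
  exact key
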